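/- Let n ≥ 2 and let (u,v) be a solution of Δu = u v², Δv = v u², u > 0, v > 0 on ℝⁿ satisfying the linear growth condition u(x) + v(x) ≤ C₀(1 + |x|) for some constant C₀ > 0. Then there exists a constant C > 0 such that 1/C ≤ J(r; 0) ≤ C for every r > 1, and moreover the limit lim_{r→∞} J(r; 0) exists and lies in (0, ∞). -/

import Mathlib

open MeasureTheory Metric
open scoped RealInnerProductSpace

noncomputable section

/-- The Laplacian of a function on Euclidean space, as the trace of the second derivative. -/
def lap {n : ℕ} (u : EuclideanSpace ℝ (Fin n) → ℝ) (x : EuclideanSpace ℝ (Fin n)) : ℝ :=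
  ∑ i : Fin n, iteratedFDeriv ℝ 2 u x (fun _ => EuclideanSpace.single i 1)

/-- A (positive classical) solution of the system Δu = u v², Δv = v u², u,v > 0 on ℝⁿ. -/
def IsSolution {n : ℕ} (u v : EuclideanSpace ℝ (Fin n) → ℝ) : Prop :=
  ContDiff ℝ (⊤ : ℕ∞) u ∧ ContDiff ℝ (⊤ : ℕ∞) v ∧ (∀ x, 0 < u x) ∧ (∀ x, 0 < v x) ∧
    (∀ x, lap u x = u x * v x ^ 2) ∧ (∀ x, lap v x = v x * u x ^ 2)

/-- The Alt–Caffarelli–Friedman quantity J(r; x). -/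
def Jfun {n : ℕ} (u v : EuclideanSpace ℝ (Fin n) → ℝ) (x : EuclideanSpace ℝ (Fin n)) (r : ℝ) :
    ℝ :=
  r ^ (-4 : ℝ) *
    ((∫ y in ball x r,
        (‖gradient u y‖ ^ 2 + (u y) ^ 2 * (v y) ^ 2) * ‖x - y‖ ^ ((2 : ℝ) - n)) *
     (∫ y in ball x r,
        (‖gradient v y‖ ^ 2 + (u y) ^ 2 * (v y) ^ 2) * ‖x - y‖ ^ ((2 : ℝ) - n)))

set_option linter.unusedSectionVars false

theorem exists_crossing {f : ℝ → ℝ} {A B t₀ t₁ : ℝ} (hf : ContinuousOn f (Set.Icc t₀ t₁))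
    (h01 : t₀ ≤ t₁) (h0 : A ≤ f t₀) (h1 : f t₁ ≤ B) (hBA : B < A) :
    ∃ s r, t₀ ≤ s ∧ s ≤ r ∧ r ≤ t₁ ∧ f s = A ∧ f r = B ∧
      ∀ x ∈ Set.Icc s r, B ≤ f x ∧ f x ≤ A := by
  -- the last time `s` with value at least `A`
  have hc1 : IsCompact (Set.Icc t₀ t₁ ∩ f ⁻¹' Set.Ici A) :=
    isCompact_Icc.of_isClosed_subset (hf.preimage_isClosed_of_isClosed isClosed_Icc isClosed_Ici)
      Set.inter_subset_left
  obtain ⟨s, ⟨⟨hs0, hs1⟩, hsA⟩, hs⟩ := hc1.exists_isGreatest ⟨t₀, ⟨le_rfl, h01⟩, h0⟩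
  have hf2 : ContinuousOn f (Set.Icc s t₁) := hf.mono (Set.Icc_subset_Icc_left hs0)
  have hc2 : IsCompact (Set.Icc s t₁ ∩ f ⁻¹' Set.Iic B) :=
    isCompact_Icc.of_isClosed_subset (hf2.preimage_isClosed_of_isClosed isClosed_Icc isClosed_Iic)
      Set.inter_subset_left
  obtain ⟨r, ⟨⟨hr0, hr1⟩, hrB⟩, hr⟩ := hc2.exists_isLeast ⟨t₁, ⟨hs1, le_rfl⟩, h1⟩
  simp only [Set.mem_preimage, Set.mem_Ici, Set.mem_Iic] at hsA hrB
  have hub : ∀ x, s < x → x ≤ t₁ → f x < A := by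
    intro x hx hx1
    by_contra! hcon
    exact absurd (hs ⟨⟨hs0.trans hx.le, hx1⟩, hcon⟩) (not_le.2 hx)
  have hlb : ∀ x, s ≤ x → x < r → B < f x := by
    intro x hx hx1
    by_contra! hcon
    exact absurd (hr ⟨⟨hx, hx1.le.trans hr1⟩, hcon⟩) (not_le.2 hx1)
  have hsA' : f s = A := by
    obtain ⟨y, hy, hyA⟩ := intermediate_value_Icc' hs1 hf2 ⟨(h1.trans hBA.le), hsA⟩
    rcases hy.1.eq_or_lt with h | h
    · rw [h, hyA]
    · exact absurd hyA (hub y h hy.2).ne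
  have hrB' : f r = B := by
    have hf3 : ContinuousOn f (Set.Icc s r) := hf2.mono (Set.Icc_subset_Icc_right hr1)
    obtain ⟨y, hy, hyB⟩ := intermediate_value_Icc' hr0 hf3 ⟨hrB, by rw [hsA']; exact hBA.le⟩
    rcases hy.2.eq_or_lt with h | h
    · rw [← h, hyB]
    · exact absurd hyB (hlb y hy.1 h).ne'
  refine ⟨s, r, hs0, hr0, hr1, hsA', hrB', fun x hx => ⟨?_, ?_⟩⟩
  · rcases hx.2.eq_or_lt with h | h
    · rw [h, hrB']
    · exact (hlb x hx.1 h).le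
  · rcases hx.1.eq_or_lt with h | h
    · rw [← h, hsA']
    · exact (hub x h (hx.2.trans hr1)).le

theorem le_of_hasDerivAt_nonneg {f f' : ℝ → ℝ} {s r : ℝ} (hsr : s ≤ r)
    (hf : ∀ t, HasDerivAt f (f' t) t) (h : ∀ t ∈ Set.Icc s r, 0 ≤ f' t) : f s ≤ f r := by
  have := monotoneOn_of_deriv_nonneg (convex_Icc s r)
    (fun x _ => (hf x).continuousAt.continuousWithinAt)
    (fun x _ => (hf x).differentiableAt.differentiableWithinAt)
    (fun x hx => by rw [(hf x).deriv]; exact h x (interior_subset hx))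
  exact this ⟨le_rfl, hsr⟩ ⟨hsr, le_rfl⟩ hsr

/-- The differential inequalities satisfied by the Gaussian averages of a segregated pair. -/
structure FlowData (a b X Y q N N' : ℝ → ℝ) : Prop where
  a_pos : ∀ t, 0 < a t
  b_pos : ∀ t, 0 < b t
  q_nonneg : ∀ t, 0 ≤ q t
  X_ge : ∀ t, -1 ≤ X t
  Y_ge : ∀ t, -1 ≤ Y t
  deriv_a : ∀ t, HasDerivAt a (2 * (a t * X t)) t
  deriv_b : ∀ t, HasDerivAt b (2 * (b t * Y t)) t
  deriv_N : ∀ t, HasDerivAt N (N' t) t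
  N_nonneg : ∀ t, 0 ≤ N t
  N_le : ∀ t, N t ≤ 1
  mean_le : ∀ t, a t * X t + b t * Y t ≤ q t
  N'_ge : ∀ t, 2 * (a t * b t) / (a t + b t) ^ 2 * (Y t - X t) ^ 2
    + 2 * (q t / (a t + b t)) ≤ N' t

namespace FlowData

variable {a b X Y q N N' : ℝ → ℝ}

theorem symm (h : FlowData a b X Y q N N') : FlowData b a Y X q N N' where
  a_pos := h.b_pos
  b_pos := h.a_pos
  q_nonneg := h.q_nonneg
  X_ge := h.Y_ge
  Y_ge := h.X_ge
  deriv_a := h.deriv_b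
  deriv_b := h.deriv_a
  deriv_N := h.deriv_N
  N_nonneg := h.N_nonneg
  N_le := h.N_le
  mean_le := fun t => by linarith [h.mean_le t]
  N'_ge := fun t => by
    have := h.N'_ge t
    rw [add_comm (b t), mul_comm (b t), show (X t - Y t) ^ 2 = (Y t - X t) ^ 2 by ring]
    exact this

theorem q_div_le (h : FlowData a b X Y q N N') (t : ℝ) : 2 * (q t / (a t + b t)) ≤ N' t := by
  have h1 := h.a_pos t
  have h2 := h.b_pos t
  have : 0 ≤ 2 * (a t * b t) / (a t + b t) ^ 2 * (Y t - X t) ^ 2 := by positivity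
  linarith [h.N'_ge t]

theorem N'_nonneg (h : FlowData a b X Y q N N') (t : ℝ) : 0 ≤ N' t := by
  have h1 := h.a_pos t
  have h2 := h.b_pos t
  have h3 := h.q_nonneg t
  have : 0 ≤ 2 * (q t / (a t + b t)) := by positivity
  linarith [h.q_div_le t]

theorem N_mono (h : FlowData a b X Y q N N') : Monotone N := fun _ _ hst =>
  le_of_hasDerivAt_nonneg hst h.deriv_N fun t _ => h.N'_nonneg t

theorem deriv_log_a (h : FlowData a b X Y q N N') (t : ℝ) :
    HasDerivAt (fun t => Real.log (a t)) (2 * X t) t := by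
  have := (h.deriv_a t).log (h.a_pos t).ne'
  convert this using 1
  have := (h.a_pos t).ne'
  field_simp

theorem add_le_exp_mul (h : FlowData a b X Y q N N') {s r : ℝ} (hsr : s ≤ r) :
    a r + b r ≤ Real.exp 1 * (a s + b s) := by
  have hp : ∀ t, 0 < a t + b t := fun t => add_pos (h.a_pos t) (h.b_pos t)
  have key := le_of_hasDerivAt_nonneg (f := fun t => N t - Real.log (a t + b t))
    (f' := fun t => N' t - (2 * (a t * X t) + 2 * (b t * Y t)) / (a t + b t)) hsr
    (fun t => (h.deriv_N t).sub (((h.deriv_a t).add (h.deriv_b t)).log (hp t).ne'))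
    (fun t _ => by
      have h1 := h.q_div_le t
      have h2 : (2 * (a t * X t) + 2 * (b t * Y t)) / (a t + b t) ≤ 2 * (q t / (a t + b t)) := by
        rw [← mul_div_assoc]
        exact div_le_div_of_nonneg_right (by linarith [h.mean_le t]) (hp t).le
      linarith)
  have h3 : Real.log (a r + b r) ≤ 1 + Real.log (a s + b s) := by
    linarith [h.N_le r, h.N_nonneg s]
  calc a r + b r = Real.exp (Real.log (a r + b r)) := (Real.exp_log (hp r)).symm
    _ ≤ Real.exp (1 + Real.log (a s + b s)) := Real.exp_le_exp.2 h3
    _ = _ := by rw [Real.exp_add, Real.exp_log (hp s)]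

/-- The improvement over the trivial bounds at scales where the masses at most multiply by `C₁`. -/
def Improves (a b X Y : ℝ → ℝ) (τ κ : ℝ) : Prop :=
  ∀ C₁ : ℝ, ∃ C : ℝ, 0 < C ∧ ∀ t, 0 ≤ t → a (t + τ) ≤ C₁ * a t → b (t + τ) ≤ C₁ * b t →
    (X t < 0 → -X t / (1 + 4 * -X t) - C * Real.exp (-κ * t) ≤ Y t) ∧
    (Y t < 0 → -Y t / (1 + 4 * -Y t) - C * Real.exp (-κ * t) ≤ X t)

theorem drift_of_small (h : FlowData a b X Y q N N') {t η : ℝ} (hη : 0 ≤ η)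
    (hsmall : 19 * b t ≤ a t) (himp : Y t < 0 → -Y t / (1 + 4 * -Y t) - η ≤ X t) :
    0 ≤ 2 * Y t - 2 * X t + 10 * N' t + 15 * η := by
  have ha := h.a_pos t
  have hb := h.b_pos t
  have hN := h.q_div_le t
  have hq : 0 ≤ q t / (a t + b t) := div_nonneg (h.q_nonneg t) (by positivity)
  have hm : a t * X t + b t * Y t ≤ q t := h.mean_le t
  set p := q t / (a t + b t) with hp
  have hqp : q t = p * (a t + b t) := by rw [hp]; field_simp
  by_cases hΔ : X t ≤ Y t
  · linarith
  push Not at hΔ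
  -- the average of `X` and `Y` with weight `θ`
  set θ := b t / (a t + b t) with hθ
  have hθ0 : 0 ≤ θ := by positivity
  have hθ1 : θ ≤ 1 / 20 := by
    rw [hθ, div_le_iff₀ (by positivity)]; linarith
  have hmean : X t + θ * (Y t - X t) ≤ p := by
    have : (X t + θ * (Y t - X t)) * (a t + b t) = a t * X t + b t * Y t := by
      rw [hθ]; field_simp; ring
    have h2 : (X t + θ * (Y t - X t)) * (a t + b t) ≤ p * (a t + b t) := by
      rw [this, ← hqp]; exact hm
    exact le_of_mul_le_mul_right h2 (by positivity)
  by_cases hY : 0 ≤ Y t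
  · nlinarith
  push Not at hY
  have h1 := himp hY
  have h5 : -Y t / 5 ≤ -Y t / (1 + 4 * -Y t) := by
    apply div_le_div_of_nonneg_left (by linarith) (by linarith) (by linarith [h.Y_ge t])
  nlinarith

theorem lower_bound_log_ratio (h : FlowData a b X Y q N N') {κ : ℝ} (hκ : 0 < κ)
    (himp : Improves a b X Y (Real.log 2) κ) :
    ∃ Λ T₀ : ℝ, 0 ≤ Λ ∧ 0 ≤ T₀ ∧ ∀ t, T₀ ≤ t → a t ≤ Real.exp Λ * b t := by
  obtain ⟨C, hC, hI⟩ := himp (2 * Real.exp 17)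
  set φ : ℝ → ℝ := fun t => Real.log (b t) - Real.log (a t) with hφ
  have hφd : ∀ t, HasDerivAt φ (2 * Y t - 2 * X t) t := fun t =>
    (h.symm.deriv_log_a t).sub (h.deriv_log_a t)
  have hφc : Continuous φ := continuous_iff_continuousAt.2 fun t => (hφd t).continuousAt
  have hba : ∀ t, b t = Real.exp (φ t) * a t := fun t => by
    rw [hφ]; simp only
    rw [Real.exp_sub, Real.exp_log (h.a_pos t), Real.exp_log (h.b_pos t),
      div_mul_cancel₀ _ (h.a_pos t).ne']
  obtain ⟨T₀, hT0, hT1⟩ : ∃ T₀ : ℝ, 0 ≤ T₀ ∧ 15 * (C / κ) * Real.exp (-κ * T₀) ≤ 1 := by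
    have : Filter.Tendsto (fun t : ℝ => 15 * (C / κ) * Real.exp (-κ * t)) Filter.atTop (nhds (15 * (C / κ) * 0)) := by
      apply Filter.Tendsto.const_mul
      apply Real.tendsto_exp_atBot.comp
      exact Filter.tendsto_id.const_mul_atTop_of_neg (by linarith)
    rw [mul_zero] at this
    obtain ⟨T, hT⟩ := ((this.eventually (ge_mem_nhds (zero_lt_one))).and
      (Filter.eventually_ge_atTop 0)).exists
    exact ⟨T, hT.2, hT.1⟩
  set Λ₁ := max 19 (-φ T₀) with hΛ
  have hΛ19 : 19 ≤ Λ₁ := le_max_left _ _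
  have hmain : ∀ t, T₀ ≤ t → -Λ₁ - 16 < φ t := by
    by_contra! hcon
    obtain ⟨t₁, ht1, hcon⟩ := hcon
    obtain ⟨s, r, hs, hsr, hr, hfs, hfr, hbd⟩ := exists_crossing (A := -Λ₁) hφc.continuousOn ht1
      (by linarith [le_max_right 19 (-φ T₀)]) hcon (by linarith)
    have hsm : ∀ x ∈ Set.Icc s r, 19 * b x ≤ a x := by
      intro x hx
      have hle : φ x ≤ -19 := (hbd x hx).2.trans (by linarith)
      have h2 : 19 * Real.exp (φ x) ≤ 1 := by
        have h3 : Real.exp (φ x) ≤ Real.exp (-19) := Real.exp_le_exp.2 hle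
        have h4 : Real.exp (-19) * Real.exp 19 = 1 := by rw [← Real.exp_add]; simp
        have h5 : (19:ℝ) ≤ Real.exp 19 := by linarith [Real.add_one_le_exp 19]
        nlinarith [Real.exp_pos (-19)]
      rw [hba x]; nlinarith [h.a_pos x]
    have ha2 : ∀ x ∈ Set.Icc s r, ∀ y ∈ Set.Icc s r, x ≤ y → a y ≤ 2 * Real.exp 1 * a x := by
      intro x hx y _ hxy
      have h1 := h.add_le_exp_mul hxy
      have h2 := hsm x hx
      have h3 := h.b_pos y
      have h4 := h.b_pos x
      nlinarith [Real.exp_pos 1]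
    have hlog2 : (0:ℝ) < Real.log 2 := Real.log_pos one_lt_two
    set w := max s (r - Real.log 2) with hw
    have hsw : s ≤ w := le_max_left _ _
    have hwr : w ≤ r := max_le hsr (by linarith)
    have hrw : r - w ≤ Real.log 2 := by linarith [le_max_right s (r - Real.log 2)]
    -- drop on the last window
    have hdrop2 : φ w - 4 ≤ φ r := by
      have h1 := le_of_hasDerivAt_nonneg (f := fun t => Real.log (b t) + 2 * t)
        (f' := fun t => 2 * Y t + 2 * 1) hwr
        (fun t => (h.symm.deriv_log_a t).add ((hasDerivAt_id t).const_mul 2))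
        (fun t _ => by linarith [h.Y_ge t])
      have h2 := ha2 w ⟨hsw, hwr⟩ r ⟨hsr, le_rfl⟩ hwr
      have h3 : Real.log (a r) ≤ Real.log 2 + 1 + Real.log (a w) := by
        have := Real.log_le_log (h.a_pos r) h2
        rwa [Real.log_mul (by positivity) (h.a_pos w).ne', Real.log_mul (by norm_num)
          (Real.exp_pos 1).ne', Real.log_exp] at this
      have h4 := Real.log_two_lt_d9
      simp only [hφ] at h1 ⊢
      linarith
    have hdrop1 : φ s - 10.9 ≤ φ w + 0.1 := by
      rcases le_or_gt (r - Real.log 2) s with hle | hlt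
      · rw [hw, max_eq_left hle]; linarith
      have hwe : w = r - Real.log 2 := max_eq_right hlt.le
      have hE : ∀ t, HasDerivAt (fun t => Real.exp (-κ * t)) (Real.exp (-κ * t) * (-κ * 1)) t :=
        fun t => ((hasDerivAt_id t).const_mul (-κ)).exp
      have h1 := le_of_hasDerivAt_nonneg
        (f := fun t => φ t + 10 * N t - 15 * (C / κ) * Real.exp (-κ * t))
        (f' := fun t => 2 * Y t - 2 * X t + 10 * N' t
          - 15 * (C / κ) * (Real.exp (-κ * t) * (-κ * 1))) hsw
        (fun t => ((hφd t).add ((h.deriv_N t).const_mul 10)).sub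
          ((hE t).const_mul (15 * (C / κ))))
        (fun t ht => by
          have htr : t + Real.log 2 ∈ Set.Icc s r := ⟨by linarith [ht.1], by linarith [ht.2]⟩
          have htm : t ∈ Set.Icc s r := ⟨ht.1, ht.2.trans hwr⟩
          have haa := ha2 t htm _ htr (by linarith)
          have e17 : Real.exp 17 = Real.exp 1 * Real.exp 16 := by rw [← Real.exp_add]; norm_num
          have e1 : 1 ≤ Real.exp 16 := Real.one_le_exp (by norm_num)
          have hA : a (t + Real.log 2) ≤ 2 * Real.exp 17 * a t := by
            refine haa.trans ?_
            rw [e17]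
            have := mul_pos (Real.exp_pos 1) (h.a_pos t)
            nlinarith
          have hB : b (t + Real.log 2) ≤ 2 * Real.exp 17 * b t := by
            rw [hba t, hba (t + Real.log 2), e17]
            have h1 : Real.exp (φ (t + Real.log 2)) ≤ Real.exp 16 * Real.exp (φ t) := by
              rw [← Real.exp_add]
              apply Real.exp_le_exp.2
              linarith [(hbd t htm).1, (hbd _ htr).2]
            calc Real.exp (φ (t + Real.log 2)) * a (t + Real.log 2)
                ≤ (Real.exp 16 * Real.exp (φ t)) * (2 * Real.exp 1 * a t) :=
                  mul_le_mul h1 haa (h.a_pos _).le (by positivity)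
              _ = _ := by ring
          have h2 := h.drift_of_small (t := t) (η := C * Real.exp (-κ * t)) (by positivity)
            (hsm t htm) (hI t (by linarith [ht.1]) hA hB).2
          have h3 : 15 * (C / κ) * (Real.exp (-κ * t) * (-κ * 1))
              = - (15 * (C * Real.exp (-κ * t))) := by field_simp
          rw [h3]; linarith)
      have h2 : 15 * (C / κ) * Real.exp (-κ * s) ≤ 1 := by
        refine le_trans ?_ hT1
        have : Real.exp (-κ * s) ≤ Real.exp (-κ * T₀) := Real.exp_le_exp.2 (by nlinarith)
        gcongr
      have h3 : 0 ≤ 15 * (C / κ) * Real.exp (-κ * w) := by positivity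
      linarith [h.N_nonneg s, h.N_le w]
    linarith
  refine ⟨Λ₁ + 16, T₀, by linarith, hT0, fun t ht => ?_⟩
  rw [hba t, ← mul_assoc, ← Real.exp_add]
  have : 1 ≤ Real.exp (Λ₁ + 16 + φ t) := Real.one_le_exp (by linarith [hmain t ht])
  nlinarith [h.a_pos t]

theorem drift_of_balanced (h : FlowData a b X Y q N N') {t η m : ℝ} (hη : 0 ≤ η) (hm : 0 < m)
    (hma : m * (a t + b t) ≤ a t) (hmb : m * (a t + b t) ≤ b t)
    (himp : (X t < 0 → -X t / (1 + 4 * -X t) - η ≤ Y t) ∧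
      (Y t < 0 → -Y t / (1 + 4 * -Y t) - η ≤ X t)) :
    0 ≤ 2 * X t + 2 * Y t + 8 / m ^ 2 * N' t + 2 * (8 * η ^ 2 + η) := by
  have aux : ∀ x y : ℝ, -1 ≤ x → x < 0 → -x / (1 + 4 * -x) - η ≤ y →
      -(8 * (y - x) ^ 2) - (8 * η ^ 2 + η) ≤ x + y := by
    intro x y hx hx0 hy
    have h1 : 0 ≤ -x / (1 + 4 * -x) := div_nonneg (by linarith) (by linarith)
    have h2 : -x - 4 * x ^ 2 ≤ -x / (1 + 4 * -x) := by
      rw [le_div_iff₀ (by linarith)]; nlinarith [mul_nonneg (neg_nonneg.2 hx0.le) (sq_nonneg x)]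
    have h3 : x ^ 2 ≤ ((y - x) + η) ^ 2 := by
      rw [← neg_sq x]; exact pow_le_pow_left₀ (by linarith) (by linarith) 2
    nlinarith [sq_nonneg (y - x - η)]
  have ha := h.a_pos t
  have hb := h.b_pos t
  have hmain : -(8 * (Y t - X t) ^ 2) - (8 * η ^ 2 + η) ≤ X t + Y t := by
    by_cases hX : X t < 0
    · exact aux _ _ (h.X_ge t) hX (himp.1 hX)
    by_cases hY : Y t < 0
    · have := aux _ _ (h.Y_ge t) hY (himp.2 hY)
      nlinarith
    push Not at hX hY
    nlinarith [sq_nonneg (Y t - X t)]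
  have hN : 2 * m ^ 2 * (Y t - X t) ^ 2 ≤ N' t := by
    have h1 := h.N'_ge t
    have h2 : 0 ≤ 2 * (q t / (a t + b t)) := by have := h.q_nonneg t; positivity
    have h3 : 2 * m ^ 2 ≤ 2 * (a t * b t) / (a t + b t) ^ 2 := by
      rw [le_div_iff₀ (by positivity)]
      have := mul_le_mul hma hmb (by positivity) ha.le
      nlinarith
    have := mul_le_mul_of_nonneg_right h3 (sq_nonneg (Y t - X t))
    linarith
  have h4 : 16 * (Y t - X t) ^ 2 ≤ 8 / m ^ 2 * N' t := by
    have := mul_le_mul_of_nonneg_left hN (show 0 ≤ 8 / m ^ 2 by positivity)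
    refine le_trans (le_of_eq ?_) this
    field_simp
    ring
  linarith

theorem exists_limit (h : FlowData a b X Y q N N') {κ K : ℝ} (hκ : 0 < κ)
    (haK : ∀ t, 0 ≤ t → a t ≤ K) (hbK : ∀ t, 0 ≤ t → b t ≤ K)
    (himp : Improves a b X Y (Real.log 2) κ) :
    ∃ L : ℝ, 0 < L ∧ Filter.Tendsto (fun t => a t * b t) Filter.atTop (nhds L) := by
  obtain ⟨Λ, T, hΛ, hT, hr⟩ := h.lower_bound_log_ratio hκ himp
  obtain ⟨Λ', T', hΛ', hT', hr'⟩ := h.symm.lower_bound_log_ratio hκ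
    (fun C₁ => by
      obtain ⟨C, hC, h1⟩ := himp C₁
      exact ⟨C, hC, fun t ht hb ha => (h1 t ht ha hb).symm⟩)
  set E := 1 + Real.exp Λ + Real.exp Λ' with hE
  have hE0 : 0 < E := by positivity
  obtain ⟨C, hC, hI⟩ := himp (Real.exp 1 * E)
  set S := max T T' with hS
  have hS0 : 0 ≤ S := hT.trans (le_max_left _ _)
  have hab : ∀ t, S ≤ t → a t + b t ≤ E * b t ∧ a t + b t ≤ E * a t := by
    intro t ht
    have h1 := hr t ((le_max_left _ _).trans ht)
    have h2 := hr' t ((le_max_right _ _).trans ht)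
    have := mul_pos (Real.exp_pos Λ) (h.a_pos t)
    have := mul_pos (Real.exp_pos Λ') (h.b_pos t)
    constructor <;> rw [hE] <;> linarith
  have hlog2 : (0:ℝ) < Real.log 2 := Real.log_pos one_lt_two
  set c := 8 / E⁻¹ ^ 2 with hc
  have hc0 : 0 ≤ c := by positivity
  set D := 2 * (8 * C ^ 2 + C) / κ with hD
  have hD0 : 0 ≤ D := by positivity
  set G : ℝ → ℝ := fun t => Real.log (a t) + Real.log (b t) + c * N t - D * Real.exp (-κ * t)
    with hG
  have hexp : ∀ t, HasDerivAt (fun t => Real.exp (-κ * t)) (Real.exp (-κ * t) * (-κ * 1)) t :=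
    fun t => ((hasDerivAt_id t).const_mul (-κ)).exp
  have hmono : MonotoneOn G (Set.Ici S) := by
    intro s hs r _ hsr
    refine le_of_hasDerivAt_nonneg
      (f' := fun t => 2 * X t + 2 * Y t + c * N' t - D * (Real.exp (-κ * t) * (-κ * 1))) hsr
      (fun t => (((h.deriv_log_a t).add (h.symm.deriv_log_a t)).add
        ((h.deriv_N t).const_mul c)).sub ((hexp t).const_mul D)) (fun t ht => ?_)
    have hSt : S ≤ t := (Set.mem_Ici.1 hs).trans ht.1
    obtain ⟨h1, h2⟩ := hab t hSt
    have h3 := h.add_le_exp_mul (show t ≤ t + Real.log 2 by linarith)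
    have h4 := hI t (hS0.trans hSt)
      (by
        have := mul_le_mul_of_nonneg_left h2 (Real.exp_pos 1).le
        linarith [h.b_pos (t + Real.log 2)])
      (by
        have := mul_le_mul_of_nonneg_left h1 (Real.exp_pos 1).le
        linarith [h.a_pos (t + Real.log 2)])
    have h5 := h.drift_of_balanced (η := C * Real.exp (-κ * t)) (m := E⁻¹) (by positivity)
      (by positivity)
      (by rw [inv_mul_le_iff₀ hE0]; exact h2) (by rw [inv_mul_le_iff₀ hE0]; exact h1) h4
    have h6 : (C * Real.exp (-κ * t)) ^ 2 ≤ C ^ 2 * Real.exp (-κ * t) := by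
      rw [mul_pow]
      have : Real.exp (-κ * t) ≤ 1 := Real.exp_le_one_iff.2 (by nlinarith)
      have h0 := Real.exp_pos (-κ * t)
      gcongr
      nlinarith
    have h7 : D * (Real.exp (-κ * t) * (-κ * 1)) = -(2 * (8 * C ^ 2 + C) * Real.exp (-κ * t)) := by
      rw [hD]; field_simp
    rw [h7]
    linarith
  have hN1 : Filter.Tendsto N Filter.atTop (nhds (⨆ t, N t)) :=
    tendsto_atTop_ciSup h.N_mono ⟨1, by rintro _ ⟨t, rfl⟩; exact h.N_le t⟩
  -- extend `G` to a monotone function on the line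
  have hGm : Monotone fun t => G (max S t) := fun s r hsr =>
    hmono (Set.mem_Ici.2 (le_max_left _ _)) (Set.mem_Ici.2 (le_max_left _ _)) (max_le_max le_rfl hsr)
  have hGb : BddAbove (Set.range fun t => G (max S t)) := by
    refine ⟨Real.log K + Real.log K + c, ?_⟩
    rintro _ ⟨t, rfl⟩
    have h0 : 0 ≤ max S t := hS0.trans (le_max_left _ _)
    have h1 := Real.log_le_log (h.a_pos _) (haK _ h0)
    have h2 := Real.log_le_log (h.b_pos _) (hbK _ h0)
    have h3 : 0 ≤ D * Real.exp (-κ * max S t) := by positivity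
    have h4 := mul_le_mul_of_nonneg_left (h.N_le (max S t)) hc0
    simp only [hG]
    linarith
  have hG1 := tendsto_atTop_ciSup hGm hGb
  have hexp0 : Filter.Tendsto (fun t : ℝ => Real.exp (-κ * t)) Filter.atTop (nhds 0) :=
    Real.tendsto_exp_atBot.comp (Filter.tendsto_id.const_mul_atTop_of_neg (by linarith))
  have hG2 : Filter.Tendsto G Filter.atTop (nhds (⨆ t, G (max S t))) :=
    hG1.congr' ((Filter.eventually_ge_atTop S).mono fun t ht => by simp only [max_eq_right ht])
  have hP := (hG2.sub (hN1.const_mul c)).add (hexp0.const_mul D)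
  refine ⟨_, Real.exp_pos _, ((Real.continuous_exp.tendsto _).comp hP).congr fun t => ?_⟩
  have : G t - c * N t + D * Real.exp (-κ * t) = Real.log (a t) + Real.log (b t) := by
    simp only [hG]; ring
  rw [Function.comp, this, Real.exp_add, Real.exp_log (h.a_pos t), Real.exp_log (h.b_pos t)]

end FlowData

section Gaussian

open ProbabilityTheory Module

variable {E : Type*} [NormedAddCommGroup E] [InnerProductSpace ℝ E] [FiniteDimensional ℝ E]
  [MeasurableSpace E] [BorelSpace E]

/-- The density of the standard Gaussian measure. -/
def gaussDens (y : E) : ℝ := (2 * Real.pi) ^ (-(finrank ℝ E : ℝ) / 2) * Real.exp (-‖y‖ ^ 2 / 2)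

theorem gaussDens_pos (y : E) : 0 < gaussDens y := by unfold gaussDens; positivity

theorem continuous_gaussDens : Continuous (gaussDens : E → ℝ) := by unfold gaussDens; fun_prop

theorem integrable_exp_neg_mul_sq_norm {β : ℝ} (hβ : 0 < β) :
    Integrable (fun v : E => Real.exp (-β * ‖v‖ ^ 2)) := by
  have := (GaussianFourier.integrable_cexp_neg_mul_sq_norm_add (V := E)
    (show 0 < (β : ℂ).re from hβ) 0 0).norm
  refine this.congr (ae_of_all _ fun v => ?_)
  simp only [Complex.norm_exp]
  congr 1
  simp [← Complex.ofReal_pow]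

theorem integrable_gaussDens : Integrable (gaussDens : E → ℝ) := by
  refine ((integrable_exp_neg_mul_sq_norm (E := E) (one_half_pos)).const_mul
    ((2 * Real.pi) ^ (-(finrank ℝ E : ℝ) / 2))).congr (ae_of_all _ fun v => ?_)
  unfold gaussDens
  ring_nf

theorem stdGaussian_eq_withDensity :
    stdGaussian E = volume.withDensity fun y => ENNReal.ofReal (gaussDens y) := by
  have : IsFiniteMeasure (volume.withDensity fun y : E => ENNReal.ofReal (gaussDens y)) :=
    isFiniteMeasure_withDensity_ofReal integrable_gaussDens.2
  apply Measure.ext_of_charFun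
  ext t
  rw [charFun_stdGaussian, charFun_apply, integral_withDensity_eq_integral_toReal_smul
    continuous_gaussDens.measurable.ennreal_ofReal (by simp)]
  have h := GaussianFourier.integral_cexp_neg_mul_sq_norm_add (V := E)
    (b := (1 / 2 : ℝ)) (by norm_num) Complex.I t
  have h2 : ∀ y : E, (ENNReal.ofReal (gaussDens y)).toReal • Complex.exp (⟪y, t⟫ * Complex.I)
      = ((2 * Real.pi) ^ (-(finrank ℝ E : ℝ) / 2) : ℝ) *
        Complex.exp (-((1 / 2 : ℝ) : ℂ) * ‖y‖ ^ 2 + Complex.I * ⟪t, y⟫) := by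
    intro y
    rw [ENNReal.toReal_ofReal (gaussDens_pos y).le, gaussDens, Complex.real_smul, Complex.ofReal_mul,
      Complex.exp_add, mul_assoc, real_inner_comm]
    push_cast
    ring_nf
  simp_rw [h2]
  rw [integral_const_mul, h, ← mul_assoc]
  have h3 : (((2 * Real.pi) ^ (-(finrank ℝ E : ℝ) / 2) : ℝ) : ℂ) *
      (Real.pi / (1 / 2 : ℝ) : ℂ) ^ (finrank ℝ E / 2 : ℂ) = 1 := by
    have : ((Real.pi / (1 / 2 : ℝ) : ℂ)) ^ (finrank ℝ E / 2 : ℂ)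
        = (((2 * Real.pi) ^ ((finrank ℝ E : ℝ) / 2) : ℝ) : ℂ) := by
      rw [Complex.ofReal_cpow (by positivity)]
      push_cast
      congr 1
      field_simp
    rw [this, ← Complex.ofReal_mul, ← Real.rpow_add (by positivity)]
    simp [neg_div]
  rw [h3, one_mul, Complex.I_sq]
  congr 1
  push_cast
  ring

variable {F : Type*} [NormedAddCommGroup F] [NormedSpace ℝ F]

theorem integral_stdGaussian (f : E → F) :
    ∫ y, f y ∂(stdGaussian E) = ∫ y, gaussDens y • f y := by
  rw [stdGaussian_eq_withDensity, integral_withDensity_eq_integral_toReal_smul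
    continuous_gaussDens.measurable.ennreal_ofReal (by simp)]
  simp_rw [ENNReal.toReal_ofReal (gaussDens_pos _).le]

theorem integrable_stdGaussian_iff {f : E → F} :
    Integrable f (stdGaussian E) ↔ Integrable fun y => gaussDens y • f y := by
  rw [stdGaussian_eq_withDensity, integrable_withDensity_iff_integrable_smul'
    continuous_gaussDens.measurable.ennreal_ofReal (by simp)]
  simp_rw [ENNReal.toReal_ofReal (gaussDens_pos _).le]

theorem measurePreserving_rotation (θ : ℝ) :
    MeasurePreserving (fun p : E × E => (Real.cos θ • p.1 + Real.sin θ • p.2,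
      -Real.sin θ • p.1 + Real.cos θ • p.2))
      ((stdGaussian E).prod (stdGaussian E)) ((stdGaussian E).prod (stdGaussian E)) := by
  refine ⟨by fun_prop, ?_⟩
  have := IsGaussian.map_rotation_eq_self (μ := stdGaussian E) (by simp [integral_id_stdGaussian]) θ
  convert this using 2
  ext p : 1
  simp [ContinuousLinearMap.rotation_apply]

theorem measurePreserving_neg_stdGaussian :
    MeasurePreserving (fun x : E => -x) (stdGaussian E) (stdGaussian E) := by
  refine ⟨by fun_prop, ?_⟩
  have := stdGaussian_map (LinearIsometryEquiv.neg ℝ (E := E))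
  exact this

/-- The reflection exchanging `x` and `cos θ x + sin θ z`. -/
theorem measurePreserving_reflection (θ : ℝ) :
    MeasurePreserving (fun p : E × E => (Real.cos θ • p.1 + Real.sin θ • p.2,
      Real.sin θ • p.1 - Real.cos θ • p.2))
      ((stdGaussian E).prod (stdGaussian E)) ((stdGaussian E).prod (stdGaussian E)) := by
  have h := ((MeasurePreserving.id (stdGaussian E)).prod
    (measurePreserving_neg_stdGaussian (E := E))).comp (measurePreserving_rotation θ)
  convert h using 1
  ext p : 1
  simp [Prod.map, sub_eq_add_neg, add_comm]

theorem integral_comp_reflection {f : E × E → F} (hf : Continuous f) (θ : ℝ) :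
    ∫ p, f (Real.cos θ • p.1 + Real.sin θ • p.2, Real.sin θ • p.1 - Real.cos θ • p.2)
      ∂((stdGaussian E).prod (stdGaussian E)) = ∫ p, f p ∂((stdGaussian E).prod (stdGaussian E)) := by
  have h := measurePreserving_reflection (E := E) θ
  have h2 := integral_map (μ := (stdGaussian E).prod (stdGaussian E)) h.measurable.aemeasurable
    (f := f) hf.aestronglyMeasurable
  rw [h.map_eq] at h2
  exact h2.symm

theorem integral_comp_rotation {f : E × E → F} (hf : Continuous f) (θ : ℝ) :
    ∫ p, f (Real.cos θ • p.1 + Real.sin θ • p.2, -Real.sin θ • p.1 + Real.cos θ • p.2)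
      ∂((stdGaussian E).prod (stdGaussian E)) = ∫ p, f p ∂((stdGaussian E).prod (stdGaussian E)) := by
  have h := measurePreserving_rotation (E := E) θ
  have h2 := integral_map (μ := (stdGaussian E).prod (stdGaussian E)) h.measurable.aemeasurable
    (f := f) hf.aestronglyMeasurable
  rw [h.map_eq] at h2
  exact h2.symm

end Gaussian

section Mehler

open ProbabilityTheory Module

variable {E : Type*} [NormedAddCommGroup E] [InnerProductSpace ℝ E] [FiniteDimensional ℝ E]
  [MeasurableSpace E] [BorelSpace E]
  {F : Type*} [NormedAddCommGroup F] [InnerProductSpace ℝ F] [CompleteSpace F]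

local notation "γ" => stdGaussian E

theorem sq_integral_inner_le {α : Type*} [MeasurableSpace α] {μ : Measure α} {f g : α → F}
    (hf : MemLp f 2 μ) (hg : MemLp g 2 μ) :
    (∫ x, ⟪f x, g x⟫ ∂μ) ^ 2 ≤ (∫ x, ‖f x‖ ^ 2 ∂μ) * ∫ x, ‖g x‖ ^ 2 ∂μ := by
  have h0 : ∀ {f g : α → F} (hf : MemLp f 2 μ) (hg : MemLp g 2 μ),
      ⟪hf.toLp f, hg.toLp g⟫ = ∫ x, ⟪f x, g x⟫ ∂μ := by
    intro f g hf hg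
    rw [L2.inner_def]
    apply integral_congr_ae
    filter_upwards [hf.coeFn_toLp, hg.coeFn_toLp] with x h1 h2
    rw [h1, h2]
  have h := real_inner_mul_inner_self_le (hf.toLp f) (hg.toLp g)
  rw [h0 hf hg, h0 hf hf, h0 hg hg] at h
  simp_rw [real_inner_self_eq_norm_sq] at h
  rw [sq]; exact h

theorem integrable_of_continuous_bdd {α G : Type*} [MeasurableSpace α] [TopologicalSpace α]
    [OpensMeasurableSpace α] [SecondCountableTopology α] [NormedAddCommGroup G]
    {μ : Measure α} [IsFiniteMeasure μ] {f : α → G} [SecondCountableTopologyEither α G]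
    (hf : Continuous f) {M : ℝ} (hb : ∀ x, ‖f x‖ ≤ M) : Integrable f μ :=
  Integrable.of_bound hf.aestronglyMeasurable M (ae_of_all _ hb)

theorem norm_inner_le_of_bdd {f g : E → F} {M K : ℝ} (hf : ∀ x, ‖f x‖ ≤ M) (hg : ∀ x, ‖g x‖ ≤ K)
    (x y : E) : ‖(⟪f x, g y⟫ : ℝ)‖ ≤ M * K :=
  (norm_inner_le_norm _ _).trans
    (mul_le_mul (hf x) (hg y) (norm_nonneg _) ((norm_nonneg _).trans (hf x)))

/-- The Mehler transform, with correlation `cos θ`. -/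
def mehler (g : E → F) (θ : ℝ) (x : E) : F :=
  ∫ z, g (Real.cos θ • x + Real.sin θ • z) ∂γ

theorem norm_mehler_le {g : E → F} {M : ℝ} (hb : ∀ x, ‖g x‖ ≤ M) (θ : ℝ) (x : E) :
    ‖mehler g θ x‖ ≤ M := by
  have := norm_integral_le_of_norm_le_const (μ := γ)
    (ae_of_all _ fun z => hb (Real.cos θ • x + Real.sin θ • z))
  simpa [mehler] using this

theorem continuous_mehler {g : E → F} {M : ℝ} (hg : Continuous g) (hb : ∀ x, ‖g x‖ ≤ M) (θ : ℝ) :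
    Continuous (mehler g θ) := by
  unfold mehler
  refine continuous_of_dominated (bound := fun _ => M) (fun x => ?_)
    (fun x => ae_of_all _ fun z => hb _) (integrable_const _) (ae_of_all _ fun z => ?_)
  · exact Continuous.aestronglyMeasurable (by fun_prop)
  · fun_prop

theorem integral_inner_mehler {f g : E → F} {M K : ℝ} (hf : Continuous f) (hfb : ∀ x, ‖f x‖ ≤ M)
    (hg : Continuous g) (hgb : ∀ x, ‖g x‖ ≤ K) (θ : ℝ) :
    ∫ x, ⟪f x, mehler g θ x⟫ ∂γ
      = ∫ p, ⟪f p.1, g (Real.cos θ • p.1 + Real.sin θ • p.2)⟫ ∂(Measure.prod γ γ) := by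
  rw [integral_prod]
  · refine integral_congr_ae (ae_of_all _ fun x => ?_)
    simp only [mehler]
    rw [integral_inner]
    exact integrable_of_continuous_bdd (by fun_prop) (fun z => hgb _)
  · exact integrable_of_continuous_bdd (M := M * K) (by fun_prop)
      (fun p => norm_inner_le_of_bdd hfb hgb _ _)

theorem integral_inner_mehler_comm {f g : E → F} {M K : ℝ} (hf : Continuous f)
    (hfb : ∀ x, ‖f x‖ ≤ M) (hg : Continuous g) (hgb : ∀ x, ‖g x‖ ≤ K) (θ : ℝ) :
    ∫ x, ⟪f x, mehler g θ x⟫ ∂γ = ∫ x, ⟪mehler f θ x, g x⟫ ∂γ := by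
  simp_rw [real_inner_comm (g _)]
  rw [integral_inner_mehler hf hfb hg hgb, integral_inner_mehler hg hgb hf hfb]
  rw [← integral_comp_reflection (f := fun p : E × E =>
    ⟪f p.1, g (Real.cos θ • p.1 + Real.sin θ • p.2)⟫) (by fun_prop) θ]
  refine integral_congr_ae (ae_of_all _ fun p => ?_)
  simp only
  rw [real_inner_comm]
  congr 2
  rw [smul_add, smul_sub, smul_smul, smul_smul, smul_smul, smul_smul]
  have h1 : Real.cos θ * Real.cos θ + Real.sin θ * Real.sin θ = 1 := by
    have := Real.sin_sq_add_cos_sq θ; nlinarith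
  calc _ = (Real.cos θ * Real.cos θ + Real.sin θ * Real.sin θ) • p.1 := by
        rw [mul_comm (Real.sin θ) (Real.cos θ)]; module
    _ = p.1 := by rw [h1, one_smul]

theorem integral_comp_add {g : E → F} {M : ℝ} (hg : Continuous g) (hb : ∀ x, ‖g x‖ ≤ M)
    (α β : ℝ) :
    ∫ z, ∫ w, g (α • z + β • w) ∂γ ∂γ = ∫ z, g (Real.sqrt (α ^ 2 + β ^ 2) • z) ∂γ := by
  set ψ := Complex.arg ⟨α, β⟩ with hψ
  set r := Real.sqrt (α ^ 2 + β ^ 2) with hr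
  have hn : ‖(⟨α, β⟩ : ℂ)‖ = r := by
    rw [Complex.norm_def, Complex.normSq_mk, hr]; ring_nf
  have h1 : r * Real.cos ψ = α := by rw [← hn, hψ, Complex.norm_mul_cos_arg]
  have h2 : r * Real.sin ψ = β := by rw [← hn, hψ, Complex.norm_mul_sin_arg]
  rw [← integral_prod (f := fun p : E × E => g (α • p.1 + β • p.2))
    (integrable_of_continuous_bdd (by fun_prop) (fun p => hb _))]
  have h3 := integral_comp_rotation (f := fun p : E × E => g (r • p.1)) (by fun_prop) ψ
  rw [integral_prod (f := fun p : E × E => g (r • p.1))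
    (integrable_of_continuous_bdd (by fun_prop) (fun p => hb _))] at h3
  simp only [integral_const, probReal_univ, one_smul, smul_add, smul_smul, h1, h2] at h3
  exact h3

theorem mehler_mehler {g : E → F} {M : ℝ} (hg : Continuous g) (hb : ∀ x, ‖g x‖ ≤ M) {c : ℝ}
    (hc : c ∈ Set.Icc (0 : ℝ) 1) (x : E) :
    mehler (mehler g (Real.arccos c)) (Real.arccos c) x = mehler g (Real.arccos (c ^ 2)) x := by
  unfold mehler
  have hc1 : c ^ 2 ≤ 1 := by nlinarith [hc.1, hc.2]
  rw [Real.cos_arccos (by linarith [hc.1]) hc.2, Real.sin_arccos,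
    Real.cos_arccos (by nlinarith) hc1, Real.sin_arccos]
  set s := Real.sqrt (1 - c ^ 2) with hs
  have h := integral_comp_add (E := E) (g := fun w => g ((c * c) • x + w)) (by fun_prop)
    (fun x => hb _) (c * s) s
  have h2 : (c * s) ^ 2 + s ^ 2 = 1 - (c ^ 2) ^ 2 := by
    rw [mul_pow, hs, Real.sq_sqrt (by linarith)]; ring
  rw [h2] at h
  have e : ∀ z w : E, g (c • (c • x + s • z) + s • w)
      = g ((c * c) • x + ((c * s) • z + s • w)) := fun z w => by
    simp only [smul_add, smul_smul, add_assoc]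
  simp_rw [e]
  rw [h]
  simp only [sq]

/-- The autocorrelation of `g` under the Mehler transform with correlation `c`. -/
def gaussCorr (g : E → F) (c : ℝ) : ℝ := ∫ x, ⟪g x, mehler g (Real.arccos c) x⟫ ∂γ

theorem integral_norm_sq_mehler {g : E → F} {M : ℝ} (hg : Continuous g) (hb : ∀ x, ‖g x‖ ≤ M)
    {c : ℝ} (hc : c ∈ Set.Icc (0 : ℝ) 1) :
    ∫ x, ‖mehler g (Real.arccos c) x‖ ^ 2 ∂γ = gaussCorr g (c ^ 2) := by
  unfold gaussCorr
  simp_rw [← mehler_mehler hg hb hc, ← real_inner_self_eq_norm_sq]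
  exact (integral_inner_mehler_comm hg hb (continuous_mehler hg hb _) (norm_mehler_le hb _) _).symm

theorem gaussCorr_one (g : E → F) : gaussCorr g 1 = ∫ x, ‖g x‖ ^ 2 ∂γ := by
  simp [gaussCorr, mehler]

theorem memLp_two_of_continuous_bdd {g : E → F} {M : ℝ} (hg : Continuous g)
    (hb : ∀ x, ‖g x‖ ≤ M) : MemLp g 2 γ :=
  MemLp.of_bound hg.aestronglyMeasurable M (ae_of_all _ hb)

theorem gaussCorr_sq_le {g : E → F} {M : ℝ} (hg : Continuous g) (hb : ∀ x, ‖g x‖ ≤ M)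
    {c : ℝ} (hc : c ∈ Set.Icc (0 : ℝ) 1) :
    gaussCorr g c ^ 2 ≤ gaussCorr g 1 * gaussCorr g (c ^ 2) := by
  rw [← integral_norm_sq_mehler hg hb hc, gaussCorr_one]
  exact sq_integral_inner_le (memLp_two_of_continuous_bdd hg hb)
    (memLp_two_of_continuous_bdd (continuous_mehler hg hb _) (norm_mehler_le hb _))

theorem gaussCorr_nonneg {g : E → F} {M : ℝ} (hg : Continuous g) (hb : ∀ x, ‖g x‖ ≤ M)
    {c : ℝ} (hc : c ∈ Set.Icc (0 : ℝ) 1) : 0 ≤ gaussCorr g c := by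
  have h : Real.sqrt c ∈ Set.Icc (0 : ℝ) 1 := ⟨Real.sqrt_nonneg _, Real.sqrt_le_one.2 hc.2⟩
  rw [← Real.sq_sqrt hc.1, ← integral_norm_sq_mehler hg hb h]
  exact integral_nonneg fun x => by positivity

theorem integrable_norm_stdGaussian : Integrable (fun x : E => ‖x‖) γ :=
  (IsGaussian.integrable_id (μ := γ)).norm

theorem gaussCorr_le_of_mean_zero {g : E → F} {M : ℝ} {K : NNReal} (hg : LipschitzWith K g)
    (hb : ∀ x, ‖g x‖ ≤ M) (hm : ∫ x, g x ∂γ = 0) :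
    ∃ C : ℝ, ∀ c ∈ Set.Icc (0 : ℝ) 1, gaussCorr g c ≤ C * c := by
  have hM : 0 ≤ M := (norm_nonneg _).trans (hb 0)
  refine ⟨∫ x : E, M * (K * ‖x‖) ∂γ, fun c hc => ?_⟩
  have hgc := hg.continuous
  set s := Real.sin (Real.arccos c) with hs
  set w : F := ∫ z, g (s • z) ∂γ with hw
  have h0 : ∫ x, ⟪g x, w⟫ ∂γ = 0 := by
    simp_rw [real_inner_comm w]
    rw [integral_inner (integrable_of_continuous_bdd hgc hb), hm, inner_zero_right]
  have hi1 : Integrable (fun x => (⟪g x, mehler g (Real.arccos c) x⟫ : ℝ)) γ :=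
    integrable_of_continuous_bdd (M := M * M) (hgc.inner (continuous_mehler hgc hb _))
      (fun x => norm_inner_le_of_bdd hb (norm_mehler_le hb _) x x)
  have hi2 : Integrable (fun x => (⟪g x, w⟫ : ℝ)) γ :=
    integrable_of_continuous_bdd (M := M * ‖w‖) (by fun_prop)
      (fun x => (norm_inner_le_norm _ _).trans (by gcongr; exact hb x))
  have h1 : gaussCorr g c = ∫ x, ⟪g x, mehler g (Real.arccos c) x - w⟫ ∂γ := by
    simp_rw [inner_sub_right]
    rw [integral_sub hi1 hi2, h0, sub_zero]; rfl
  rw [h1, ← integral_mul_const]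
  refine integral_mono (by simp_rw [inner_sub_right]; exact hi1.sub hi2)
    (((integrable_norm_stdGaussian.const_mul _).const_mul _).mul_const _) fun x => ?_
  refine (real_inner_le_norm _ _).trans ?_
  have h2 : ‖mehler g (Real.arccos c) x - w‖ ≤ K * ‖x‖ * c := by
    rw [hw, mehler, ← integral_sub (integrable_of_continuous_bdd (by fun_prop) (fun z => hb _))
      (integrable_of_continuous_bdd (by fun_prop) (fun z => hb _))]
    refine (norm_integral_le_of_norm_le_const (C := K * ‖x‖ * c) (ae_of_all _ fun z => ?_)).trans
      (by simp)
    refine (hg.norm_sub_le _ _).trans ?_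
    rw [add_sub_cancel_right, Real.cos_arccos (by linarith [hc.1]) hc.2, norm_smul,
      Real.norm_of_nonneg hc.1]
    exact le_of_eq (by ring)
  calc ‖g x‖ * ‖mehler g (Real.arccos c) x - w‖ ≤ M * (K * ‖x‖ * c) := by
        gcongr; exact hb x
    _ = _ := by ring

theorem le_mul_of_sq_le {φ : ℝ → ℝ} {A C : ℝ} (hA : φ 1 = A)
    (h0 : ∀ c ∈ Set.Icc (0 : ℝ) 1, 0 ≤ φ c)
    (h1 : ∀ c ∈ Set.Icc (0 : ℝ) 1, φ c ^ 2 ≤ A * φ (c ^ 2))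
    (h2 : ∀ c ∈ Set.Icc (0 : ℝ) 1, φ c ≤ C * c) {c : ℝ} (hc : c ∈ Set.Icc (0 : ℝ) 1) :
    φ c ≤ c * A := by
  have hA0 : 0 ≤ A := hA ▸ h0 1 (by simp)
  rcases hA0.eq_or_lt with hA1 | hA1
  · have := h1 c hc
    rw [← hA1] at this ⊢
    nlinarith
  rcases hc.1.eq_or_lt with hc0 | hc0
  · have := h2 c hc
    rw [← hc0] at this ⊢
    linarith
  have key : ∀ k : ℕ, (φ c / A) ^ (2 ^ k) ≤ φ (c ^ 2 ^ k) / A := by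
    intro k
    induction k with
    | zero => simp
    | succ k ih =>
      have hck : c ^ 2 ^ k ∈ Set.Icc (0 : ℝ) 1 := ⟨by positivity, pow_le_one₀ hc.1 hc.2⟩
      rw [pow_succ, pow_mul, pow_mul]
      refine (pow_le_pow_left₀ (pow_nonneg (div_nonneg (h0 c hc) hA0) _) ih 2).trans ?_
      rw [div_pow, div_le_div_iff₀ (by positivity) hA1]
      nlinarith [h1 _ hck]
  by_contra! hcon
  have hx : 1 < φ c / (c * A) := by rwa [one_lt_div (by positivity)]
  obtain ⟨m, hm⟩ := pow_unbounded_of_one_lt (C / A) hx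
  have h3 : (φ c / (c * A)) ^ (2 ^ m) ≤ C / A := by
    have hck : c ^ 2 ^ m ∈ Set.Icc (0 : ℝ) 1 := ⟨by positivity, pow_le_one₀ hc.1 hc.2⟩
    have h4 := (key m).trans (div_le_div_of_nonneg_right (h2 _ hck) hA0)
    rw [show φ c / (c * A) = φ c / A / c by field_simp, div_pow, div_le_iff₀ (by positivity)]
    exact h4.trans (le_of_eq (by ring))
  have h5 := pow_le_pow_right₀ hx.le (Nat.lt_two_pow_self (n := m)).le
  linarith

theorem gaussCorr_le {g : E → F} {M : ℝ} {K : NNReal} (hg : LipschitzWith K g)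
    (hb : ∀ x, ‖g x‖ ≤ M) {c : ℝ} (hc : c ∈ Set.Icc (0 : ℝ) 1) :
    gaussCorr g c ≤ ‖∫ x, g x ∂γ‖ ^ 2 + c * (∫ x, ‖g x‖ ^ 2 ∂γ - ‖∫ x, g x ∂γ‖ ^ 2) := by
  set l := ∫ x, g x ∂γ with hl
  have hgc := hg.continuous
  have hgi : Integrable g γ := integrable_of_continuous_bdd hgc hb
  set f : E → F := fun x => g x - l with hf
  have hfl : LipschitzWith K f := by
    refine LipschitzWith.of_dist_le_mul fun x y => ?_
    simp only [hf, dist_sub_right]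
    exact hg.dist_le_mul x y
  have hfb : ∀ x, ‖f x‖ ≤ M + ‖l‖ := fun x => (norm_sub_le _ _).trans (by gcongr; exact hb x)
  have hf0 : ∫ x, f x ∂γ = 0 := by
    rw [hf, integral_sub hgi (integrable_const _)]; simp [hl]
  obtain ⟨C, hC⟩ := gaussCorr_le_of_mean_zero hfl hfb hf0
  have hfc := hfl.continuous
  have h := le_mul_of_sq_le rfl (fun c hc => gaussCorr_nonneg hfc hfb hc)
    (fun c hc => gaussCorr_sq_le hfc hfb hc) hC hc
  have hcorr : ∀ c, gaussCorr f c = gaussCorr g c - ‖l‖ ^ 2 := by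
    intro c
    set θ := Real.arccos c
    have hmf : ∀ x, mehler f θ x = mehler g θ x - l := by
      intro x
      simp only [mehler, hf]
      rw [integral_sub (integrable_of_continuous_bdd (by fun_prop) (fun z => hb _))
        (integrable_const _)]
      simp
    have hmg : ∫ x, mehler g θ x ∂γ = l := by
      have := integral_comp_add hgc hb (Real.cos θ) (Real.sin θ)
      rw [show Real.cos θ ^ 2 + Real.sin θ ^ 2 = 1 by rw [add_comm, Real.sin_sq_add_cos_sq],
        Real.sqrt_one] at this
      simpa [mehler] using this
    have hmi : Integrable (mehler g θ) γ :=
      integrable_of_continuous_bdd (continuous_mehler hgc hb _) (norm_mehler_le hb _)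
    have e : ∀ x, ⟪f x, mehler f θ x⟫ = ⟪g x, mehler g θ x⟫ - ⟪l, g x⟫
        - (⟪l, mehler g θ x⟫ - ‖l‖ ^ 2) := by
      intro x
      rw [hmf, hf, inner_sub_left, inner_sub_right, inner_sub_right, real_inner_self_eq_norm_sq,
        real_inner_comm l (g x)]
    have i1 : Integrable (fun x => (⟪g x, mehler g θ x⟫ : ℝ)) γ :=
      integrable_of_continuous_bdd (M := M * M) (hgc.inner (continuous_mehler hgc hb _))
        (fun x => norm_inner_le_of_bdd hb (norm_mehler_le hb _) x x)
    have i2 : Integrable (fun x => (⟪g x, mehler g θ x⟫ : ℝ) - ⟪l, g x⟫) γ :=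
      i1.sub (hgi.const_inner l)
    have i3 : Integrable (fun x => (⟪l, mehler g θ x⟫ : ℝ) - ‖l‖ ^ 2) γ :=
      (hmi.const_inner l).sub (integrable_const _)
    change ∫ x, ⟪f x, mehler f θ x⟫ ∂γ = ∫ x, ⟪g x, mehler g θ x⟫ ∂γ - ‖l‖ ^ 2
    simp_rw [e]
    rw [integral_sub i2 i3,
      integral_sub i1 (hgi.const_inner l), integral_sub (hmi.const_inner l) (integrable_const _),
      integral_inner hgi, integral_inner hmi, hmg, ← hl, real_inner_self_eq_norm_sq]
    simp
  rw [hcorr, hcorr, gaussCorr_one] at h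
  linarith

end Mehler

section Gradient

variable {E : Type*} [NormedAddCommGroup E] [InnerProductSpace ℝ E] [CompleteSpace E]

theorem gradient_fun_mul {f g : E → ℝ} {x : E} (hf : DifferentiableAt ℝ f x)
    (hg : DifferentiableAt ℝ g x) :
    gradient (fun y => f y * g y) x = f x • gradient g x + g x • gradient f x := by
  simp only [gradient]
  rw [fderiv_fun_mul hf hg]
  simp

theorem gradient_comp_real {f : E → ℝ} {g : ℝ → ℝ} {x : E} {g' : ℝ} (hg : HasDerivAt g g' (f x))
    (hf : DifferentiableAt ℝ f x) : gradient (fun y => g (f y)) x = g' • gradient f x := by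
  have h := (hg.comp_hasFDerivAt x hf.hasFDerivAt).fderiv
  simp only [gradient]
  rw [show (fun y => g (f y)) = g ∘ f from rfl, h]
  simp

theorem gradient_comp_affine {f : E → ℝ} {c : ℝ} {w x : E}
    (hf : DifferentiableAt ℝ f (c • x + w)) :
    gradient (fun y => f (c • y + w)) x = c • gradient f (c • x + w) := by
  have h1 : HasFDerivAt (fun y : E => c • y + w) (c • ContinuousLinearMap.id ℝ E) x :=
    ((hasFDerivAt_id x).const_smul c).add_const w
  have h := (hf.hasFDerivAt.comp x h1).fderiv
  simp only [gradient]
  rw [show (fun y => f (c • y + w)) = f ∘ fun y => c • y + w from rfl, h]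
  simp

theorem contDiff_gradient {f : E → ℝ} {m k : WithTop ℕ∞} (hf : ContDiff ℝ k f) (hm : m + 1 ≤ k) :
    ContDiff ℝ m (gradient f) :=
  (InnerProductSpace.toDual ℝ E).symm.contDiff.comp (hf.fderiv_right hm)

theorem hasCompactSupport_gradient {f : E → ℝ} (hf : HasCompactSupport f) :
    HasCompactSupport (gradient f) :=
  (hf.fderiv (𝕜 := ℝ)).comp_left (g := (InnerProductSpace.toDual ℝ E).symm) (map_zero _)

end Gradient

section Poincare

open ProbabilityTheory Module

variable {E : Type*} [NormedAddCommGroup E] [InnerProductSpace ℝ E] [FiniteDimensional ℝ E]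
  [MeasurableSpace E] [BorelSpace E]

local notation "γ" => stdGaussian E

theorem hasFDerivAt_gaussDens (z : E) :
    HasFDerivAt (gaussDens : E → ℝ) (-(gaussDens z • innerSL ℝ z)) z := by
  have h := (((hasStrictFDerivAt_norm_sq z).hasFDerivAt.const_mul (-(1 / 2 : ℝ))).exp).const_mul
    ((2 * Real.pi) ^ (-(finrank ℝ E : ℝ) / 2))
  have e : (gaussDens : E → ℝ) = fun y => (2 * Real.pi) ^ (-(finrank ℝ E : ℝ) / 2) *
      Real.exp (-(1 / 2 : ℝ) * ‖y‖ ^ 2) := by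
    ext y; simp only [gaussDens]; congr 2; ring
  rw [e]
  refine h.congr_fderiv ?_
  ext v
  simp
  ring_nf

/-- Gaussian integration by parts. -/
theorem integral_mul_inner_stdGaussian {h : E → ℝ} {M K : ℝ} (hh : ContDiff ℝ 1 h)
    (hM : ∀ x, ‖h x‖ ≤ M) (hK : ∀ x, ‖gradient h x‖ ≤ K) (w : E) :
    ∫ z, h z * ⟪w, z⟫ ∂γ = ∫ z, ⟪gradient h z, w⟫ ∂γ := by
  have hgc : Continuous (gradient h) := (contDiff_gradient (m := 0) hh (by simp)).continuous
  have hi1 : Integrable (fun z => h z * ⟪w, z⟫) γ := by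
    refine Integrable.bdd_mul (c := M) ?_ hh.continuous.aestronglyMeasurable (ae_of_all _ hM)
    exact (IsGaussian.integrable_id (μ := γ)).const_inner w
  have hi2 : Integrable (fun z => (⟪gradient h z, w⟫ : ℝ)) γ :=
    integrable_of_continuous_bdd (M := K * ‖w‖) (by fun_prop)
      (fun x => (norm_inner_le_norm _ _).trans (by gcongr; exact hK x))
  have hi3 : Integrable h γ := integrable_of_continuous_bdd hh.continuous hM
  rw [integral_stdGaussian, integral_stdGaussian]
  rw [integrable_stdGaussian_iff] at hi1 hi2 hi3
  have e1 : ∀ z, fderiv ℝ (gaussDens : E → ℝ) z w * h z = -(gaussDens z • (h z * ⟪w, z⟫)) := by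
    intro z
    rw [(hasFDerivAt_gaussDens z).fderiv]
    simp only [neg_apply, smul_apply, innerSL_apply_apply,
      smul_eq_mul]
    rw [real_inner_comm]
    ring
  have e2 : ∀ z, gaussDens z * fderiv ℝ h z w = gaussDens z • (⟪gradient h z, w⟫ : ℝ) := by
    intro z
    rw [inner_gradient_left, smul_eq_mul]
  have := integral_mul_fderiv_eq_neg_fderiv_mul_of_integrable (μ := (volume : Measure E))
    (f := gaussDens) (g := h) (v := w) (by simp_rw [e1]; exact hi1.neg) (by simp_rw [e2]; exact hi2)
    hi3 (fun x _ => (hasFDerivAt_gaussDens x).differentiableAt)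
    (fun x _ => (hh.differentiable one_ne_zero) x)
  simp_rw [e1, e2, integral_neg, neg_neg] at this
  exact this.symm

theorem mehler_neg {F : Type*} [NormedAddCommGroup F] [InnerProductSpace ℝ F] [CompleteSpace F]
    {g : E → F} (hg : Continuous g) (θ : ℝ) (x : E) :
    mehler g (-θ) x = mehler g θ x := by
  unfold mehler
  have h := integral_map (μ := γ) measurePreserving_neg_stdGaussian.measurable.aemeasurable
    (f := fun z => g (Real.cos θ • x + Real.sin θ • z))
    (Continuous.aestronglyMeasurable (by fun_prop))
  rw [measurePreserving_neg_stdGaussian.map_eq] at h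
  simpa using h.symm

/-- Derivative of the correlation of `f x` and `f (cos θ x + sin θ z)` in the angle. -/
theorem hasDerivAt_gaussian_rotation {f : E → ℝ} {M K : ℝ} (hf : ContDiff ℝ 1 f)
    (hM : ∀ x, ‖f x‖ ≤ M) (hK : ∀ x, ‖gradient f x‖ ≤ K) (θ : ℝ) :
    HasDerivAt (fun θ => ∫ p, f p.1 * f (Real.cos θ • p.1 + Real.sin θ • p.2)
      ∂(Measure.prod γ γ))
      (-Real.sin θ * ∫ x, ⟪gradient f x, mehler (gradient f) θ x⟫ ∂γ) θ := by
  have hfc := hf.continuous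
  have hM0 : 0 ≤ M := (norm_nonneg _).trans (hM 0)
  have hK0 : 0 ≤ K := (norm_nonneg _).trans (hK 0)
  have hgc : Continuous (gradient f) := (contDiff_gradient (m := 0) hf (by simp)).continuous
  have hn1 : Integrable (fun p : E × E => ‖p.1‖) (Measure.prod γ γ) :=
    (integrable_norm_stdGaussian (E := E)).comp_fst γ
  have hn2 : Integrable (fun p : E × E => ‖p.2‖) (Measure.prod γ γ) :=
    (integrable_norm_stdGaussian (E := E)).comp_snd γ
  have hder : ∀ (p : E × E) (t : ℝ), HasDerivAt
      (fun t => f p.1 * f (Real.cos t • p.1 + Real.sin t • p.2))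
      (f p.1 * ⟪gradient f (Real.cos t • p.1 + Real.sin t • p.2),
        -Real.sin t • p.1 + Real.cos t • p.2⟫) t := by
    intro p t
    have h1 : HasDerivAt (fun t => Real.cos t • p.1 + Real.sin t • p.2)
        (-Real.sin t • p.1 + Real.cos t • p.2) t :=
      ((Real.hasDerivAt_cos t).smul_const p.1).add ((Real.hasDerivAt_sin t).smul_const p.2)
    have h2 := ((hf.differentiable one_ne_zero)
      (Real.cos t • p.1 + Real.sin t • p.2)).hasFDerivAt.comp_hasDerivAt t h1
    rw [inner_gradient_left]
    exact h2.const_mul _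
  have hbd : ∀ (p : E × E) (t : ℝ), ‖f p.1 * ⟪gradient f (Real.cos t • p.1 + Real.sin t • p.2),
        -Real.sin t • p.1 + Real.cos t • p.2⟫‖ ≤ M * (K * (‖p.1‖ + ‖p.2‖)) := by
    intro p t
    rw [norm_mul]
    refine mul_le_mul (hM _) ((norm_inner_le_norm _ _).trans
      (mul_le_mul (hK _) ?_ (norm_nonneg _) hK0)) (norm_nonneg _) hM0
    refine (norm_add_le _ _).trans (add_le_add ?_ ?_)
    · rw [norm_smul, norm_neg]
      exact mul_le_of_le_one_left (norm_nonneg _) (Real.abs_sin_le_one t)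
    · rw [norm_smul]
      exact mul_le_of_le_one_left (norm_nonneg _) (Real.abs_cos_le_one t)
  have hbi : Integrable (fun p : E × E => M * (K * (‖p.1‖ + ‖p.2‖))) (Measure.prod γ γ) :=
    ((hn1.add hn2).const_mul K).const_mul M
  have hD := (hasDerivAt_integral_of_dominated_loc_of_deriv_le (μ := Measure.prod γ γ)
    (F := fun t (p : E × E) => f p.1 * f (Real.cos t • p.1 + Real.sin t • p.2))
    (F' := fun t (p : E × E) => f p.1 * ⟪gradient f (Real.cos t • p.1 + Real.sin t • p.2),
        -Real.sin t • p.1 + Real.cos t • p.2⟫)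
    (bound := fun p => M * (K * (‖p.1‖ + ‖p.2‖))) (x₀ := θ) (s := Set.univ) Filter.univ_mem
    (Filter.Eventually.of_forall fun t => Continuous.aestronglyMeasurable (by fun_prop))
    (integrable_of_continuous_bdd (M := M * M) (by fun_prop) (fun p => by
      rw [norm_mul]; exact mul_le_mul (hM _) (hM _) (norm_nonneg _) hM0))
    (Continuous.aestronglyMeasurable (by fun_prop))
    (ae_of_all _ fun p t _ => hbd p t) hbi (ae_of_all _ fun p t _ => hder p t)).2
  refine hD.congr_deriv ?_
  -- rotate the variables and integrate by parts
  set H : E × E → ℝ := fun p => f (Real.cos θ • p.1 - Real.sin θ • p.2) * ⟪gradient f p.1, p.2⟫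
    with hH
  have hrot := integral_comp_rotation (E := E) (f := H) (by fun_prop) θ
  have e1 : ∀ p : E × E, H (Real.cos θ • p.1 + Real.sin θ • p.2,
      -Real.sin θ • p.1 + Real.cos θ • p.2) = f p.1 *
      ⟪gradient f (Real.cos θ • p.1 + Real.sin θ • p.2),
        -Real.sin θ • p.1 + Real.cos θ • p.2⟫ := by
    intro p
    simp only [hH]
    congr 2
    have h1 : Real.cos θ * Real.cos θ + Real.sin θ * Real.sin θ = 1 := by
      have := Real.sin_sq_add_cos_sq θ; nlinarith
    calc _ = (Real.cos θ * Real.cos θ + Real.sin θ * Real.sin θ) • p.1 := by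
          simp only [smul_add, smul_smul]
          rw [mul_comm (Real.sin θ) (Real.cos θ)]; module
      _ = p.1 := by rw [h1, one_smul]
  simp_rw [e1] at hrot
  rw [hrot]
  have hHi : Integrable H (Measure.prod γ γ) := by
    refine Integrable.mono' ((hn2.const_mul K).const_mul M)
      (Continuous.aestronglyMeasurable (by fun_prop)) (ae_of_all _ fun p => ?_)
    rw [hH, norm_mul]
    exact mul_le_mul (hM _) ((norm_inner_le_norm _ _).trans
      (mul_le_mul_of_nonneg_right (hK _) (norm_nonneg _))) (norm_nonneg _) hM0
  rw [integral_prod _ hHi, ← integral_const_mul]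
  refine integral_congr_ae (ae_of_all _ fun x => ?_)
  simp only [hH]
  have hgrad : ∀ z, gradient (fun z => f (Real.cos θ • x - Real.sin θ • z)) z
      = -Real.sin θ • gradient f (Real.cos θ • x - Real.sin θ • z) := by
    intro z
    have := gradient_comp_affine (f := f) (c := -Real.sin θ) (w := Real.cos θ • x) (x := z)
      ((hf.differentiable one_ne_zero) _)
    have e : ∀ z : E, -Real.sin θ • z + Real.cos θ • x = Real.cos θ • x - Real.sin θ • z :=
      fun z => by module
    simp_rw [e] at this
    exact this
  have hibp := integral_mul_inner_stdGaussian (E := E)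
    (h := fun z => f (Real.cos θ • x - Real.sin θ • z)) (M := M) (K := K) (by fun_prop)
    (fun z => hM _) (fun z => by
      rw [hgrad, norm_smul, norm_neg]
      exact (mul_le_of_le_one_left (norm_nonneg _) (Real.abs_sin_le_one θ)).trans (hK _))
    (gradient f x)
  rw [hibp, ← mehler_neg hgc]
  simp_rw [hgrad, inner_smul_left]
  rw [integral_const_mul, mehler]
  congr 1
  rw [← integral_inner]
  · refine integral_congr_ae (ae_of_all _ fun z => ?_)
    simp only [Real.cos_neg, Real.sin_neg]
    rw [real_inner_comm, neg_smul, sub_eq_add_neg]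
  · exact integrable_of_continuous_bdd (M := K) (by fun_prop) (fun z => hK _)

theorem gaussian_poincare_of_hasCompactSupport {f : E → ℝ} (hf : ContDiff ℝ 2 f)
    (hc : HasCompactSupport f) :
    ∫ x, f x ^ 2 ∂γ - (∫ x, f x ∂γ) ^ 2 - ‖∫ x, gradient f x ∂γ‖ ^ 2
      ≤ 1 / 2 * (∫ x, ‖gradient f x‖ ^ 2 ∂γ - ‖∫ x, gradient f x ∂γ‖ ^ 2) := by
  have hf1 : ContDiff ℝ 1 f := hf.of_le (by norm_num)
  have hg1 : ContDiff ℝ 1 (gradient f) := contDiff_gradient hf (by norm_num)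
  obtain ⟨M, hM⟩ := hf.continuous.bounded_above_of_compact_support hc
  obtain ⟨K, hK⟩ := hg1.continuous.bounded_above_of_compact_support (hasCompactSupport_gradient hc)
  obtain ⟨L, hL⟩ := ContDiff.lipschitzWith_of_hasCompactSupport (hasCompactSupport_gradient hc) hg1
    one_ne_zero
  set l := ∫ x, gradient f x ∂γ
  set D := ∫ x, ‖gradient f x‖ ^ 2 ∂γ
  set Φ : ℝ → ℝ := fun θ => ∫ p, f p.1 * f (Real.cos θ • p.1 + Real.sin θ • p.2)
      ∂(Measure.prod γ γ) with hΦ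
  have key := le_of_hasDerivAt_nonneg
    (f := fun θ => Φ θ - Real.cos θ * ‖l‖ ^ 2 - 1 / 2 * Real.cos θ ^ 2 * (D - ‖l‖ ^ 2))
    (f' := fun θ => -Real.sin θ * ∫ x, ⟪gradient f x, mehler (gradient f) θ x⟫ ∂γ
      - -Real.sin θ * ‖l‖ ^ 2
      - 1 / 2 * ((2 : ℕ) * Real.cos θ ^ (2 - 1) * -Real.sin θ) * (D - ‖l‖ ^ 2))
    (s := 0) (r := Real.pi / 2) (by positivity)
    (fun θ => ((hasDerivAt_gaussian_rotation hf1 hM hK θ).sub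
      ((Real.hasDerivAt_cos θ).mul_const _)).sub
      ((((Real.hasDerivAt_cos θ).pow 2).const_mul (1 / 2)).mul_const _))
    (fun θ hθ => by
      have hs : 0 ≤ Real.sin θ := Real.sin_nonneg_of_nonneg_of_le_pi hθ.1
        (by linarith [hθ.2, Real.pi_pos])
      have hcos : Real.cos θ ∈ Set.Icc (0 : ℝ) 1 :=
        ⟨Real.cos_nonneg_of_neg_pi_div_two_le_of_le (by linarith [hθ.1, Real.pi_pos]) hθ.2,
          Real.cos_le_one θ⟩
      have h := gaussCorr_le hL hK hcos
      rw [gaussCorr, Real.arccos_cos hθ.1 (by linarith [hθ.2, Real.pi_pos])] at h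
      have h2 := mul_le_mul_of_nonneg_left h hs
      simp only [l, D]
      push_cast
      simp only [pow_one]
      linarith)
  have e0 : Φ 0 = ∫ x, f x ^ 2 ∂γ := by
    simp only [hΦ, Real.cos_zero, Real.sin_zero, one_smul, zero_smul, add_zero]
    have := integral_fun_fst (μ := γ) (ν := γ) (f := fun x => f x * f x)
    simpa [sq] using this
  have e1 : Φ (Real.pi / 2) = (∫ x, f x ∂γ) ^ 2 := by
    simp only [hΦ, Real.cos_pi_div_two, Real.sin_pi_div_two, one_smul, zero_smul, zero_add]
    rw [integral_prod_mul, sq]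
  simp only [e0, e1, Real.cos_zero, Real.cos_pi_div_two] at key
  linarith

end Poincare

section PoincareGeneral

open ProbabilityTheory Module Filter Topology

variable {E : Type*} [NormedAddCommGroup E] [InnerProductSpace ℝ E] [FiniteDimensional ℝ E]
  [MeasurableSpace E] [BorelSpace E]

local notation "γ" => stdGaussian E

/-- Smooth cutoffs `χ_k` with values in `[0, 1]`, tending to `1`, with gradients tending to `0`. -/
theorem exists_cutoff (E : Type*) [NormedAddCommGroup E] [InnerProductSpace ℝ E]
    [FiniteDimensional ℝ E] : ∃ (χ : ℕ → E → ℝ) (K : ℝ), 0 ≤ K ∧ (∀ k, ContDiff ℝ 2 (χ k)) ∧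
      (∀ k, HasCompactSupport (χ k)) ∧ (∀ k x, |χ k x| ≤ 1) ∧
      (∀ k x, ‖gradient (χ k) x‖ ≤ K) ∧ (∀ x, Tendsto (fun k => χ k x) atTop (𝓝 1)) ∧
      (∀ x, Tendsto (fun k => gradient (χ k) x) atTop (𝓝 0)) := by
  let b : ContDiffBump (0 : E) := ⟨1, 2, one_pos, one_lt_two⟩
  have hb : ContDiff ℝ 2 (b : E → ℝ) := b.contDiff
  have hb1 : ContDiff ℝ 1 (gradient (b : E → ℝ)) := contDiff_gradient hb (by norm_num)
  obtain ⟨K, hK⟩ := hb1.continuous.bounded_above_of_compact_support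
    (hasCompactSupport_gradient b.hasCompactSupport)
  have hK0 : 0 ≤ K := (norm_nonneg _).trans (hK 0)
  have hpos : ∀ k : ℕ, (0 : ℝ) < ((k : ℝ) + 1)⁻¹ := fun k => by positivity
  have hle : ∀ k : ℕ, ((k : ℝ) + 1)⁻¹ ≤ 1 := fun k =>
    inv_le_one_of_one_le₀ (by linarith [k.cast_nonneg (α := ℝ)])
  have hlim : Tendsto (fun k : ℕ => ((k : ℝ) + 1)⁻¹) atTop (𝓝 0) :=
    tendsto_one_div_add_atTop_nhds_zero_nat.congr (fun k => by rw [one_div])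
  have hgr : ∀ (k : ℕ) (x : E), gradient (fun x => b (((k : ℝ) + 1)⁻¹ • x)) x
      = ((k : ℝ) + 1)⁻¹ • gradient b (((k : ℝ) + 1)⁻¹ • x) := by
    intro k x
    have := gradient_comp_affine (f := (b : E → ℝ)) (c := ((k : ℝ) + 1)⁻¹) (w := 0) (x := x)
      ((hb.differentiable (by norm_num)) _)
    simpa only [add_zero] using this
  refine ⟨fun k x => b (((k : ℝ) + 1)⁻¹ • x), K, hK0, fun k => by fun_prop, fun k => ?_,
    fun k x => ?_, fun k x => ?_, fun x => ?_, fun x => ?_⟩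
  · exact b.hasCompactSupport.comp_homeomorph (Homeomorph.smulOfNeZero _ (hpos k).ne')
  · rw [abs_of_nonneg b.nonneg]; exact b.le_one
  · rw [hgr, norm_smul, Real.norm_of_nonneg (hpos k).le]
    exact (mul_le_of_le_one_left (norm_nonneg _) (hle k)).trans (hK _)
  · have h1 : Tendsto (fun k : ℕ => b (((k : ℝ) + 1)⁻¹ • x)) atTop (𝓝 (b ((0 : ℝ) • x))) :=
      (hb.continuous.tendsto _).comp (hlim.smul_const x)
    rwa [zero_smul, b.one_of_mem_closedBall (by simp [b])] at h1
  · simp_rw [hgr]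
    refine squeeze_zero_norm (a := fun k : ℕ => ((k : ℝ) + 1)⁻¹ * K) (fun k => ?_) ?_
    · rw [norm_smul, Real.norm_of_nonneg (hpos k).le]
      exact mul_le_mul_of_nonneg_left (hK _) (hpos k).le
    · simpa using hlim.mul_const K

/-- Second-order Gaussian Poincaré inequality. -/
theorem gaussian_poincare_second {f : E → ℝ} (hf : ContDiff ℝ 2 f)
    (hf2 : Integrable (fun x => f x ^ 2) γ) (hg2 : Integrable (fun x => ‖gradient f x‖ ^ 2) γ) :
    ∫ x, f x ^ 2 ∂γ - (∫ x, f x ∂γ) ^ 2 - ‖∫ x, gradient f x ∂γ‖ ^ 2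
      ≤ 1 / 2 * (∫ x, ‖gradient f x‖ ^ 2 ∂γ - ‖∫ x, gradient f x ∂γ‖ ^ 2) := by
  obtain ⟨χ, K, hK0, hχ, hχc, hχ1, hχK, hlim, hglim⟩ := exists_cutoff E
  have hfc := hf.continuous
  have hgc : Continuous (gradient f) := (contDiff_gradient (m := 1) hf (by norm_num)).continuous
  have hcg : ∀ k, Continuous (gradient (χ k)) := fun k =>
    (contDiff_gradient (m := 1) (hχ k) (by norm_num)).continuous
  have hfi : Integrable f γ :=
    ((memLp_two_iff_integrable_sq hfc.aestronglyMeasurable).2 hf2).integrable one_le_two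
  have hgi : Integrable (gradient f) γ :=
    ((memLp_two_iff_integrable_sq_norm hgc.aestronglyMeasurable).2 hg2).integrable one_le_two
  have hgr : ∀ k x, gradient (fun y => χ k y * f y) x = χ k x • gradient f x + f x • gradient (χ k) x :=
    fun k x => gradient_fun_mul ((hχ k).differentiable (by norm_num) x)
      (hf.differentiable (by norm_num) x)
  have hgb : ∀ k x, ‖χ k x • gradient f x + f x • gradient (χ k) x‖ ≤ ‖gradient f x‖ + K * |f x| := by
    intro k x
    refine (norm_add_le _ _).trans (add_le_add ?_ ?_)
    · rw [norm_smul]; exact mul_le_of_le_one_left (norm_nonneg _) (hχ1 k x)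
    · rw [norm_smul, mul_comm, Real.norm_eq_abs]
      exact mul_le_mul_of_nonneg_right (hχK k x) (abs_nonneg _)
  have hgl : ∀ x, Tendsto (fun k => χ k x • gradient f x + f x • gradient (χ k) x) atTop
      (𝓝 (gradient f x)) := fun x => by
    simpa using ((hlim x).smul_const (gradient f x)).add ((hglim x).const_smul (f x))
  have hfl : ∀ x, Tendsto (fun k => χ k x * f x) atTop (𝓝 (f x)) := fun x => by
    simpa using (hlim x).mul_const (f x)
  have hfb : ∀ k x, ‖χ k x * f x‖ ≤ ‖f x‖ := fun k x => by
    rw [norm_mul]; exact mul_le_of_le_one_left (norm_nonneg _) (hχ1 k x)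
  have hc : ∀ k, Continuous (fun x => χ k x) := fun k => (hχ k).continuous
  have t1 : Tendsto (fun k => ∫ x, (χ k x * f x) ^ 2 ∂γ) atTop (𝓝 (∫ x, f x ^ 2 ∂γ)) := by
    refine tendsto_integral_of_dominated_convergence (fun x => f x ^ 2)
      (fun k => Continuous.aestronglyMeasurable ((((hc k).mul hfc)).pow 2)) hf2
      (fun k => ae_of_all _ fun x => ?_) (ae_of_all _ fun x => (hfl x).pow 2)
    rw [norm_pow]
    exact (pow_le_pow_left₀ (norm_nonneg _) (hfb k x) 2).trans_eq (sq_abs _)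
  have t2 : Tendsto (fun k => ∫ x, χ k x * f x ∂γ) atTop (𝓝 (∫ x, f x ∂γ)) :=
    tendsto_integral_of_dominated_convergence (fun x => ‖f x‖)
      (fun k => Continuous.aestronglyMeasurable ((hc k).mul hfc)) hfi.norm
      (fun k => ae_of_all _ fun x => hfb k x) (ae_of_all _ fun x => hfl x)
  have t3 : Tendsto (fun k => ∫ x, (χ k x • gradient f x + f x • gradient (χ k) x) ∂γ) atTop
      (𝓝 (∫ x, gradient f x ∂γ)) :=
    tendsto_integral_of_dominated_convergence (fun x => ‖gradient f x‖ + K * |f x|)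
      (fun k => Continuous.aestronglyMeasurable (((hc k).smul hgc).add (hfc.smul (hcg k))))
      (hgi.norm.add (hfi.abs.const_mul K))
      (fun k => ae_of_all _ fun x => hgb k x) (ae_of_all _ fun x => hgl x)
  have t4 : Tendsto (fun k => ∫ x, ‖χ k x • gradient f x + f x • gradient (χ k) x‖ ^ 2 ∂γ) atTop
      (𝓝 (∫ x, ‖gradient f x‖ ^ 2 ∂γ)) := by
    refine tendsto_integral_of_dominated_convergence
      (fun x => 2 * ‖gradient f x‖ ^ 2 + 2 * K ^ 2 * f x ^ 2)
      (fun k => Continuous.aestronglyMeasurable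
        ((((hc k).smul hgc).add (hfc.smul (hcg k))).norm.pow 2))
      ((hg2.const_mul 2).add (hf2.const_mul (2 * K ^ 2)))
      (fun k => ae_of_all _ fun x => ?_) (ae_of_all _ fun x => (hgl x).norm.pow 2)
    rw [norm_pow, norm_norm]
    have h1 := pow_le_pow_left₀ (norm_nonneg _) (hgb k x) 2
    have h2 := sq_abs (f x)
    nlinarith [sq_nonneg (‖gradient f x‖ - K * |f x|)]
  refine le_of_tendsto_of_tendsto' ((t1.sub (t2.pow 2)).sub (t3.norm.pow 2))
    ((t4.sub (t3.norm.pow 2)).const_mul (1 / 2)) (fun k => ?_)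
  have := gaussian_poincare_of_hasCompactSupport (f := fun x => χ k x * f x) ((hχ k).mul hf)
    ((hχc k).mul_right)
  simpa only [hgr] using this

theorem sq_norm_integral_le {F : Type*} [NormedAddCommGroup F] [InnerProductSpace ℝ F]
    [CompleteSpace F] {α : Type*} [MeasurableSpace α] {μ : Measure α} [IsProbabilityMeasure μ]
    {g : α → F} (hg : MemLp g 2 μ) : ‖∫ x, g x ∂μ‖ ^ 2 ≤ ∫ x, ‖g x‖ ^ 2 ∂μ := by
  have h := sq_integral_inner_le hg (memLp_const (∫ x, g x ∂μ) (p := 2) (μ := μ))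
  have e : ∫ x, ⟪g x, ∫ x, g x ∂μ⟫ ∂μ = ‖∫ x, g x ∂μ‖ ^ 2 := by
    rw [← real_inner_self_eq_norm_sq, ← integral_inner (hg.integrable one_le_two)]
    exact integral_congr_ae (ae_of_all _ fun x => real_inner_comm _ _)
  rw [e] at h
  simp only [integral_const, probReal_univ, one_smul] at h
  by_contra hlt
  push Not at hlt
  have h0 : 0 ≤ ∫ x, ‖g x‖ ^ 2 ∂μ := integral_nonneg fun _ => by positivity
  nlinarith

theorem gaussian_poincare {f : E → ℝ} (hf : ContDiff ℝ 2 f)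
    (hf2 : Integrable (fun x => f x ^ 2) γ) (hg2 : Integrable (fun x => ‖gradient f x‖ ^ 2) γ) :
    ∫ x, f x ^ 2 ∂γ - (∫ x, f x ∂γ) ^ 2 ≤ ∫ x, ‖gradient f x‖ ^ 2 ∂γ := by
  have h := gaussian_poincare_second hf hf2 hg2
  have hgc : Continuous (gradient f) := (contDiff_gradient (m := 1) hf (by norm_num)).continuous
  have := sq_norm_integral_le ((memLp_two_iff_integrable_sq_norm hgc.aestronglyMeasurable).2 hg2)
  linarith

end PoincareGeneral

section SegregatedPairs

open ProbabilityTheory Module Filter Topology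

theorem lower_bound_of_quadratic {s Y m p η : ℝ} (hs : 0 ≤ s) (hη : 0 ≤ η) (hη1 : η ≤ 1)
    (h1 : p ^ 2 * s + (m - p) ^ 2 / 4 ≤ m ^ 2 * Y + 7 * η) (h2 : s - 2 * η ≤ m ^ 2)
    (h3 : -Y - 2 * η ≤ p ^ 2) : s / (1 + 4 * s) - 63 * √η ≤ Y := by
  set r := √η with hr
  have hr0 : 0 ≤ r := Real.sqrt_nonneg _
  have hrr : r * r = η := Real.mul_self_sqrt hη
  have hr1 : r ≤ 1 := by nlinarith
  set σ := s / (1 + 4 * s) with hσ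
  have hσs : σ * (1 + 4 * s) = s := by rw [hσ]; field_simp
  have hσ0 : 0 ≤ σ := by positivity
  have hσle : σ ≤ s := by nlinarith [mul_nonneg hσ0 hs]
  have hmin : m ^ 2 * σ ≤ p ^ 2 * s + (m - p) ^ 2 / 4 := by
    rw [hσ, ← mul_div_assoc, div_le_iff₀ (by linarith)]
    nlinarith [sq_nonneg (2 * s * p - (m - p) / 2)]
  rcases lt_or_ge r (m ^ 2) with hm | hm
  · by_contra hlt
    push Not at hlt
    have h4 : m ^ 2 * (σ - Y) ≤ 7 * η := by linarith
    have h5 : r * (63 * r) ≤ m ^ 2 * (σ - Y) :=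
      mul_le_mul hm.le (by linarith) (by linarith) (sq_nonneg _)
    have : r * (56 * r) ≤ 0 := by nlinarith
    have hr00 : r = 0 := by nlinarith
    rw [hr00] at hm hlt hrr
    have := mul_pos hm (show 0 < σ - Y by linarith)
    linarith
  · have hηr : η ≤ r := by nlinarith
    rcases le_total 0 Y with hY | hY
    · linarith
    · have h6 : (m - p) ^ 2 ≤ 28 * η := by
        nlinarith [mul_nonneg (sq_nonneg p) hs, mul_nonneg (sq_nonneg m) (neg_nonneg.2 hY)]
      have h7 : p ^ 2 ≤ 2 * m ^ 2 + 2 * (m - p) ^ 2 := by nlinarith [sq_nonneg (2 * m - p)]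
      linarith

variable {E : Type*} [NormedAddCommGroup E] [InnerProductSpace ℝ E] [FiniteDimensional ℝ E]
  [MeasurableSpace E] [BorelSpace E]

local notation "γ" => stdGaussian E

theorem memLp_norm_stdGaussian : MemLp (fun x : E => ‖x‖) 2 γ :=
  (IsGaussian.memLp_id γ 2 (by simp)).norm

/-- Gaussian integration by parts for functions in the Gaussian Sobolev class. -/
theorem integral_mul_inner_stdGaussian_of_sq {f : E → ℝ} (hf : ContDiff ℝ 2 f)
    (hf2 : Integrable (fun x => f x ^ 2) γ) (hg2 : Integrable (fun x => ‖gradient f x‖ ^ 2) γ)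
    (w : E) : ∫ z, f z * ⟪w, z⟫ ∂γ = ⟪∫ z, gradient f z ∂γ, w⟫ := by
  obtain ⟨χ, K, hK0, hχ, hχc, hχ1, hχK, hlim, hglim⟩ := exists_cutoff E
  have hfc := hf.continuous
  have hgc : Continuous (gradient f) := (contDiff_gradient (m := 1) hf (by norm_num)).continuous
  have hcg : ∀ k, Continuous (gradient (χ k)) := fun k =>
    (contDiff_gradient (m := 1) (hχ k) (by norm_num)).continuous
  have hfm : MemLp f 2 γ := (memLp_two_iff_integrable_sq hfc.aestronglyMeasurable).2 hf2
  have hfi : Integrable f γ := hfm.integrable one_le_two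
  have hgi : Integrable (gradient f) γ :=
    ((memLp_two_iff_integrable_sq_norm hgc.aestronglyMeasurable).2 hg2).integrable one_le_two
  have hgr : ∀ k x, gradient (fun y => χ k y * f y) x = χ k x • gradient f x + f x • gradient (χ k) x :=
    fun k x => gradient_fun_mul ((hχ k).differentiable (by norm_num) x)
      (hf.differentiable (by norm_num) x)
  have hgb : ∀ k x, ‖χ k x • gradient f x + f x • gradient (χ k) x‖ ≤ ‖gradient f x‖ + K * |f x| := by
    intro k x
    refine (norm_add_le _ _).trans (add_le_add ?_ ?_)
    · rw [norm_smul]; exact mul_le_of_le_one_left (norm_nonneg _) (hχ1 k x)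
    · rw [norm_smul, mul_comm, Real.norm_eq_abs]
      exact mul_le_mul_of_nonneg_right (hχK k x) (abs_nonneg _)
  have hgl : ∀ x, Tendsto (fun k => χ k x • gradient f x + f x • gradient (χ k) x) atTop
      (𝓝 (gradient f x)) := fun x => by
    simpa using ((hlim x).smul_const (gradient f x)).add ((hglim x).const_smul (f x))
  have hc : ∀ k, Continuous (fun x => χ k x) := fun k => (hχ k).continuous
  have t1 : Tendsto (fun k => ∫ x, (χ k x * f x) * ⟪w, x⟫ ∂γ) atTop
      (𝓝 (∫ x, f x * ⟪w, x⟫ ∂γ)) := by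
    refine tendsto_integral_of_dominated_convergence (fun x => (‖f x‖ * ‖x‖) * ‖w‖)
      (fun k => Continuous.aestronglyMeasurable (by have := hc k; fun_prop))
      ((hfm.norm.integrable_mul memLp_norm_stdGaussian).mul_const _)
      (fun k => ae_of_all _ fun x => ?_) (ae_of_all _ fun x => ?_)
    · rw [norm_mul, norm_mul]
      calc ‖χ k x‖ * ‖f x‖ * ‖(⟪w, x⟫ : ℝ)‖ ≤ 1 * ‖f x‖ * (‖w‖ * ‖x‖) := by
            gcongr
            · exact hχ1 k x
            · exact norm_inner_le_norm _ _
        _ = _ := by ring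
    · simpa using ((hlim x).mul_const (f x)).mul_const (⟪w, x⟫ : ℝ)
  have t3 : Tendsto (fun k => ∫ x, (χ k x • gradient f x + f x • gradient (χ k) x) ∂γ) atTop
      (𝓝 (∫ x, gradient f x ∂γ)) :=
    tendsto_integral_of_dominated_convergence (fun x => ‖gradient f x‖ + K * |f x|)
      (fun k => Continuous.aestronglyMeasurable (((hc k).smul hgc).add (hfc.smul (hcg k))))
      (hgi.norm.add (hfi.abs.const_mul K))
      (fun k => ae_of_all _ fun x => hgb k x) (ae_of_all _ fun x => hgl x)
  refine tendsto_nhds_unique t1 ((t3.inner tendsto_const_nhds).congr fun k => ?_)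
  have hfk : ContDiff ℝ 2 (fun y => χ k y * f y) := (hχ k).mul hf
  have hsk : HasCompactSupport (fun y => χ k y * f y) := (hχc k).mul_right
  have hgk : Continuous (gradient fun y => χ k y * f y) :=
    (contDiff_gradient (m := 1) hfk (by norm_num)).continuous
  obtain ⟨M, hM⟩ := hfk.continuous.bounded_above_of_compact_support hsk
  obtain ⟨L, hL⟩ := hgk.bounded_above_of_compact_support (hasCompactSupport_gradient hsk)
  rw [integral_mul_inner_stdGaussian (hfk.of_le (by norm_num)) hM hL w]
  simp_rw [hgr]
  rw [real_inner_comm, ← integral_inner]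
  · exact integral_congr_ae (ae_of_all _ fun x => real_inner_comm _ _)
  · have := integrable_of_continuous_bdd (μ := γ) hgk hL
    simpa only [funext (hgr k)] using this

theorem gradient_inner (w x : E) : gradient (fun z : E => (⟪w, z⟫ : ℝ)) x = w := by
  have h : HasFDerivAt (fun z : E => (⟪w, z⟫ : ℝ)) (innerSL ℝ w) x := (innerSL ℝ w).hasFDerivAt
  refine (InnerProductSpace.toDual ℝ E).injective ?_
  rw [gradient, LinearIsometryEquiv.apply_symm_apply, h.fderiv]
  ext v; simp

theorem integral_inner_sq_stdGaussian (w : E) : ∫ z, (⟪w, z⟫ : ℝ) ^ 2 ∂γ = ‖w‖ ^ 2 := by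
  have hc : ContDiff ℝ 2 (fun z : E => (⟪w, z⟫ : ℝ)) := (innerSL ℝ w).contDiff
  have h2 : Integrable (fun z : E => (⟪w, z⟫ : ℝ) ^ 2) γ := by
    refine Integrable.mono' (memLp_norm_stdGaussian.integrable_sq.const_mul (‖w‖ ^ 2))
      (Continuous.aestronglyMeasurable (by fun_prop)) (ae_of_all _ fun x => ?_)
    rw [norm_pow, ← mul_pow]
    exact pow_le_pow_left₀ (norm_nonneg _) (norm_inner_le_norm _ _) 2
  have h := integral_mul_inner_stdGaussian_of_sq hc h2
    (by simp only [gradient_inner]; exact integrable_const _) w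
  simp only [gradient_inner, integral_const, probReal_univ, one_smul,
    real_inner_self_eq_norm_sq] at h
  rw [← h]
  simp only [sq]

theorem abs_sqrt_integral_sq_sub_le {α : Type*} [MeasurableSpace α] {μ : Measure α} {F G : α → ℝ}
    (hF : MemLp F 2 μ) (hG : MemLp G 2 μ) :
    |√(∫ x, F x ^ 2 ∂μ) - √(∫ x, G x ^ 2 ∂μ)| ≤ √(∫ x, (F x - G x) ^ 2 ∂μ) := by
  have h := sq_integral_inner_le hF hG
  simp only [Real.norm_eq_abs, sq_abs] at h
  have hFG : Integrable (fun x => F x * G x) μ := hF.integrable_mul hG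
  have i2 : Integrable (fun x => F x ^ 2 - 2 * (F x * G x)) μ :=
    hF.integrable_sq.sub (hFG.const_mul 2)
  have e : ∫ x, (F x - G x) ^ 2 ∂μ = ∫ x, F x ^ 2 ∂μ - 2 * ∫ x, F x * G x ∂μ + ∫ x, G x ^ 2 ∂μ := by
    rw [← integral_const_mul, ← integral_sub hF.integrable_sq (hFG.const_mul 2),
      ← integral_add i2 hG.integrable_sq]
    exact integral_congr_ae (ae_of_all _ fun x => by ring)
  have h0 : 0 ≤ ∫ x, F x ^ 2 ∂μ := integral_nonneg fun _ => sq_nonneg _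
  have h1 : 0 ≤ ∫ x, G x ^ 2 ∂μ := integral_nonneg fun _ => sq_nonneg _
  have h2 : (∫ x, F x * G x ∂μ) ^ 2 ≤ (√(∫ x, F x ^ 2 ∂μ) * √(∫ x, G x ^ 2 ∂μ)) ^ 2 := by
    rw [mul_pow, Real.sq_sqrt h0, Real.sq_sqrt h1]
    refine le_trans (le_of_eq ?_) h
    congr 1
    exact integral_congr_ae (ae_of_all _ fun x => by simp [mul_comm (F x)])
  have h3 := (abs_le_of_sq_le_sq' h2 (by positivity)).2
  refine Real.le_sqrt_of_sq_le ?_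
  rw [sq_abs, e, sub_sq, Real.sq_sqrt h0, Real.sq_sqrt h1]
  linarith

/-- The Gaussian `L²` norms of the positive and negative parts of `H` differ by at most twice the
distance of `H` to a linear function. -/
theorem abs_norm_posPart_sub_norm_negPart_le {H : E → ℝ} (hH : Continuous H)
    (hH2 : Integrable (fun x => H x ^ 2) γ) (w : E) :
    |√(∫ x, (max (H x) 0) ^ 2 ∂γ) - √(∫ x, (max (-H x) 0) ^ 2 ∂γ)|
      ≤ 2 * √(∫ x, (H x - ⟪w, x⟫) ^ 2 ∂γ) := by
  have hHm : MemLp H 2 γ := (memLp_two_iff_integrable_sq hH.aestronglyMeasurable).2 hH2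
  have hLm : MemLp (fun x : E => (⟪w, x⟫ : ℝ)) 2 γ :=
    (IsGaussian.memLp_id γ 2 (by simp)).const_inner w
  have hpos : ∀ {G : E → ℝ}, MemLp G 2 γ → MemLp (fun x => max (G x) 0) 2 γ := fun hG => hG.pos_part
  have hsym : ∫ x, (max (⟪w, x⟫ : ℝ) 0) ^ 2 ∂γ = ∫ x, (max (-⟪w, x⟫ : ℝ) 0) ^ 2 ∂γ := by
    have h := integral_map (μ := γ) measurePreserving_neg_stdGaussian.measurable.aemeasurable
      (f := fun x : E => (max (⟪w, x⟫ : ℝ) 0) ^ 2) (Continuous.aestronglyMeasurable (by fun_prop))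
    rw [measurePreserving_neg_stdGaussian.map_eq] at h
    simpa using h
  have hmono : ∀ {G K : E → ℝ}, MemLp G 2 γ → MemLp K 2 γ →
      √(∫ x, (max (G x) 0 - max (K x) 0) ^ 2 ∂γ) ≤ √(∫ x, (G x - K x) ^ 2 ∂γ) := by
    intro G K hG hK
    refine Real.sqrt_le_sqrt (integral_mono ((hpos hG).sub (hpos hK)).integrable_sq
      (hG.sub hK).integrable_sq fun x => ?_)
    exact sq_le_sq.2 (abs_max_sub_max_le_abs _ _ _)
  have h1 := (abs_sqrt_integral_sq_sub_le (hpos hHm) (hpos hLm)).trans (hmono hHm hLm)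
  have h2 := (abs_sqrt_integral_sq_sub_le (hpos hHm.neg) (hpos hLm.neg)).trans
    (hmono hHm.neg hLm.neg)
  have h3 : ∫ x, ((-H) x - (-fun x : E => (⟪w, x⟫ : ℝ)) x) ^ 2 ∂γ
      = ∫ x, (H x - ⟪w, x⟫) ^ 2 ∂γ :=
    integral_congr_ae (ae_of_all _ fun x => by simp only [Pi.neg_apply]; ring)
  rw [h3] at h2
  simp only [Pi.neg_apply] at h2
  rw [← hsym] at h2
  rw [abs_le] at h1 h2 ⊢
  constructor <;> linarith [h1.1, h1.2, h2.1, h2.2]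

end SegregatedPairs

section SegregatedPairs

open ProbabilityTheory Module Filter Topology

theorem sq_sub_le_of_abs_sub_le {a b A B D η : ℝ} (ha0 : 0 ≤ a) (hb0 : 0 ≤ b) (ha1 : a ^ 2 ≤ 1)
    (hb1 : b ^ 2 ≤ 1) (hη : 0 ≤ η) (hη1 : η ≤ 1) (hD0 : 0 ≤ D) (hD2 : D ≤ 2)
    (hf2 : 1 - η ≤ A) (hf1 : A ≤ 1) (hg2 : 1 - η ≤ B) (hg1 : B ≤ 1)
    (hpm : |b * √A - a * √B| ≤ 2 * √D) : (a - b) ^ 2 / 4 ≤ D + 3 * η := by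
  have hsq : ∀ {t : ℝ}, 1 - η ≤ t → t ≤ 1 → 1 - η ≤ √t ∧ √t ≤ 1 := fun {t} h1 h2 =>
    ⟨Real.le_sqrt_of_sq_le (by nlinarith), Real.sqrt_le_one.2 h2⟩
  obtain ⟨hA1, hA2⟩ := hsq hf2 hf1
  obtain ⟨hB1, hB2⟩ := hsq hg2 hg1
  set d := √D with hd
  have hdd : d * d = D := Real.mul_self_sqrt hD0
  have hd0 : 0 ≤ d := Real.sqrt_nonneg _
  have hale : a ≤ 1 := by nlinarith
  have hble : b ≤ 1 := by nlinarith
  have hz : |a - b| ≤ 2 * d + η := by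
    rw [abs_le] at hpm ⊢
    have h1 : b - η ≤ b * √A := by nlinarith
    have h2 : b * √A ≤ b := by nlinarith
    have h3 : a - η ≤ a * √B := by nlinarith
    have h4 : a * √B ≤ a := by nlinarith
    constructor <;> linarith [hpm.1, hpm.2]
  have hz2 : (a - b) ^ 2 ≤ (2 * d + η) ^ 2 := by
    rw [← sq_abs]; exact pow_le_pow_left₀ (abs_nonneg _) hz 2
  have hd2 : d ≤ 3 / 2 := by nlinarith
  nlinarith

variable {E : Type*} [NormedAddCommGroup E] [InnerProductSpace ℝ E] [FiniteDimensional ℝ E]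
  [MeasurableSpace E] [BorelSpace E]

local notation "γ" => stdGaussian E

/-- A quantitative Friedland–Hayman inequality in Gauss space, for functions with disjoint
supports. -/
theorem friedland_hayman_of_disjoint {f g : E → ℝ} {p q η : ℝ} (hf : ContDiff ℝ 2 f)
    (hg : ContDiff ℝ 2 g) (hf0 : ∀ x, 0 ≤ f x) (hg0 : ∀ x, 0 ≤ g x) (hfg : ∀ x, f x * g x = 0)
    (hgr : ∀ x, ⟪gradient f x, gradient g x⟫ = 0)
    (hfi : Integrable (fun x => f x ^ 2) γ) (hgi : Integrable (fun x => g x ^ 2) γ)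
    (hfi' : Integrable (fun x => ‖gradient f x‖ ^ 2) γ)
    (hgi' : Integrable (fun x => ‖gradient g x‖ ^ 2) γ)
    (hf1 : ∫ x, f x ^ 2 ∂γ ≤ 1) (hg1 : ∫ x, g x ^ 2 ∂γ ≤ 1)
    (hf2 : 1 - η ≤ ∫ x, f x ^ 2 ∂γ) (hg2 : 1 - η ≤ ∫ x, g x ^ 2 ∂γ)
    (hp : ∫ x, ‖gradient f x‖ ^ 2 ∂γ ≤ p + η) (hq : ∫ x, ‖gradient g x‖ ^ 2 ∂γ ≤ q + η)
    (hη : 0 ≤ η) (hη1 : η ≤ 1) (hp1 : p ≤ 1) :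
    (1 - p) / (1 + 4 * (1 - p)) - 63 * √η ≤ q - 1 := by
  have hfc := hf.continuous
  have hgc := hg.continuous
  have hf' : Continuous (gradient f) := (contDiff_gradient (m := 1) hf (by norm_num)).continuous
  have hg' : Continuous (gradient g) := (contDiff_gradient (m := 1) hg (by norm_num)).continuous
  have hfm : MemLp f 2 γ := (memLp_two_iff_integrable_sq hfc.aestronglyMeasurable).2 hfi
  have hgm : MemLp g 2 γ := (memLp_two_iff_integrable_sq hgc.aestronglyMeasurable).2 hgi
  set a := ∫ x, f x ∂γ with ha
  set b := ∫ x, g x ∂γ with hb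
  have ha0 : 0 ≤ a := integral_nonneg hf0
  have hb0 : 0 ≤ b := integral_nonneg hg0
  have hmean : ∀ {k : E → ℝ}, MemLp k 2 γ → (∫ x, k x ∂γ) ^ 2 ≤ ∫ x, k x ^ 2 ∂γ := fun hk => by
    have := sq_norm_integral_le hk
    simpa only [Real.norm_eq_abs, sq_abs] using this
  have ha1 : a ^ 2 ≤ 1 := (hmean hfm).trans hf1
  have hb1 : b ^ 2 ≤ 1 := (hmean hgm).trans hg1
  set H : E → ℝ := fun x => b * f x - a * g x with hH
  have hHd : ContDiff ℝ 2 H := (contDiff_const.mul hf).sub (contDiff_const.mul hg)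
  have hHg : ∀ x, gradient H x = b • gradient f x - a • gradient g x := by
    intro x
    have h1 := ((hf.differentiable (by norm_num)) x).const_mul b
    have h2 := ((hg.differentiable (by norm_num)) x).const_mul a
    simp only [gradient, hH]
    rw [fderiv_fun_sub h1 h2, fderiv_const_mul ((hf.differentiable (by norm_num)) x),
      fderiv_const_mul ((hg.differentiable (by norm_num)) x)]
    simp
  have eH2 : ∀ x, H x ^ 2 = b ^ 2 * f x ^ 2 + a ^ 2 * g x ^ 2 := fun x => by
    simp only [hH]; linear_combination (-2 * a * b) * hfg x
  have eG2 : ∀ x, ‖gradient H x‖ ^ 2 = b ^ 2 * ‖gradient f x‖ ^ 2 + a ^ 2 * ‖gradient g x‖ ^ 2 := by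
    intro x
    rw [hHg, norm_sub_sq_real, norm_smul, norm_smul, inner_smul_left, inner_smul_right, hgr,
      mul_pow, mul_pow, Real.norm_eq_abs, Real.norm_eq_abs, sq_abs, sq_abs]
    simp
  have hHi : Integrable (fun x => H x ^ 2) γ := by
    simp_rw [eH2]; exact (hfi.const_mul _).add (hgi.const_mul _)
  have hHi' : Integrable (fun x => ‖gradient H x‖ ^ 2) γ := by
    simp_rw [eG2]; exact (hfi'.const_mul _).add (hgi'.const_mul _)
  have iH2 : ∫ x, H x ^ 2 ∂γ = b ^ 2 * ∫ x, f x ^ 2 ∂γ + a ^ 2 * ∫ x, g x ^ 2 ∂γ := by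
    simp_rw [eH2]
    rw [integral_add (hfi.const_mul _) (hgi.const_mul _), integral_const_mul, integral_const_mul]
  have iG2 : ∫ x, ‖gradient H x‖ ^ 2 ∂γ
      = b ^ 2 * ∫ x, ‖gradient f x‖ ^ 2 ∂γ + a ^ 2 * ∫ x, ‖gradient g x‖ ^ 2 ∂γ := by
    simp_rw [eG2]
    rw [integral_add (hfi'.const_mul _) (hgi'.const_mul _), integral_const_mul, integral_const_mul]
  have iH : ∫ x, H x ∂γ = 0 := by
    simp only [hH]
    rw [integral_sub ((hfm.integrable one_le_two).const_mul _)
      ((hgm.integrable one_le_two).const_mul _), integral_const_mul, integral_const_mul]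
    ring
  set w := ∫ x, gradient H x ∂γ with hw
  set D := ∫ x, (H x - ⟪w, x⟫) ^ 2 ∂γ with hD
  have hHm : MemLp H 2 γ := (memLp_two_iff_integrable_sq hHd.continuous.aestronglyMeasurable).2 hHi
  have hLm : MemLp (fun x : E => (⟪w, x⟫ : ℝ)) 2 γ :=
    (IsGaussian.memLp_id γ 2 (by simp)).const_inner w
  have eD : D = ∫ x, H x ^ 2 ∂γ - ‖w‖ ^ 2 := by
    have hHL : Integrable (fun x => H x * ⟪w, x⟫) γ := hHm.integrable_mul hLm
    have i2 : Integrable (fun x => H x ^ 2 - 2 * (H x * ⟪w, x⟫)) γ :=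
      hHm.integrable_sq.sub (hHL.const_mul 2)
    have e1 : D = ∫ x, (H x ^ 2 - 2 * (H x * ⟪w, x⟫) + (⟪w, x⟫ : ℝ) ^ 2) ∂γ :=
      integral_congr_ae (ae_of_all _ fun x => by ring)
    rw [e1, integral_add i2 hLm.integrable_sq, integral_sub hHm.integrable_sq (hHL.const_mul 2),
      integral_const_mul, integral_mul_inner_stdGaussian_of_sq hHd hHi hHi',
      integral_inner_sq_stdGaussian, real_inner_self_eq_norm_sq]
    ring
  have hD0 : 0 ≤ D := integral_nonneg fun _ => sq_nonneg _
  have hP := gaussian_poincare_second hHd hHi hHi'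
  rw [iH, iG2, ← hw] at hP
  rw [iH2] at eD hP
  set A := ∫ x, f x ^ 2 ∂γ
  set B := ∫ x, g x ^ 2 ∂γ
  set F' := ∫ x, ‖gradient f x‖ ^ 2 ∂γ
  set G' := ∫ x, ‖gradient g x‖ ^ 2 ∂γ
  have hDle : D ≤ b ^ 2 * (F' - A) + a ^ 2 * (G' - B) := by nlinarith
  have hDle2 : D ≤ a ^ 2 * (q - 1) - b ^ 2 * (1 - p) + 4 * η := by
    have h1 : b ^ 2 * (F' - A) ≤ b ^ 2 * (p - 1 + 2 * η) := by gcongr; linarith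
    have h2 : a ^ 2 * (G' - B) ≤ a ^ 2 * (q - 1 + 2 * η) := by gcongr; linarith
    nlinarith
  have hD2 : D ≤ 2 := by
    rw [eD]; nlinarith [sq_nonneg ‖w‖, sq_nonneg a, sq_nonneg b]
  -- positive and negative parts of `H`
  have hpm := abs_norm_posPart_sub_norm_negPart_le hHd.continuous hHi w
  have hcase : ∀ x, f x = 0 ∨ g x = 0 := fun x => mul_eq_zero.1 (hfg x)
  have ep : ∫ x, (max (H x) 0) ^ 2 ∂γ = b ^ 2 * A := by
    rw [← integral_const_mul]
    refine integral_congr_ae (ae_of_all _ fun x => ?_)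
    simp only [hH]
    rcases hcase x with h | h
    · rw [h, max_eq_right (by linarith [mul_nonneg ha0 (hg0 x)])]; ring
    · rw [h, max_eq_left (by linarith [mul_nonneg hb0 (hf0 x)])]; ring
  have en : ∫ x, (max (-H x) 0) ^ 2 ∂γ = a ^ 2 * B := by
    rw [← integral_const_mul]
    refine integral_congr_ae (ae_of_all _ fun x => ?_)
    simp only [hH]
    rcases hcase x with h | h
    · rw [h, max_eq_left (by linarith [mul_nonneg ha0 (hg0 x)])]; ring
    · rw [h, max_eq_right (by linarith [mul_nonneg hb0 (hf0 x)])]; ring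
  rw [ep, en, ← hD, Real.sqrt_mul (sq_nonneg _), Real.sqrt_mul (sq_nonneg _), Real.sqrt_sq hb0,
    Real.sqrt_sq ha0] at hpm
  have hz3 := sq_sub_le_of_abs_sub_le ha0 hb0 ha1 hb1 hη hη1 hD0 hD2 hf2 hf1 hg2 hg1 hpm
  refine lower_bound_of_quadratic (m := a) (p := b) (by linarith) hη hη1 (by nlinarith) ?_ ?_
  · have := gaussian_poincare hf hfi hfi'
    linarith
  · have := gaussian_poincare hg hgi hgi'
    linarith

end SegregatedPairs

section Truncation

open ProbabilityTheory Module Filter Topology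

/-- A `C²` substitute for the truncation `s ↦ max (s - δ) 0`. -/
def smoothTrunc (δ s : ℝ) : ℝ := ∫ x in (0 : ℝ)..s, Real.smoothTransition (x / δ)

theorem hasDerivAt_smoothTrunc (δ s : ℝ) :
    HasDerivAt (smoothTrunc δ) (Real.smoothTransition (s / δ)) s :=
  (Continuous.integral_hasStrictDerivAt (f := fun x => Real.smoothTransition (x / δ))
    (Real.smoothTransition.continuous.comp (continuous_id.div_const δ)) 0 s).hasDerivAt

theorem contDiff_smoothTrunc (δ : ℝ) : ContDiff ℝ 2 (smoothTrunc δ) := by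
  rw [show (2 : WithTop ℕ∞) = 1 + 1 by norm_num, contDiff_succ_iff_deriv]
  refine ⟨fun s => (hasDerivAt_smoothTrunc δ s).differentiableAt, by simp, ?_⟩
  rw [show deriv (smoothTrunc δ) = fun s => Real.smoothTransition (s / δ) from
    funext fun s => (hasDerivAt_smoothTrunc δ s).deriv]
  exact Real.smoothTransition.contDiff.comp (contDiff_id.div_const δ)

theorem smoothTrunc_of_nonpos {δ s : ℝ} (hδ : 0 < δ) (hs : s ≤ 0) : smoothTrunc δ s = 0 := by
  unfold smoothTrunc
  rw [intervalIntegral.integral_congr (g := fun _ => (0 : ℝ)), intervalIntegral.integral_zero]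
  intro x hx
  rw [Set.uIcc_of_ge hs] at hx
  exact Real.smoothTransition.zero_of_nonpos (div_nonpos_of_nonpos_of_nonneg hx.2 hδ.le)

theorem smoothTrunc_nonneg (δ : ℝ) {s : ℝ} (hs : 0 ≤ s) : 0 ≤ smoothTrunc δ s :=
  intervalIntegral.integral_nonneg hs fun _ _ => Real.smoothTransition.nonneg _

theorem smoothTrunc_le (δ : ℝ) {s : ℝ} (hs : 0 ≤ s) : smoothTrunc δ s ≤ s := by
  have h := le_of_hasDerivAt_nonneg (f := fun t => t - smoothTrunc δ t) hs
    (fun t => (hasDerivAt_id t).sub (hasDerivAt_smoothTrunc δ t))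
    (fun t _ => sub_nonneg.2 (Real.smoothTransition.le_one _))
  have h0 : smoothTrunc δ 0 = 0 := by simp [smoothTrunc]
  simp only [h0] at h
  linarith

theorem sub_le_smoothTrunc {δ s : ℝ} (hδ : 0 < δ) (hs : 0 ≤ s) : s - δ ≤ smoothTrunc δ s := by
  rcases le_total s δ with h | h
  · linarith [smoothTrunc_nonneg δ hs]
  have h1 := le_of_hasDerivAt_nonneg (f := fun t => smoothTrunc δ t - t) h
    (fun t => (hasDerivAt_smoothTrunc δ t).sub (hasDerivAt_id t))
    (fun t ht => by
      rw [Real.smoothTransition.one_of_one_le ((one_le_div hδ).2 ht.1)]; simp)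
  have := smoothTrunc_nonneg δ hδ.le
  linarith

variable {E : Type*} [NormedAddCommGroup E] [InnerProductSpace ℝ E] [FiniteDimensional ℝ E]
  [MeasurableSpace E] [BorelSpace E]

local notation "γ" => stdGaussian E

theorem smoothTrunc_sub_bounds {δ u w : ℝ} (hδ : 0 < δ) (hu : 0 ≤ u) (hw : 1 ≤ w) :
    0 ≤ smoothTrunc δ (u - δ * w) ∧ smoothTrunc δ (u - δ * w) ≤ u ∧
      u - 2 * δ * w ≤ smoothTrunc δ (u - δ * w) := by
  have h0 : 0 < δ * w := by positivity
  rcases le_total (u - δ * w) 0 with h | h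
  · rw [smoothTrunc_of_nonpos hδ h]
    exact ⟨le_rfl, hu, by linarith⟩
  · refine ⟨smoothTrunc_nonneg δ h, (smoothTrunc_le δ h).trans (by linarith), ?_⟩
    have := sub_le_smoothTrunc hδ h
    nlinarith

theorem gradient_smoothTrunc_sub {U ω : E → ℝ} (hU : ContDiff ℝ 2 U) (hω : ContDiff ℝ 2 ω)
    (δ : ℝ) (x : E) : gradient (fun x => smoothTrunc δ (U x - δ * ω x)) x
      = Real.smoothTransition ((U x - δ * ω x) / δ) • (gradient U x - δ • gradient ω x) := by
  have h1 := hU.differentiable (by norm_num) x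
  have h2 := hω.differentiable (by norm_num) x
  rw [gradient_comp_real (f := fun x => U x - δ * ω x) (hasDerivAt_smoothTrunc δ _)
    (h1.sub (h2.const_mul δ))]
  congr 1
  simp only [gradient]
  rw [fderiv_fun_sub h1 (h2.const_mul δ), fderiv_const_mul h2]
  simp

theorem truncation_estimates {U ω : E → ℝ} {l δ : ℝ} (hU : ContDiff ℝ 2 U) (hω : ContDiff ℝ 2 ω)
    (hU0 : ∀ x, 0 ≤ U x) (hω1 : ∀ x, 1 ≤ ω x) (hδ : 0 < δ) (hδ1 : δ ≤ 1)
    (hUi : Integrable (fun x => U x ^ 2) γ) (hUi' : Integrable (fun x => ‖gradient U x‖ ^ 2) γ)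
    (hωi : Integrable (fun x => ω x ^ 2) γ) (hωi' : Integrable (fun x => ‖gradient ω x‖ ^ 2) γ)
    (hU1 : ∫ x, U x ^ 2 ∂γ = 1) (hl : ∫ x, ‖gradient U x‖ ^ 2 ∂γ ≤ l) (hl2 : l ≤ 2)
    {η : ℝ} (hη : η = 2 * (1 + ∫ x, ω x ^ 2 ∂γ + ∫ x, ‖gradient ω x‖ ^ 2 ∂γ) * δ)
    {f : E → ℝ} (hf : f = fun x => smoothTrunc δ (U x - δ * ω x)) :
    ContDiff ℝ 2 f ∧ (∀ x, 0 ≤ f x) ∧ Integrable (fun x => f x ^ 2) γ ∧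
      Integrable (fun x => ‖gradient f x‖ ^ 2) γ ∧ ∫ x, f x ^ 2 ∂γ ≤ 1 ∧
      1 - η ≤ ∫ x, f x ^ 2 ∂γ ∧ ∫ x, ‖gradient f x‖ ^ 2 ∂γ ≤ l + η := by
  have hfd : ContDiff ℝ 2 f := by
    rw [hf]; exact (contDiff_smoothTrunc δ).comp (hU.sub (contDiff_const.mul hω))
  have hb := fun x => smoothTrunc_sub_bounds hδ (hU0 x) (hω1 x)
  have hf' : Continuous (gradient f) := (contDiff_gradient (m := 1) hfd (by norm_num)).continuous
  have hf0 : ∀ x, 0 ≤ f x := fun x => by rw [hf]; exact (hb x).1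
  have hfU : ∀ x, f x ≤ U x := fun x => by rw [hf]; exact (hb x).2.1
  have hfl : ∀ x, U x - 2 * δ * ω x ≤ f x := fun x => by rw [hf]; exact (hb x).2.2
  have hW0 : 0 ≤ ∫ x, ω x ^ 2 ∂γ := integral_nonneg fun _ => by positivity
  have hW1 : 0 ≤ ∫ x, ‖gradient ω x‖ ^ 2 ∂γ := integral_nonneg fun _ => by positivity
  have hfi : Integrable (fun x => f x ^ 2) γ := by
    refine hUi.mono' (hfd.continuous.pow 2).aestronglyMeasurable (ae_of_all _ fun x => ?_)
    rw [Real.norm_of_nonneg (sq_nonneg _)]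
    exact pow_le_pow_left₀ (hf0 x) (hfU x) 2
  have hgb : ∀ x, ‖gradient f x‖ ^ 2
      ≤ (1 + δ) * ‖gradient U x‖ ^ 2 + 2 * δ * ‖gradient ω x‖ ^ 2 := by
    intro x
    have h1 : ‖gradient f x‖ ≤ ‖gradient U x‖ + δ * ‖gradient ω x‖ := by
      rw [hf, gradient_smoothTrunc_sub hU hω, norm_smul, Real.norm_of_nonneg
        (Real.smoothTransition.nonneg _)]
      refine (mul_le_of_le_one_left (norm_nonneg _) (Real.smoothTransition.le_one _)).trans
        ((norm_sub_le _ _).trans_eq ?_)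
      rw [norm_smul, Real.norm_of_nonneg hδ.le]
    have h2 := pow_le_pow_left₀ (norm_nonneg _) h1 2
    have h3 := mul_nonneg hδ.le (sq_nonneg (‖gradient U x‖ - ‖gradient ω x‖))
    have h4 : δ * δ * ‖gradient ω x‖ ^ 2 ≤ δ * ‖gradient ω x‖ ^ 2 := by
      gcongr; nlinarith
    nlinarith
  have hgi2 : Integrable (fun x => (1 + δ) * ‖gradient U x‖ ^ 2 + 2 * δ * ‖gradient ω x‖ ^ 2) γ :=
    (hUi'.const_mul _).add (hωi'.const_mul _)
  have hgi : Integrable (fun x => ‖gradient f x‖ ^ 2) γ := by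
    refine hgi2.mono' (hf'.norm.pow 2).aestronglyMeasurable (ae_of_all _ fun x => ?_)
    rw [Real.norm_of_nonneg (sq_nonneg _)]
    exact hgb x
  refine ⟨hfd, hf0, hfi, hgi, ?_, ?_, ?_⟩
  · rw [← hU1]
    exact integral_mono hfi hUi fun x => pow_le_pow_left₀ (hf0 x) (hfU x) 2
  · have h1 : ∫ x, (U x ^ 2 - 2 * δ * (U x ^ 2 + ω x ^ 2)) ∂γ ≤ ∫ x, f x ^ 2 ∂γ := by
      refine integral_mono (hUi.sub ((hUi.add hωi).const_mul _)) hfi fun x => ?_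
      have hx1 := hfl x
      have hx2 := hfU x
      have hx3 := mul_nonneg hδ.le (sq_nonneg (U x - ω x))
      have hx4 := mul_nonneg (hU0 x) (sub_nonneg.2 hx1)
      change U x ^ 2 - 2 * δ * (U x ^ 2 + ω x ^ 2) ≤ f x ^ 2
      nlinarith [sq_nonneg (U x - f x)]
    have i2 : Integrable (fun x => 2 * δ * (U x ^ 2 + ω x ^ 2)) γ := (hUi.add hωi).const_mul _
    rw [integral_sub hUi i2, integral_const_mul, integral_add hUi hωi, hU1] at h1
    rw [hη]
    nlinarith
  · have h1 := integral_mono hgi hgi2 hgb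
    rw [integral_add (hUi'.const_mul _) (hωi'.const_mul _), integral_const_mul,
      integral_const_mul] at h1
    rw [hη]
    have h2 : (1 + δ) * ∫ x, ‖gradient U x‖ ^ 2 ∂γ ≤ (1 + δ) * l := by gcongr
    nlinarith [mul_nonneg hδ.le hW0, mul_nonneg hδ.le hW1]

/-- The weight `exp(‖y‖² / 12)`. -/
def expWeight (y : E) : ℝ := Real.exp (‖y‖ ^ 2 / 12)

theorem one_le_expWeight (y : E) : 1 ≤ expWeight y := Real.one_le_exp (by positivity)

theorem contDiff_expWeight : ContDiff ℝ 2 (expWeight : E → ℝ) := by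
  unfold expWeight
  exact ((contDiff_norm_sq ℝ).div_const 12).exp

theorem gradient_expWeight (y : E) : gradient expWeight y = (expWeight y / 6) • y := by
  have h := ((hasStrictFDerivAt_norm_sq y).hasFDerivAt.mul_const (12 : ℝ)⁻¹).exp
  refine (InnerProductSpace.toDual ℝ E).injective ?_
  rw [gradient, LinearIsometryEquiv.apply_symm_apply]
  have e : (expWeight : E → ℝ) = fun y => Real.exp (‖y‖ ^ 2 * (12 : ℝ)⁻¹) := by
    ext y; simp only [expWeight, div_eq_mul_inv]
  rw [e, h.fderiv]
  ext v
  simp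
  ring

theorem integrable_expWeight_sq : Integrable (fun y : E => expWeight y ^ 2) γ := by
  rw [integrable_stdGaussian_iff]
  refine ((integrable_exp_neg_mul_sq_norm (E := E) (β := 1 / 3) (by norm_num)).const_mul
    ((2 * Real.pi) ^ (-(finrank ℝ E : ℝ) / 2))).congr (ae_of_all _ fun y => ?_)
  simp only [gaussDens, expWeight, smul_eq_mul]
  rw [← Real.exp_nat_mul, mul_assoc, ← Real.exp_add]
  congr 2
  push_cast
  ring

theorem integrable_gradient_expWeight_sq :
    Integrable (fun y : E => ‖gradient (expWeight : E → ℝ) y‖ ^ 2) γ := by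
  rw [integrable_stdGaussian_iff]
  have hc : Continuous (gradient (expWeight : E → ℝ)) :=
    (contDiff_gradient (m := 1) contDiff_expWeight (by norm_num)).continuous
  refine ((integrable_exp_neg_mul_sq_norm (E := E) (β := 1 / 6) (by norm_num)).const_mul
    ((2 * Real.pi) ^ (-(finrank ℝ E : ℝ) / 2))).mono'
    (continuous_gaussDens.smul (hc.norm.pow 2)).aestronglyMeasurable (ae_of_all _ fun y => ?_)
  rw [Real.norm_of_nonneg (smul_nonneg (gaussDens_pos y).le (sq_nonneg _)), gradient_expWeight,
    norm_smul, mul_pow, Real.norm_eq_abs, sq_abs, div_pow]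
  simp only [gaussDens, expWeight, smul_eq_mul]
  rw [← Real.exp_nat_mul, mul_assoc]
  have h1 : ‖y‖ ^ 2 / 6 ≤ Real.exp (‖y‖ ^ 2 / 6) := by linarith [Real.add_one_le_exp (‖y‖ ^ 2 / 6)]
  have hpi : (0 : ℝ) ≤ (2 * Real.pi) ^ (-(finrank ℝ E : ℝ) / 2) := by positivity
  refine mul_le_mul_of_nonneg_left ?_ hpi
  have e1 : Real.exp (-(1 / 6) * ‖y‖ ^ 2) = Real.exp (-‖y‖ ^ 2 / 2)
      * (Real.exp ((2 : ℕ) * (‖y‖ ^ 2 / 12)) * Real.exp (‖y‖ ^ 2 / 6)) := by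
    rw [← Real.exp_add, ← Real.exp_add]; congr 1; push_cast; ring
  rw [e1]
  refine mul_le_mul_of_nonneg_left ?_ (Real.exp_pos _).le
  rw [div_mul_eq_mul_div, mul_div_assoc]
  refine mul_le_mul_of_nonneg_left ?_ (Real.exp_pos _).le
  refine le_trans ?_ h1
  have := sq_nonneg ‖y‖
  linarith

variable (E) in
/-- A quantitative Friedland–Hayman inequality in Gauss space, for almost segregated functions. -/
theorem friedland_hayman_of_almost_disjoint : ∃ C > 0, ∀ (U V : E → ℝ) (p q δ : ℝ),
    ContDiff ℝ 2 U → ContDiff ℝ 2 V → (∀ x, 0 ≤ U x) → (∀ x, 0 ≤ V x) →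
    Integrable (fun x => U x ^ 2) γ → Integrable (fun x => V x ^ 2) γ →
    Integrable (fun x => ‖gradient U x‖ ^ 2) γ → Integrable (fun x => ‖gradient V x‖ ^ 2) γ →
    ∫ x, U x ^ 2 ∂γ = 1 → ∫ x, V x ^ 2 ∂γ = 1 → ∫ x, ‖gradient U x‖ ^ 2 ∂γ ≤ p →
    ∫ x, ‖gradient V x‖ ^ 2 ∂γ ≤ q → p ≤ 1 → 0 < δ → δ ≤ 1 →
    (∀ x, U x ≤ δ * expWeight x ∨ V x ≤ δ * expWeight x) →
    (1 - p) / (1 + 4 * (1 - p)) - C * √δ ≤ q - 1 := by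
  set C₀ : ℝ := 2 * (1 + ∫ x : E, expWeight x ^ 2 ∂γ
    + ∫ x, ‖gradient (expWeight : E → ℝ) x‖ ^ 2 ∂γ) with hC₀
  have hW0 : 0 ≤ ∫ x : E, expWeight x ^ 2 ∂γ := integral_nonneg fun _ => by positivity
  have hW1 : 0 ≤ ∫ x, ‖gradient (expWeight : E → ℝ) x‖ ^ 2 ∂γ :=
    integral_nonneg fun _ => by positivity
  have hC₀p : 0 < C₀ := by positivity
  refine ⟨63 * √C₀, by positivity, fun U V p q δ hU hV hU0 hV0 hUi hVi hUi' hVi' hU1 hV1 hp hq hp1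
    hδ hδ1 hseg => ?_⟩
  have hq0 : 0 ≤ q := le_trans (integral_nonneg fun _ => by positivity) hq
  have hs : (1 - p) / (1 + 4 * (1 - p)) ≤ 1 := by
    rw [div_le_one (by linarith)]; linarith
  rw [mul_assoc, ← Real.sqrt_mul hC₀p.le]
  rcases lt_or_ge 1 (C₀ * δ) with h1 | h1
  · have : 1 ≤ √(C₀ * δ) := Real.one_le_sqrt.2 h1.le
    linarith
  rcases lt_or_ge 2 q with h2 | h2
  · have : 0 ≤ √(C₀ * δ) := Real.sqrt_nonneg _
    linarith
  obtain ⟨a1, a2, a3, a4, a5, a6, a7⟩ := truncation_estimates hU contDiff_expWeight hU0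
    one_le_expWeight hδ hδ1 hUi hUi' integrable_expWeight_sq integrable_gradient_expWeight_sq
    hU1 hp (by linarith) rfl rfl
  obtain ⟨b1, b2, b3, b4, b5, b6, b7⟩ := truncation_estimates hV contDiff_expWeight hV0
    one_le_expWeight hδ hδ1 hVi hVi' integrable_expWeight_sq integrable_gradient_expWeight_sq
    hV1 hq h2 rfl rfl
  have hz : ∀ {s : ℝ}, s ≤ 0 → Real.smoothTransition (s / δ) = 0 := fun hs =>
    Real.smoothTransition.zero_of_nonpos (div_nonpos_of_nonpos_of_nonneg hs hδ.le)
  refine friedland_hayman_of_disjoint a1 b1 a2 b2 (fun x => ?_) (fun x => ?_) a3 b3 a4 b4 a5 b5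
    a6 b6 a7 b7 (by positivity) h1 hp1
  · rcases hseg x with h | h
    · rw [smoothTrunc_of_nonpos hδ (sub_nonpos.2 h), zero_mul]
    · rw [smoothTrunc_of_nonpos hδ (s := V x - _) (sub_nonpos.2 h), mul_zero]
  · rw [gradient_smoothTrunc_sub hU contDiff_expWeight,
      gradient_smoothTrunc_sub hV contDiff_expWeight]
    rcases hseg x with h | h
    · rw [hz (sub_nonpos.2 h), zero_smul, inner_zero_left]
    · rw [hz (s := V x - _) (sub_nonpos.2 h), zero_smul, inner_zero_right]

end Truncation

section Divergence

variable {n : ℕ}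

local notation "𝔼" => EuclideanSpace ℝ (Fin n)

def divergence (Z : 𝔼 → 𝔼) (x : 𝔼) : ℝ :=
  ∑ i, ⟪fderiv ℝ Z x (EuclideanSpace.single i 1), EuclideanSpace.single i 1⟫

theorem integrable_divergence {Z : 𝔼 → 𝔼} (hZ : ContDiff ℝ 1 Z) (hc : HasCompactSupport Z) :
    Integrable (divergence Z) := by
  have hcont : Continuous (fderiv ℝ Z) := hZ.continuous_fderiv one_ne_zero
  refine integrable_finsetSum _ fun i _ => Continuous.integrable_of_hasCompactSupport
    (by fun_prop) ?_
  exact (hc.fderiv (𝕜 := ℝ)).comp_left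
      (g := fun L : 𝔼 →L[ℝ] 𝔼 => (⟪L (EuclideanSpace.single i 1), EuclideanSpace.single i 1⟫ : ℝ))
      (by simp)

theorem integral_divergence {Z : 𝔼 → 𝔼} (hZ : ContDiff ℝ 1 Z) (hc : HasCompactSupport Z) :
    ∫ x, divergence Z x = 0 := by
  have hcf : ∀ i : Fin n, HasCompactSupport fun x =>
      (⟪fderiv ℝ Z x (EuclideanSpace.single i 1), EuclideanSpace.single i 1⟫ : ℝ) := fun i =>
    (hc.fderiv (𝕜 := ℝ)).comp_left
      (g := fun L : 𝔼 →L[ℝ] 𝔼 => (⟪L (EuclideanSpace.single i 1), EuclideanSpace.single i 1⟫ : ℝ))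
      (by simp)
  have hcont : Continuous (fderiv ℝ Z) := hZ.continuous_fderiv one_ne_zero
  have hi : ∀ i : Fin n, Integrable fun x =>
      (⟪fderiv ℝ Z x (EuclideanSpace.single i 1), EuclideanSpace.single i 1⟫ : ℝ) := fun i =>
    Continuous.integrable_of_hasCompactSupport (by fun_prop) (hcf i)
  unfold divergence
  rw [integral_finsetSum _ fun i _ => hi i]
  refine Finset.sum_eq_zero fun i _ => ?_
  have hd : ∀ x, fderiv ℝ (fun x => (⟪Z x, EuclideanSpace.single i 1⟫ : ℝ)) x
      (EuclideanSpace.single i 1)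
      = ⟪fderiv ℝ Z x (EuclideanSpace.single i 1), EuclideanSpace.single i 1⟫ := by
    intro x
    rw [fderiv_inner_apply ℝ (hZ.differentiable one_ne_zero x) (differentiableAt_const _)]
    simp
  have h := integral_mul_fderiv_eq_neg_fderiv_mul_of_integrable (μ := (volume : Measure 𝔼))
    (f := fun _ => (1 : ℝ)) (g := fun x => (⟪Z x, EuclideanSpace.single i 1⟫ : ℝ))
    (v := EuclideanSpace.single i 1) (by simp) (by simpa only [hd, one_mul] using hi i)
    (by
      simp only [one_mul]
      exact Continuous.integrable_of_hasCompactSupport (by have := hZ.continuous; fun_prop)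
        (hc.comp_left (g := fun z : 𝔼 => (⟪z, EuclideanSpace.single i 1⟫ : ℝ)) (by simp)))
    (by simp) (fun x _ => (hZ.differentiable one_ne_zero x).inner ℝ (differentiableAt_const _))
  simpa [hd] using h

theorem divergence_smul {f : 𝔼 → ℝ} {Z : 𝔼 → 𝔼} {x : 𝔼} (hf : DifferentiableAt ℝ f x)
    (hZ : DifferentiableAt ℝ Z x) :
    divergence (fun x => f x • Z x) x = fderiv ℝ f x (Z x) + f x * divergence Z x := by
  unfold divergence
  rw [fderiv_fun_smul hf hZ]
  simp only [add_apply, smul_apply, ContinuousLinearMap.smulRight_apply, inner_add_left,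
    inner_smul_left, Finset.sum_add_distrib, Finset.mul_sum]
  rw [add_comm]
  congr 1
  have h1 : Z x = ∑ i, ⟪Z x, EuclideanSpace.single i 1⟫ • EuclideanSpace.single i (1 : ℝ) := by
    have := (EuclideanSpace.basisFun (Fin n) ℝ).sum_repr' (Z x)
    simp only [EuclideanSpace.basisFun_apply] at this
    conv_lhs => rw [← this]
    simp_rw [real_inner_comm]
  conv_rhs => rw [h1]
  simp [mul_comm]

theorem divergence_id (x : 𝔼) : divergence (fun x => x) x = n := by
  unfold divergence
  simp

theorem inner_fderiv_gradient {u : 𝔼 → ℝ} (hu : ContDiff ℝ 2 u) (x w z : 𝔼) :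
    ⟪fderiv ℝ (gradient u) x w, z⟫ = fderiv ℝ (fderiv ℝ u) x w z := by
  have h1 : DifferentiableAt ℝ (fderiv ℝ u) x :=
    (hu.fderiv_right (m := 1) (by norm_num)).differentiable one_ne_zero x
  have h2 : DifferentiableAt ℝ (gradient u) x :=
    (contDiff_gradient (m := 1) hu (by norm_num)).differentiable one_ne_zero x
  have h3 := fderiv_inner_apply ℝ h2 (differentiableAt_const z) w
  simp only [inner_gradient_left] at h3
  rw [fderiv_clm_apply h1 (differentiableAt_const _)] at h3
  simpa using h3.symm

theorem divergence_gradient {u : 𝔼 → ℝ} (hu : ContDiff ℝ 2 u) (x : 𝔼) :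
    divergence (gradient u) x = lap u x := by
  unfold divergence lap
  refine Finset.sum_congr rfl fun i _ => ?_
  rw [inner_fderiv_gradient hu, iteratedFDeriv_two_apply]

theorem fderiv_apply_gradient (u : 𝔼 → ℝ) (x : 𝔼) :
    fderiv ℝ u x (gradient u x) = ‖gradient u x‖ ^ 2 := by
  rw [← inner_gradient_left, real_inner_self_eq_norm_sq]

/-- Derivative of the radial derivative `x ↦ x · ∇u(x)`. -/
theorem fderiv_radial_deriv {u : 𝔼 → ℝ} (hu : ContDiff ℝ 2 u) (x w : 𝔼) :
    fderiv ℝ (fun y => fderiv ℝ u y y) x w = fderiv ℝ (fderiv ℝ u) x x w + fderiv ℝ u x w := by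
  have h1 : DifferentiableAt ℝ (fderiv ℝ u) x :=
    (hu.fderiv_right (m := 1) (by norm_num)).differentiable one_ne_zero x
  have hsym := (hu.contDiffAt (x := x)).isSymmSndFDerivAt (by simp)
  rw [fderiv_clm_apply h1 differentiableAt_fun_id]
  simp [hsym.eq w x, add_comm]

theorem fderiv_norm_gradient_sq {u : 𝔼 → ℝ} (hu : ContDiff ℝ 2 u) (x w : 𝔼) :
    fderiv ℝ (fun y => ‖gradient u y‖ ^ 2) x w
      = 2 * fderiv ℝ (fderiv ℝ u) x w (gradient u x) := by
  have h2 : DifferentiableAt ℝ (gradient u) x :=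
    (contDiff_gradient (m := 1) hu (by norm_num)).differentiable one_ne_zero x
  rw [h2.hasFDerivAt.norm_sq.fderiv, ← inner_fderiv_gradient hu]
  simp

/-- The derivative of a radial weight. -/
theorem fderiv_radial {κ κ' : ℝ → ℝ} (hκ : ∀ t, HasDerivAt κ (κ' t) t) (x w : 𝔼) :
    fderiv ℝ (fun x : 𝔼 => κ (‖x‖ ^ 2)) x w = κ' (‖x‖ ^ 2) * (2 * ⟪x, w⟫) := by
  have h := (hκ (‖x‖ ^ 2)).comp_hasFDerivAt x (hasStrictFDerivAt_norm_sq x).hasFDerivAt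
  rw [show (fun x : 𝔼 => κ (‖x‖ ^ 2)) = κ ∘ fun x => ‖x‖ ^ 2 from rfl, h.fderiv]
  simp

theorem hasCompactSupport_radial {κ : ℝ → ℝ} {R : ℝ} (hR : ∀ t, R ≤ t → κ t = 0) :
    HasCompactSupport (fun x : 𝔼 => κ (‖x‖ ^ 2)) := by
  refine HasCompactSupport.intro (isCompact_closedBall (0 : 𝔼) √R) fun x hx => hR _ ?_
  rw [mem_closedBall_zero_iff, not_le] at hx
  exact (Real.lt_sq_of_sqrt_lt hx).le

section Identities

variable {κ κ' : ℝ → ℝ} {R : ℝ} {u v : EuclideanSpace ℝ (Fin n) → ℝ}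

/-- Divergence theorem for the field `κ(‖x‖²) u² x`. -/
theorem integral_radial_sq (hκ : ContDiff ℝ 1 κ) (hκ' : ∀ t, HasDerivAt κ (κ' t) t)
    (hR : ∀ t, R ≤ t → κ t = 0) (hu : ContDiff ℝ 2 u) :
    ∫ x : 𝔼, ((n * u x ^ 2 + 2 * (u x * fderiv ℝ u x x)) * κ (‖x‖ ^ 2)
      + 2 * (‖x‖ ^ 2 * u x ^ 2) * κ' (‖x‖ ^ 2)) = 0 := by
  have hκr : ContDiff ℝ 1 fun x : 𝔼 => κ (‖x‖ ^ 2) := hκ.comp (contDiff_norm_sq ℝ)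
  have hu1 : ContDiff ℝ 1 u := hu.of_le (by norm_num)
  have hf : ContDiff ℝ 1 fun x : 𝔼 => κ (‖x‖ ^ 2) * u x ^ 2 := hκr.mul (hu1.pow 2)
  have h := integral_divergence (Z := fun x : 𝔼 => (κ (‖x‖ ^ 2) * u x ^ 2) • x)
    (hf.smul contDiff_id) ((hasCompactSupport_radial hR).mul_right.smul_right)
  rw [← h]
  refine integral_congr_ae (ae_of_all _ fun x => ?_)
  simp only
  rw [divergence_smul (hf.differentiable one_ne_zero x) differentiableAt_fun_id, divergence_id,
    fderiv_fun_mul (hκr.differentiable one_ne_zero x)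
      ((hu1.differentiable one_ne_zero x).fun_pow 2), fderiv_fun_pow 2 (hu1.differentiable one_ne_zero x)]
  simp only [add_apply, smul_apply, fderiv_radial hκ', smul_eq_mul, real_inner_self_eq_norm_sq]
  simp
  ring

/-- Divergence theorem for the field `κ(‖x‖²) u ∇u`. -/
theorem integral_radial_mul_gradient (hκ : ContDiff ℝ 1 κ) (hκ' : ∀ t, HasDerivAt κ (κ' t) t)
    (hR : ∀ t, R ≤ t → κ t = 0) (hu : ContDiff ℝ 2 u) (hlap : ∀ x, lap u x = u x * v x ^ 2) :
    ∫ x : 𝔼, ((‖gradient u x‖ ^ 2 + u x ^ 2 * v x ^ 2) * κ (‖x‖ ^ 2)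
      + 2 * (u x * fderiv ℝ u x x) * κ' (‖x‖ ^ 2)) = 0 := by
  have hκr : ContDiff ℝ 1 fun x : 𝔼 => κ (‖x‖ ^ 2) := hκ.comp (contDiff_norm_sq ℝ)
  have hu1 : ContDiff ℝ 1 u := hu.of_le (by norm_num)
  have hg : ContDiff ℝ 1 (gradient u) := contDiff_gradient hu (by norm_num)
  have hf : ContDiff ℝ 1 fun x : 𝔼 => κ (‖x‖ ^ 2) * u x := hκr.mul hu1
  have h := integral_divergence (Z := fun x : 𝔼 => (κ (‖x‖ ^ 2) * u x) • gradient u x)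
    (hf.smul hg) ((hasCompactSupport_radial hR).mul_right.smul_right)
  rw [← h]
  refine integral_congr_ae (ae_of_all _ fun x => ?_)
  simp only
  rw [divergence_smul (hf.differentiable one_ne_zero x) (hg.differentiable one_ne_zero x),
    divergence_gradient hu, hlap, fderiv_fun_mul (hκr.differentiable one_ne_zero x)
      (hu1.differentiable one_ne_zero x)]
  simp only [add_apply, smul_apply, fderiv_radial hκ', smul_eq_mul, fderiv_apply_gradient,
    inner_gradient_right]
  simp
  ring

/-- The Rellich–Pohozaev identity: divergence theorem for
`κ(‖x‖²) (2 (x · ∇u) ∇u + 2 (x · ∇v) ∇v - e x)` with `e = |∇u|² + |∇v|² + u² v²`. -/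
theorem integral_radial_pohozaev (hκ : ContDiff ℝ 1 κ) (hκ' : ∀ t, HasDerivAt κ (κ' t) t)
    (hR : ∀ t, R ≤ t → κ t = 0) (hu : ContDiff ℝ 2 u) (hv : ContDiff ℝ 2 v)
    (hlap : ∀ x, lap u x = u x * v x ^ 2) (hlapv : ∀ x, lap v x = v x * u x ^ 2) :
    ∫ x : 𝔼, ((2 * (‖gradient u x‖ ^ 2 + ‖gradient v x‖ ^ 2)
        - n * (‖gradient u x‖ ^ 2 + ‖gradient v x‖ ^ 2 + u x ^ 2 * v x ^ 2)) * κ (‖x‖ ^ 2)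
      + 2 * (2 * fderiv ℝ u x x ^ 2 + 2 * fderiv ℝ v x x ^ 2
        - ‖x‖ ^ 2 * (‖gradient u x‖ ^ 2 + ‖gradient v x‖ ^ 2 + u x ^ 2 * v x ^ 2))
          * κ' (‖x‖ ^ 2)) = 0 := by
  have hκr : ContDiff ℝ 1 fun x : 𝔼 => κ (‖x‖ ^ 2) := hκ.comp (contDiff_norm_sq ℝ)
  have hu1 : ContDiff ℝ 1 u := hu.of_le (by norm_num)
  have hv1 : ContDiff ℝ 1 v := hv.of_le (by norm_num)
  have hgu : ContDiff ℝ 1 (gradient u) := contDiff_gradient hu (by norm_num)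
  have hgv : ContDiff ℝ 1 (gradient v) := contDiff_gradient hv (by norm_num)
  have hdu : ContDiff ℝ 1 fun x => fderiv ℝ u x x :=
    (hu.fderiv_right (m := 1) (by norm_num)).clm_apply contDiff_id
  have hdv : ContDiff ℝ 1 fun x => fderiv ℝ v x x :=
    (hv.fderiv_right (m := 1) (by norm_num)).clm_apply contDiff_id
  have hnu : ContDiff ℝ 1 fun x => ‖gradient u x‖ ^ 2 := hgu.norm_sq ℝ
  have hnv : ContDiff ℝ 1 fun x => ‖gradient v x‖ ^ 2 := hgv.norm_sq ℝ
  have hsum : ContDiff ℝ 1 fun x => ‖gradient u x‖ ^ 2 + ‖gradient v x‖ ^ 2 := hnu.add hnv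
  have huv : ContDiff ℝ 1 fun x => u x ^ 2 * v x ^ 2 := (hu1.pow 2).mul (hv1.pow 2)
  have he : ContDiff ℝ 1 fun x => ‖gradient u x‖ ^ 2 + ‖gradient v x‖ ^ 2 + u x ^ 2 * v x ^ 2 :=
    hsum.add huv
  have hf1 : ContDiff ℝ 1 fun x : 𝔼 => κ (‖x‖ ^ 2) * fderiv ℝ u x x := hκr.mul hdu
  have hf2 : ContDiff ℝ 1 fun x : 𝔼 => κ (‖x‖ ^ 2) * fderiv ℝ v x x := hκr.mul hdv
  have hf3 : ContDiff ℝ 1 fun x : 𝔼 => κ (‖x‖ ^ 2) *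
    (‖gradient u x‖ ^ 2 + ‖gradient v x‖ ^ 2 + u x ^ 2 * v x ^ 2) := hκr.mul he
  have hs := hasCompactSupport_radial (n := n) hR
  have c1 := hs.mul_right (f' := fun x => fderiv ℝ u x x) |>.smul_right (f' := gradient u)
  have c2 := hs.mul_right (f' := fun x => fderiv ℝ v x x) |>.smul_right (f' := gradient v)
  have c3 := hs.mul_right (f' := fun x => ‖gradient u x‖ ^ 2 + ‖gradient v x‖ ^ 2
    + u x ^ 2 * v x ^ 2) |>.smul_right (f' := fun x : 𝔼 => x)
  have z1 := integral_divergence (Z := fun x => (κ (‖x‖ ^ 2) * fderiv ℝ u x x) • gradient u x)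
    (hf1.smul hgu) c1
  have z2 := integral_divergence (Z := fun x => (κ (‖x‖ ^ 2) * fderiv ℝ v x x) • gradient v x)
    (hf2.smul hgv) c2
  have z3 := integral_divergence (Z := fun x => (κ (‖x‖ ^ 2) *
    (‖gradient u x‖ ^ 2 + ‖gradient v x‖ ^ 2 + u x ^ 2 * v x ^ 2)) • x) (hf3.smul contDiff_id) c3
  have i1 := (integrable_divergence (Z := fun x => (κ (‖x‖ ^ 2) * fderiv ℝ u x x) • gradient u x)
    (hf1.smul hgu) c1).const_mul 2
  have i2 := (integrable_divergence (Z := fun x => (κ (‖x‖ ^ 2) * fderiv ℝ v x x) • gradient v x)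
    (hf2.smul hgv) c2).const_mul 2
  have i3 := integrable_divergence (Z := fun x => (κ (‖x‖ ^ 2) *
    (‖gradient u x‖ ^ 2 + ‖gradient v x‖ ^ 2 + u x ^ 2 * v x ^ 2)) • x) (hf3.smul contDiff_id) c3
  have hzero := integral_sub (i1.add i2) i3
  rw [integral_add' i1 i2, integral_const_mul, integral_const_mul, z1, z2, z3,
    show (2 * 0 + 2 * 0 - 0 : ℝ) = 0 by norm_num] at hzero
  rw [← hzero]
  refine integral_congr_ae (ae_of_all _ fun x => ?_)
  have dκ := hκr.differentiable one_ne_zero x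
  have du := hu1.differentiable one_ne_zero x
  have dv := hv1.differentiable one_ne_zero x
  have e1 := divergence_smul (hf1.differentiable one_ne_zero x) (hgu.differentiable one_ne_zero x)
  have e2 := divergence_smul (hf2.differentiable one_ne_zero x) (hgv.differentiable one_ne_zero x)
  have e3 := divergence_smul (hf3.differentiable one_ne_zero x) (differentiableAt_fun_id (𝕜 := ℝ))
  rw [divergence_gradient hu, hlap, fderiv_fun_mul dκ (hdu.differentiable one_ne_zero x)] at e1
  rw [divergence_gradient hv, hlapv, fderiv_fun_mul dκ (hdv.differentiable one_ne_zero x)] at e2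
  rw [divergence_id, fderiv_fun_mul dκ (he.differentiable one_ne_zero x),
    fderiv_fun_add (hsum.differentiable one_ne_zero x) (huv.differentiable one_ne_zero x),
    fderiv_fun_add (hnu.differentiable one_ne_zero x) (hnv.differentiable one_ne_zero x),
    fderiv_fun_mul (du.fun_pow 2) (dv.fun_pow 2), fderiv_fun_pow 2 du, fderiv_fun_pow 2 dv] at e3
  simp only [add_apply, smul_apply, fderiv_radial hκ', smul_eq_mul, fderiv_apply_gradient,
    inner_gradient_right, fderiv_radial_deriv hu, fderiv_radial_deriv hv,
    fderiv_norm_gradient_sq hu, fderiv_norm_gradient_sq hv, real_inner_self_eq_norm_sq,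
    conj_trivial] at e1 e2 e3
  simp only [Pi.add_apply]
  rw [e1, e2, e3]
  have hsu := (hu.contDiffAt (x := x)).isSymmSndFDerivAt (by simp) |>.eq x (gradient u x)
  have hsv := (hv.contDiffAt (x := x)).isSymmSndFDerivAt (by simp) |>.eq x (gradient v x)
  rw [hsu, hsv]
  simp only [two_smul, pow_one, Nat.add_one_sub_one]
  ring

end Identities

end Divergence

/-- A smooth cutoff on the line, equal to one on `(-∞, 0]` and to zero on `[1, ∞)`. -/
theorem exists_real_cutoff : ∃ (χ χ' : ℝ → ℝ) (C : ℝ), ContDiff ℝ 1 χ ∧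
    (∀ t, HasDerivAt χ (χ' t) t) ∧ (∀ t, 0 ≤ χ t) ∧ (∀ t, χ t ≤ 1) ∧ (∀ t, |χ' t| ≤ C) ∧
    (∀ t, t ≤ 0 → χ t = 1) ∧ (∀ t, t < 0 → χ' t = 0) ∧ ∀ t, 1 ≤ t → χ t = 0 := by
  have hc : ContDiff ℝ 1 fun t : ℝ => Real.smoothTransition (1 - t) :=
    Real.smoothTransition.contDiff.comp (contDiff_const.sub contDiff_id)
  have hd : Continuous (deriv fun t : ℝ => Real.smoothTransition (1 - t)) :=
    hc.continuous_deriv le_rfl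
  have h1 : ∀ t, t ≤ 0 → Real.smoothTransition (1 - t) = 1 := fun t ht =>
    Real.smoothTransition.one_of_one_le (by linarith)
  have h0 : ∀ t, 1 ≤ t → Real.smoothTransition (1 - t) = 0 := fun t ht =>
    Real.smoothTransition.zero_of_nonpos (by linarith)
  have hd1 : ∀ t, t < 0 → deriv (fun t : ℝ => Real.smoothTransition (1 - t)) t = 0 := by
    intro t ht
    have : (fun t : ℝ => Real.smoothTransition (1 - t)) =ᶠ[nhds t] fun _ => 1 := by
      filter_upwards [Iio_mem_nhds ht] with s hs using h1 s (le_of_lt hs)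
    rw [this.deriv_eq]
    simp
  have hd0 : ∀ t, 1 < t → deriv (fun t : ℝ => Real.smoothTransition (1 - t)) t = 0 := by
    intro t ht
    have : (fun t : ℝ => Real.smoothTransition (1 - t)) =ᶠ[nhds t] fun _ => 0 := by
      filter_upwards [Ioi_mem_nhds ht] with s hs using h0 s (le_of_lt hs)
    rw [this.deriv_eq]
    simp
  obtain ⟨C, hC⟩ := (isCompact_Icc (a := (0 : ℝ)) (b := 1)).exists_bound_of_continuousOn
    hd.continuousOn
  refine ⟨_, _, max C 0, hc, fun t => (hc.differentiable one_ne_zero t).hasDerivAt,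
    fun t => Real.smoothTransition.nonneg _, fun t => Real.smoothTransition.le_one _, fun t => ?_,
    h1, hd1, h0⟩
  rcases lt_or_ge t 0 with h | h
  · simp [hd1 t h]
  rcases lt_or_ge 1 t with h' | h'
  · simp [hd0 t h']
  · exact (hC t ⟨h, h'⟩).trans (le_max_left _ _)

section GaussInt

variable {n : ℕ}

local notation "𝔼" => EuclideanSpace ℝ (Fin n)

/-- Functions integrable against every centred Gaussian weight. -/
def GaussInt (g : 𝔼 → ℝ) : Prop :=
  ∀ β : ℝ, 0 < β → Integrable fun x => g x * Real.exp (-β * ‖x‖ ^ 2)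

theorem GaussInt.add {f g : 𝔼 → ℝ} (hf : GaussInt f) (hg : GaussInt g) :
    GaussInt fun x => f x + g x := fun β hβ =>
  ((hf β hβ).add (hg β hβ)).congr (ae_of_all _ fun x => by simp [add_mul])

theorem GaussInt.const_mul {f : 𝔼 → ℝ} (hf : GaussInt f) (c : ℝ) :
    GaussInt fun x => c * f x := fun β hβ =>
  ((hf β hβ).const_mul c).congr (ae_of_all _ fun x => by simp [mul_assoc])

theorem GaussInt.sub {f g : 𝔼 → ℝ} (hf : GaussInt f) (hg : GaussInt g) :
    GaussInt fun x => f x - g x := fun β hβ =>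
  ((hf β hβ).sub (hg β hβ)).congr (ae_of_all _ fun x => by simp [sub_mul])

theorem GaussInt.mono {f g : 𝔼 → ℝ} (hg : GaussInt g) (hf : Continuous f)
    (h : ∀ x, |f x| ≤ g x) : GaussInt f := fun β hβ => by
  refine (hg β hβ).mono' (by fun_prop) (ae_of_all _ fun x => ?_)
  rw [Real.norm_eq_abs, abs_mul, Real.abs_exp]
  exact mul_le_mul_of_nonneg_right (h x) (Real.exp_pos _).le

theorem norm_sq_mul_exp_le {β : ℝ} (hβ : 0 < β) (s : ℝ) :
    s * Real.exp (-β * s) ≤ 1 / β := by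
  have h := Real.add_one_le_exp (β * s)
  rw [neg_mul, Real.exp_neg, le_div_iff₀ hβ, ← div_eq_mul_inv, div_mul_eq_mul_div,
    div_le_one (Real.exp_pos _)]
  linarith

theorem GaussInt.norm_sq_mul {g : 𝔼 → ℝ} (hg : GaussInt g) :
    GaussInt fun x => ‖x‖ ^ 2 * g x := fun β hβ => by
  have h := (hg (β / 2) (by positivity)).bdd_mul (c := 1 / (β / 2))
    (f := fun x : 𝔼 => ‖x‖ ^ 2 * Real.exp (-(β / 2) * ‖x‖ ^ 2)) (by fun_prop)
    (ae_of_all _ fun x => ?_)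
  · refine h.congr (ae_of_all _ fun x => ?_)
    simp only
    rw [show -β * ‖x‖ ^ 2 = -(β / 2) * ‖x‖ ^ 2 + -(β / 2) * ‖x‖ ^ 2 by ring, Real.exp_add]
    ring
  · rw [Real.norm_of_nonneg (by positivity)]
    exact norm_sq_mul_exp_le (by positivity) _

theorem gaussInt_const (c : ℝ) : GaussInt fun _ : 𝔼 => c := fun _ hβ =>
  (integrable_exp_neg_mul_sq_norm hβ).const_mul c

theorem GaussInt.of_growth {g : 𝔼 → ℝ} (hg : Continuous g) {C : ℝ}
    (h : ∀ x, |g x| ≤ C * (1 + ‖x‖ ^ 2) ^ 2) : GaussInt g := by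
  have h1 := ((gaussInt_const (n := n) C).add (gaussInt_const C).norm_sq_mul)
  refine (h1.add h1.norm_sq_mul).mono hg fun x => (h x).trans (le_of_eq (by ring))

/-- The integral against a centred Gaussian weight. -/
def weightInt (g : 𝔼 → ℝ) (β : ℝ) : ℝ := ∫ x, g x * Real.exp (-β * ‖x‖ ^ 2)

theorem GaussInt.hasDerivAt_weightInt {g : 𝔼 → ℝ} (hg : GaussInt g) {β : ℝ} (hβ : 0 < β) :
    HasDerivAt (weightInt g) (-weightInt (fun x => ‖x‖ ^ 2 * g x) β) β := by
  have h := (hasDerivAt_integral_of_dominated_loc_of_deriv_le (μ := (volume : Measure 𝔼))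
    (F := fun β x => g x * Real.exp (-β * ‖x‖ ^ 2)) (x₀ := β) (s := Set.Ioi (β / 2))
    (F' := fun β x => -((‖x‖ ^ 2 * g x) * Real.exp (-β * ‖x‖ ^ 2)))
    (bound := fun x => ‖(‖x‖ ^ 2 * g x) * Real.exp (-(β / 2) * ‖x‖ ^ 2)‖)
    (Ioi_mem_nhds (by linarith)) ?_ (hg β hβ) (hg.norm_sq_mul β hβ).neg.aestronglyMeasurable
    (ae_of_all _ fun x b hb => ?_) (hg.norm_sq_mul (β / 2) (by positivity)).norm
    (ae_of_all _ fun x b _ => ?_)).2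
  · rw [integral_neg] at h
    exact h
  · filter_upwards [Ioi_mem_nhds hβ] with b hb using (hg b hb).aestronglyMeasurable
  · simp only [norm_neg, norm_mul, Real.norm_eq_abs (Real.exp _), Real.abs_exp]
    have : β / 2 < b := hb
    gcongr
  · have h1 : HasDerivAt (fun b : ℝ => -b * ‖x‖ ^ 2) (-1 * ‖x‖ ^ 2) b :=
      (hasDerivAt_id b).neg.mul_const _
    exact (h1.exp.const_mul (g x)).congr_deriv (by ring)

/-- A radial identity valid for all compactly supported weights extends to Gaussian weights. -/
theorem weightInt_eq_of_radial {A B : 𝔼 → ℝ} (hA : GaussInt A) (hB : GaussInt B)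
    (h : ∀ (κ κ' : ℝ → ℝ) (R : ℝ), ContDiff ℝ 1 κ → (∀ t, HasDerivAt κ (κ' t) t) →
      (∀ t, R ≤ t → κ t = 0) →
      ∫ x, (A x * κ (‖x‖ ^ 2) + B x * κ' (‖x‖ ^ 2)) = 0) {β : ℝ} (hβ : 0 < β) :
    weightInt A β = β * weightInt B β := by
  obtain ⟨χ, χ', C, hχ, hχ', h0, h1, hC, hone, hder, hzero⟩ := exists_real_cutoff
  have hexp : ∀ t : ℝ, HasDerivAt (fun t => Real.exp (-β * t)) (Real.exp (-β * t) * -β) t :=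
    fun t => by simpa using ((hasDerivAt_id t).const_mul (-β)).exp
  have hid : ∀ k : ℕ, ∫ x, (A x * (Real.exp (-β * ‖x‖ ^ 2) * χ (‖x‖ ^ 2 - k))
      + B x * (Real.exp (-β * ‖x‖ ^ 2) * -β * χ (‖x‖ ^ 2 - k)
        + Real.exp (-β * ‖x‖ ^ 2) * χ' (‖x‖ ^ 2 - k))) = 0 := fun k => by
    refine h (fun t => Real.exp (-β * t) * χ (t - k))
      (fun t => Real.exp (-β * t) * -β * χ (t - k) + Real.exp (-β * t) * χ' (t - k)) (k + 1) ?_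
      (fun t => (hexp t).mul ((hχ' _).comp_sub_const t k)) fun t ht => ?_
    · have : ContDiff ℝ 1 fun t : ℝ => Real.exp (-β * t) :=
        Real.contDiff_exp.comp (contDiff_const.mul contDiff_id)
      exact this.mul (hχ.comp (contDiff_id.sub contDiff_const))
    · rw [hzero _ (by linarith), mul_zero]
  have hχm : Measurable χ' := by
    have : χ' = deriv χ := funext fun t => (hχ' t).deriv.symm
    rw [this]
    exact measurable_deriv χ
  have hχc := hχ.continuous
  have hC0 : 0 ≤ C := (abs_nonneg _).trans (hC 0)
  have hev : ∀ x : 𝔼, ∀ᶠ k : ℕ in Filter.atTop, ‖x‖ ^ 2 - k < 0 := fun x => by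
    filter_upwards [tendsto_natCast_atTop_atTop.eventually_gt_atTop (‖x‖ ^ 2)] with k hk
    linarith
  have lim := tendsto_integral_of_dominated_convergence (μ := (volume : Measure 𝔼))
    (F := fun (k : ℕ) x => A x * (Real.exp (-β * ‖x‖ ^ 2) * χ (‖x‖ ^ 2 - k))
      + B x * (Real.exp (-β * ‖x‖ ^ 2) * -β * χ (‖x‖ ^ 2 - k)
        + Real.exp (-β * ‖x‖ ^ 2) * χ' (‖x‖ ^ 2 - k)))
    (f := fun x => A x * Real.exp (-β * ‖x‖ ^ 2) - β * (B x * Real.exp (-β * ‖x‖ ^ 2)))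
    (fun x => ‖A x * Real.exp (-β * ‖x‖ ^ 2)‖ + (β + C) * ‖B x * Real.exp (-β * ‖x‖ ^ 2)‖)
    (fun k => ?_) ((hA β hβ).norm.add ((hB β hβ).norm.const_mul _))
    (fun k => ae_of_all _ fun x => ?_) (ae_of_all _ fun x => ?_)
  · simp only [hid] at lim
    have := tendsto_nhds_unique lim tendsto_const_nhds
    rw [integral_sub (hA β hβ) ((hB β hβ).const_mul β), integral_const_mul] at this
    unfold weightInt
    linarith
  · have e : (fun x => A x * (Real.exp (-β * ‖x‖ ^ 2) * χ (‖x‖ ^ 2 - k))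
      + B x * (Real.exp (-β * ‖x‖ ^ 2) * -β * χ (‖x‖ ^ 2 - k)
        + Real.exp (-β * ‖x‖ ^ 2) * χ' (‖x‖ ^ 2 - k)))
      = fun x => (A x * Real.exp (-β * ‖x‖ ^ 2)) * χ (‖x‖ ^ 2 - k)
        + (B x * Real.exp (-β * ‖x‖ ^ 2)) * (-β * χ (‖x‖ ^ 2 - k) + χ' (‖x‖ ^ 2 - k)) := by
      ext x; ring
    rw [e]
    have m1 : Measurable fun x : 𝔼 => χ (‖x‖ ^ 2 - k) := by fun_prop
    have m2 : Measurable fun x : 𝔼 => χ' (‖x‖ ^ 2 - k) := by fun_prop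
    exact ((hA β hβ).aestronglyMeasurable.mul m1.aestronglyMeasurable).add
      ((hB β hβ).aestronglyMeasurable.mul
        ((m1.const_mul _).add m2).aestronglyMeasurable)
  · have e : A x * (Real.exp (-β * ‖x‖ ^ 2) * χ (‖x‖ ^ 2 - k))
      + B x * (Real.exp (-β * ‖x‖ ^ 2) * -β * χ (‖x‖ ^ 2 - k)
        + Real.exp (-β * ‖x‖ ^ 2) * χ' (‖x‖ ^ 2 - k))
      = (A x * Real.exp (-β * ‖x‖ ^ 2)) * χ (‖x‖ ^ 2 - k)
        + (B x * Real.exp (-β * ‖x‖ ^ 2)) * (-β * χ (‖x‖ ^ 2 - k) + χ' (‖x‖ ^ 2 - k)) := by ring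
    have b0 : ‖χ (‖x‖ ^ 2 - k)‖ ≤ 1 := by
      rw [Real.norm_of_nonneg (h0 _)]; exact h1 _
    have b1 : ‖-β * χ (‖x‖ ^ 2 - k) + χ' (‖x‖ ^ 2 - k)‖ ≤ β + C := by
      refine (norm_add_le _ _).trans (add_le_add ?_ (hC _))
      rw [norm_mul, norm_neg, Real.norm_of_nonneg hβ.le]
      exact mul_le_of_le_one_right hβ.le b0
    rw [e]
    refine (norm_add_le _ _).trans (add_le_add ?_ ?_)
    · rw [norm_mul]
      exact mul_le_of_le_one_right (norm_nonneg _) b0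
    · rw [norm_mul, mul_comm]
      exact mul_le_mul_of_nonneg_right b1 (norm_nonneg _)
  · refine tendsto_const_nhds.congr' ?_
    filter_upwards [hev x] with k hk
    rw [hone _ hk.le, hder _ hk]
    ring

/-- The Caccioppoli inequality with Gaussian weights. -/
theorem GaussInt.caccioppoli {u v : 𝔼 → ℝ} (hu : ContDiff ℝ 2 u) (hv : ContDiff ℝ 2 v)
    (hlap : ∀ x, lap u x = u x * v x ^ 2) (hg : GaussInt fun x => u x ^ 2) :
    GaussInt fun x => ‖gradient u x‖ ^ 2 + u x ^ 2 * v x ^ 2 := fun β hβ => by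
  obtain ⟨χ, χ', C, hχ, hχ', h0, h1, hC, hone, hder, hzero⟩ := exists_real_cutoff
  have hC0 : 0 ≤ C := (abs_nonneg _).trans (hC 0)
  have hχ'c : Continuous χ' := by
    have : χ' = deriv χ := funext fun t => (hχ' t).deriv.symm
    rw [this]
    exact hχ.continuous_deriv le_rfl
  have hχc := hχ.continuous
  have hgu : Continuous (gradient u) := (contDiff_gradient (m := 1) hu (by norm_num)).continuous
  have huc := hu.continuous
  have hvc := hv.continuous
  have hduc : Continuous fun x => fderiv ℝ u x x :=
    (hu.continuous_fderiv (by norm_num)).clm_apply continuous_id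
  have hexp : ∀ t : ℝ, HasDerivAt (fun t => Real.exp (-(β / 2) * t))
      (Real.exp (-(β / 2) * t) * -(β / 2)) t :=
    fun t => by simpa using ((hasDerivAt_id t).const_mul (-(β / 2))).exp
  set D : ℝ := 8 * (β / 2 + C) ^ 2 with hD
  refine (aecover_closedBall (μ := (volume : Measure 𝔼)) (x := 0)
    tendsto_natCast_atTop_atTop).integrable_of_integral_norm_bounded
    (2 * ∫ x, D * ((‖x‖ ^ 2 * u x ^ 2) * Real.exp (-β * ‖x‖ ^ 2)))
    (fun k => ContinuousOn.integrableOn_compact (isCompact_closedBall _ _)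
      (Continuous.continuousOn (by fun_prop)))
    (Filter.Eventually.of_forall fun k => ?_)
  set ζ : ℝ → ℝ := fun t => Real.exp (-(β / 2) * t) * χ (t - k ^ 2) with hζ
  set ζ' : ℝ → ℝ := fun t => Real.exp (-(β / 2) * t) * -(β / 2) * χ (t - k ^ 2)
    + Real.exp (-(β / 2) * t) * χ' (t - k ^ 2) with hζ'
  have dζ : ∀ t, HasDerivAt ζ (ζ' t) t := fun t =>
    (hexp t).mul ((hχ' _).comp_sub_const t _)
  have cζ : ContDiff ℝ 1 ζ := by
    have : ContDiff ℝ 1 fun t : ℝ => Real.exp (-(β / 2) * t) :=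
      Real.contDiff_exp.comp (contDiff_const.mul contDiff_id)
    exact this.mul (hχ.comp (contDiff_id.sub contDiff_const))
  have zζ : ∀ t, (k : ℝ) ^ 2 + 1 ≤ t → ζ t = 0 := fun t ht => by
    simp only [hζ]
    rw [hzero _ (by linarith), mul_zero]
  have hζc := cζ.continuous
  have hζ'c : Continuous ζ' := by fun_prop
  have ident := integral_radial_mul_gradient (κ := fun t => ζ t ^ 2)
    (κ' := fun t => 2 * ζ t * ζ' t) (R := k ^ 2 + 1) (cζ.pow 2)
    (fun t => ((dζ t).fun_pow 2).congr_deriv (by simp)) (fun t ht => by simp [zζ t ht]) hu hlap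
  have int1 : Integrable fun x : 𝔼 => ((‖gradient u x‖ ^ 2 + u x ^ 2 * v x ^ 2) * ζ (‖x‖ ^ 2) ^ 2
      + 2 * (u x * fderiv ℝ u x x) * (2 * ζ (‖x‖ ^ 2) * ζ' (‖x‖ ^ 2))) := by
    have e : (fun x : 𝔼 => ((‖gradient u x‖ ^ 2 + u x ^ 2 * v x ^ 2) * ζ (‖x‖ ^ 2) ^ 2
      + 2 * (u x * fderiv ℝ u x x) * (2 * ζ (‖x‖ ^ 2) * ζ' (‖x‖ ^ 2))))
      = fun x => ζ (‖x‖ ^ 2) * ((‖gradient u x‖ ^ 2 + u x ^ 2 * v x ^ 2) * ζ (‖x‖ ^ 2)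
      + 2 * (u x * fderiv ℝ u x x) * (2 * ζ' (‖x‖ ^ 2))) := by ext x; ring
    rw [e]
    exact Continuous.integrable_of_hasCompactSupport (by fun_prop)
      (hasCompactSupport_radial zζ).mul_right
  have int2 : Integrable fun x : 𝔼 => (‖gradient u x‖ ^ 2 + u x ^ 2 * v x ^ 2)
      * ζ (‖x‖ ^ 2) ^ 2 := by
    have e : (fun x : 𝔼 => (‖gradient u x‖ ^ 2 + u x ^ 2 * v x ^ 2) * ζ (‖x‖ ^ 2) ^ 2)
      = fun x => ζ (‖x‖ ^ 2) * ((‖gradient u x‖ ^ 2 + u x ^ 2 * v x ^ 2) * ζ (‖x‖ ^ 2)) := by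
      ext x; ring
    rw [e]
    exact Continuous.integrable_of_hasCompactSupport (by fun_prop)
      (hasCompactSupport_radial zζ).mul_right
  have int3 := (hg.norm_sq_mul β hβ).const_mul D
  have hpt : ∀ x : 𝔼, (‖gradient u x‖ ^ 2 + u x ^ 2 * v x ^ 2) * ζ (‖x‖ ^ 2) ^ 2
      ≤ 2 * (((‖gradient u x‖ ^ 2 + u x ^ 2 * v x ^ 2) * ζ (‖x‖ ^ 2) ^ 2
      + 2 * (u x * fderiv ℝ u x x) * (2 * ζ (‖x‖ ^ 2) * ζ' (‖x‖ ^ 2)))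
      + D * ((‖x‖ ^ 2 * u x ^ 2) * Real.exp (-β * ‖x‖ ^ 2))) := fun x => by
    have hdu : |fderiv ℝ u x x| ≤ ‖gradient u x‖ * ‖x‖ := by
      rw [← inner_gradient_left]
      exact abs_real_inner_le_norm _ _
    have hsq : ζ' (‖x‖ ^ 2) ^ 2 ≤ (β / 2 + C) ^ 2 * Real.exp (-β * ‖x‖ ^ 2) := by
      have e : ζ' (‖x‖ ^ 2) = Real.exp (-(β / 2) * ‖x‖ ^ 2)
          * (-(β / 2) * χ (‖x‖ ^ 2 - k ^ 2) + χ' (‖x‖ ^ 2 - k ^ 2)) := by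
        simp only [hζ']; ring
      rw [e, mul_pow, ← Real.exp_nat_mul, mul_comm]
      rw [show ((2 : ℕ) : ℝ) * (-(β / 2) * ‖x‖ ^ 2) = -β * ‖x‖ ^ 2 by push_cast; ring]
      refine mul_le_mul_of_nonneg_right ?_ (Real.exp_pos _).le
      refine sq_le_sq' ?_ ?_
      · have := (abs_le.1 (hC (‖x‖ ^ 2 - k ^ 2))).1
        nlinarith [h1 (‖x‖ ^ 2 - k ^ 2)]
      · have := (abs_le.1 (hC (‖x‖ ^ 2 - k ^ 2))).2
        nlinarith [h0 (‖x‖ ^ 2 - k ^ 2)]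
    have hyoung : -(4 * (u x * fderiv ℝ u x x) * (ζ (‖x‖ ^ 2) * ζ' (‖x‖ ^ 2)))
        ≤ 1 / 2 * (‖gradient u x‖ ^ 2 * ζ (‖x‖ ^ 2) ^ 2)
          + 8 * (‖x‖ ^ 2 * u x ^ 2 * ζ' (‖x‖ ^ 2) ^ 2) := by
      have a1 : -(4 * (u x * fderiv ℝ u x x) * (ζ (‖x‖ ^ 2) * ζ' (‖x‖ ^ 2)))
          ≤ 4 * (|u x| * (‖gradient u x‖ * ‖x‖)) * (|ζ (‖x‖ ^ 2)| * |ζ' (‖x‖ ^ 2)|) := by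
        refine (neg_le_abs _).trans ?_
        rw [abs_mul, abs_mul, abs_mul, abs_mul, abs_of_pos (four_pos (α := ℝ))]
        gcongr
      refine a1.trans ?_
      have := sq_nonneg (‖gradient u x‖ * |ζ (‖x‖ ^ 2)| - 4 * (‖x‖ * |u x| * |ζ' (‖x‖ ^ 2)|))
      rw [← sq_abs (ζ (‖x‖ ^ 2)), ← sq_abs (u x), ← sq_abs (ζ' (‖x‖ ^ 2))]
      linarith
    have h3 : ‖x‖ ^ 2 * u x ^ 2 * ζ' (‖x‖ ^ 2) ^ 2
        ≤ ‖x‖ ^ 2 * u x ^ 2 * ((β / 2 + C) ^ 2 * Real.exp (-β * ‖x‖ ^ 2)) :=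
      mul_le_mul_of_nonneg_left hsq (by positivity)
    have h4 : 0 ≤ u x ^ 2 * v x ^ 2 * ζ (‖x‖ ^ 2) ^ 2 := by positivity
    rw [hD]
    linarith
  have hle := integral_mono int2 ((int1.add int3).const_mul 2) hpt
  rw [integral_const_mul, integral_add' int1 int3, ident, zero_add] at hle
  refine le_trans ?_ hle
  refine le_trans (le_of_eq ?_) (setIntegral_le_integral (s := closedBall (0 : 𝔼) k) int2
    (ae_of_all _ fun x => by positivity))
  refine setIntegral_congr_fun measurableSet_closedBall fun x hx => ?_
  have hx' : ‖x‖ ^ 2 ≤ (k : ℝ) ^ 2 := by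
    have := mem_closedBall_zero_iff.1 hx
    gcongr
  have e : ζ (‖x‖ ^ 2) ^ 2 = Real.exp (-β * ‖x‖ ^ 2) := by
    simp only [hζ]
    rw [hone _ (by linarith), mul_one, ← Real.exp_nat_mul]
    congr 1
    push_cast
    ring
  simp only [e]
  exact Real.norm_of_nonneg (by positivity)

end GaussInt

section GaussMean

open ProbabilityTheory

variable {n : ℕ}

local notation "𝔼" => EuclideanSpace ℝ (Fin n)

/-- The average of `g` against the centred Gaussian of standard deviation `e ^ t`. -/
def gaussMean (g : 𝔼 → ℝ) (t : ℝ) : ℝ := ∫ y, g (Real.exp t • y) ∂(stdGaussian 𝔼)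

theorem gaussDens_exp_smul (t : ℝ) (x : 𝔼) : gaussDens (Real.exp (-t) • x)
    = (2 * Real.pi) ^ (-(n : ℝ) / 2) * Real.exp (-(Real.exp (-2 * t) / 2) * ‖x‖ ^ 2) := by
  unfold gaussDens
  rw [norm_smul, Real.norm_of_nonneg (Real.exp_pos _).le, mul_pow, ← Real.exp_nat_mul,
    finrank_euclideanSpace_fin]
  push_cast
  ring_nf

theorem gaussMean_eq (g : 𝔼 → ℝ) (t : ℝ) : gaussMean g t =
    (2 * Real.pi) ^ (-(n : ℝ) / 2) * Real.exp (-n * t) * weightInt g (Real.exp (-2 * t) / 2) := by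
  unfold gaussMean
  rw [integral_stdGaussian]
  have h := Measure.integral_comp_smul (volume : Measure 𝔼)
    (fun x => gaussDens (Real.exp (-t) • x) * g x) (Real.exp t)
  have e : ∀ y : 𝔼, Real.exp (-t) • Real.exp t • y = y := fun y => by
    rw [smul_smul, ← Real.exp_add]; simp
  simp only [e] at h
  simp only [smul_eq_mul]
  rw [h, finrank_euclideanSpace_fin, abs_of_pos (by positivity), ← Real.exp_nat_mul, ← Real.exp_neg]
  simp only [gaussDens_exp_smul]
  have e2 : ∫ x : 𝔼, (2 * Real.pi) ^ (-(n : ℝ) / 2)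
      * Real.exp (-(Real.exp (-2 * t) / 2) * ‖x‖ ^ 2) * g x
      = (2 * Real.pi) ^ (-(n : ℝ) / 2) * weightInt g (Real.exp (-2 * t) / 2) := by
    unfold weightInt
    rw [← integral_const_mul]
    refine integral_congr_ae (ae_of_all _ fun x => ?_)
    simp only
    ring
  rw [e2, smul_eq_mul, neg_mul]
  ring_nf

theorem GaussInt.integrable_comp_exp_smul {g : 𝔼 → ℝ} (hg : GaussInt g) (t : ℝ) :
    Integrable (fun y => g (Real.exp t • y)) (stdGaussian 𝔼) := by
  rw [integrable_stdGaussian_iff]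
  have h := ((hg (Real.exp (-2 * t) / 2) (by positivity)).const_mul
    ((2 * Real.pi) ^ (-(n : ℝ) / 2))).comp_smul (Real.exp_ne_zero t)
  refine h.congr (ae_of_all _ fun y => ?_)
  have e := gaussDens_exp_smul t (Real.exp t • y)
  rw [smul_smul, ← Real.exp_add, neg_add_cancel, Real.exp_zero, one_smul] at e
  simp only [e, smul_eq_mul]
  ring

theorem GaussInt.hasDerivAt_gaussMean {g : 𝔼 → ℝ} (hg : GaussInt g) (t : ℝ) :
    HasDerivAt (gaussMean g)
      (Real.exp (-2 * t) * gaussMean (fun x => ‖x‖ ^ 2 * g x) t - n * gaussMean g t) t := by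
  have e : gaussMean g = fun t => (2 * Real.pi) ^ (-(n : ℝ) / 2) * Real.exp (-n * t)
      * weightInt g (Real.exp (-2 * t) / 2) := funext (gaussMean_eq g)
  have h1 : HasDerivAt (fun t => Real.exp (-n * t)) (Real.exp (-n * t) * -n) t := by
    simpa using ((hasDerivAt_id t).const_mul (-(n : ℝ))).exp
  have h2 : HasDerivAt (fun t => Real.exp (-2 * t) / 2) (-Real.exp (-2 * t)) t :=
    ((((hasDerivAt_id t).const_mul (-2)).exp).div_const 2).congr_deriv (by simp; ring)
  have h3 := (hg.hasDerivAt_weightInt (β := Real.exp (-2 * t) / 2) (by positivity)).comp t h2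
  have h4 := (h1.const_mul ((2 * Real.pi) ^ (-(n : ℝ) / 2))).mul h3
  rw [gaussMean_eq, gaussMean_eq, e]
  refine h4.congr_deriv ?_
  simp only [Function.comp]
  ring

theorem GaussInt.gaussMean_add {f g : 𝔼 → ℝ} (hf : GaussInt f) (hg : GaussInt g) (t : ℝ) :
    gaussMean (fun x => f x + g x) t = gaussMean f t + gaussMean g t :=
  integral_add (hf.integrable_comp_exp_smul t) (hg.integrable_comp_exp_smul t)

theorem GaussInt.gaussMean_sub {f g : 𝔼 → ℝ} (hf : GaussInt f) (hg : GaussInt g) (t : ℝ) :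
    gaussMean (fun x => f x - g x) t = gaussMean f t - gaussMean g t :=
  integral_sub (hf.integrable_comp_exp_smul t) (hg.integrable_comp_exp_smul t)

theorem gaussMean_const_mul (c : ℝ) (f : 𝔼 → ℝ) (t : ℝ) :
    gaussMean (fun x => c * f x) t = c * gaussMean f t :=
  integral_const_mul _ _

theorem gaussMean_const (c : ℝ) (t : ℝ) : gaussMean (fun _ : 𝔼 => c) t = c := by
  simp [gaussMean]

theorem gaussMean_norm_sq_mul (g : 𝔼 → ℝ) (t : ℝ) : gaussMean (fun x => ‖x‖ ^ 2 * g x) t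
    = Real.exp (2 * t) * ∫ y, ‖y‖ ^ 2 * g (Real.exp t • y) ∂(stdGaussian 𝔼) := by
  unfold gaussMean
  rw [← integral_const_mul]
  refine integral_congr_ae (ae_of_all _ fun y => ?_)
  simp only
  rw [norm_smul, Real.norm_of_nonneg (Real.exp_pos _).le, mul_pow, ← Real.exp_nat_mul]
  push_cast
  ring

theorem gaussMean_nonneg {g : 𝔼 → ℝ} (hg : ∀ x, 0 ≤ g x) (t : ℝ) : 0 ≤ gaussMean g t :=
  integral_nonneg fun _ => hg _

theorem GaussInt.gaussMean_mono {f g : 𝔼 → ℝ} (hf : GaussInt f) (hg : GaussInt g)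
    (h : ∀ x, f x ≤ g x) (t : ℝ) : gaussMean f t ≤ gaussMean g t :=
  integral_mono (hf.integrable_comp_exp_smul t) (hg.integrable_comp_exp_smul t) fun _ => h _

theorem GaussInt.gaussMean_pos {g : 𝔼 → ℝ} (hg : GaussInt g) (h : ∀ x, 0 < g x) (t : ℝ) :
    0 < gaussMean g t := by
  unfold gaussMean
  rw [integral_pos_iff_support_of_nonneg (fun _ => (h _).le) (hg.integrable_comp_exp_smul t)]
  have : (Function.support fun y : 𝔼 => g (Real.exp t • y)) = Set.univ :=
    Set.eq_univ_of_forall fun y => (h _).ne'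
  rw [this]
  simp

theorem gaussMean_eq_of_radial {A B : 𝔼 → ℝ} (hA : GaussInt A) (hB : GaussInt B)
    (h : ∀ (κ κ' : ℝ → ℝ) (R : ℝ), ContDiff ℝ 1 κ → (∀ t, HasDerivAt κ (κ' t) t) →
      (∀ t, R ≤ t → κ t = 0) →
      ∫ x, (A x * κ (‖x‖ ^ 2) + 2 * B x * κ' (‖x‖ ^ 2)) = 0) (t : ℝ) :
    gaussMean A t = Real.exp (-2 * t) * gaussMean B t := by
  have h1 := weightInt_eq_of_radial hA (hB.const_mul 2) h (β := Real.exp (-2 * t) / 2)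
    (by positivity)
  have h2 : weightInt (fun x => 2 * B x) (Real.exp (-2 * t) / 2)
      = 2 * weightInt B (Real.exp (-2 * t) / 2) := by
    unfold weightInt
    rw [← integral_const_mul]
    simp only [mul_assoc]
  rw [gaussMean_eq, gaussMean_eq, h1, h2]
  ring

end GaussMean

section Solutions

variable {n : ℕ}

local notation "𝔼" => EuclideanSpace ℝ (Fin n)

/-- Twice differentiable positive solutions of the system with at most linear growth. -/
structure IsLinearSolution (u v : 𝔼 → ℝ) : Prop where
  contDiff_left : ContDiff ℝ 2 u
  contDiff_right : ContDiff ℝ 2 v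
  pos_left : ∀ x, 0 < u x
  pos_right : ∀ x, 0 < v x
  lap_left : ∀ x, lap u x = u x * v x ^ 2
  lap_right : ∀ x, lap v x = v x * u x ^ 2
  growth : ∃ C > 0, ∀ x, u x + v x ≤ C * (1 + ‖x‖)

namespace IsLinearSolution

variable {u v : EuclideanSpace ℝ (Fin n) → ℝ}

theorem symm (h : IsLinearSolution u v) : IsLinearSolution v u where
  contDiff_left := h.contDiff_right
  contDiff_right := h.contDiff_left
  pos_left := h.pos_right
  pos_right := h.pos_left
  lap_left := h.lap_right
  lap_right := h.lap_left
  growth := by simpa only [add_comm (v _)] using h.growth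

theorem lap_translate (f : 𝔼 → ℝ) (z x : 𝔼) : lap (fun y => f (y + z)) x = lap f (x + z) := by
  unfold lap
  simp only [iteratedFDeriv_comp_add_right]

theorem translate (h : IsLinearSolution u v) (z : 𝔼) :
    IsLinearSolution (fun x => u (x + z)) (fun x => v (x + z)) where
  contDiff_left := h.contDiff_left.comp (contDiff_id.add contDiff_const)
  contDiff_right := h.contDiff_right.comp (contDiff_id.add contDiff_const)
  pos_left x := h.pos_left _
  pos_right x := h.pos_right _
  lap_left x := by rw [lap_translate, h.lap_left]
  lap_right x := by rw [lap_translate, h.lap_right]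
  growth := by
    obtain ⟨C, hC, hg⟩ := h.growth
    refine ⟨C * (1 + ‖z‖), by positivity, fun x => (hg _).trans ?_⟩
    rw [mul_assoc]
    refine mul_le_mul_of_nonneg_left ?_ hC.le
    have := norm_add_le x z
    nlinarith [norm_nonneg x, norm_nonneg z, mul_nonneg (norm_nonneg x) (norm_nonneg z)]

theorem continuous_gradient (h : IsLinearSolution u v) : Continuous (gradient u) :=
  (contDiff_gradient (m := 1) h.contDiff_left (by norm_num)).continuous

theorem continuous_radial (h : IsLinearSolution u v) : Continuous fun x => fderiv ℝ u x x :=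
  (h.contDiff_left.continuous_fderiv (by norm_num)).clm_apply continuous_id

theorem exists_sq_le (h : IsLinearSolution u v) :
    ∃ C > 0, ∀ x, u x ^ 2 ≤ C * (1 + ‖x‖ ^ 2) := by
  obtain ⟨C, hC, hg⟩ := h.growth
  refine ⟨2 * C ^ 2, by positivity, fun x => ?_⟩
  have h1 : u x ≤ C * (1 + ‖x‖) := by linarith [hg x, h.pos_right x]
  have h2 : u x ^ 2 ≤ (C * (1 + ‖x‖)) ^ 2 := pow_le_pow_left₀ (h.pos_left x).le h1 2
  refine h2.trans ?_
  rw [mul_pow]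
  nlinarith [mul_nonneg (sq_nonneg C) (sq_nonneg (1 - ‖x‖))]

theorem gaussInt_sq (h : IsLinearSolution u v) : GaussInt fun x => u x ^ 2 := by
  obtain ⟨C, hC, hg⟩ := h.exists_sq_le
  have := h.contDiff_left.continuous
  refine GaussInt.of_growth (C := C) (by fun_prop) fun x => ?_
  rw [abs_of_nonneg (sq_nonneg _)]
  refine (hg x).trans (mul_le_mul_of_nonneg_left ?_ hC.le)
  nlinarith [sq_nonneg ‖x‖]

theorem gaussInt_energy (h : IsLinearSolution u v) :
    GaussInt fun x => ‖gradient u x‖ ^ 2 + u x ^ 2 * v x ^ 2 :=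
  h.gaussInt_sq.caccioppoli h.contDiff_left h.contDiff_right h.lap_left

theorem gaussInt_gradient (h : IsLinearSolution u v) :
    GaussInt fun x => ‖gradient u x‖ ^ 2 := by
  have := h.continuous_gradient
  refine h.gaussInt_energy.mono (by fun_prop) fun x => ?_
  rw [abs_of_nonneg (by positivity)]
  nlinarith [mul_nonneg (sq_nonneg (u x)) (sq_nonneg (v x))]

theorem gaussInt_interaction (h : IsLinearSolution u v) :
    GaussInt fun x => u x ^ 2 * v x ^ 2 := by
  have := h.contDiff_left.continuous
  have := h.contDiff_right.continuous
  refine h.gaussInt_energy.mono (by fun_prop) fun x => ?_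
  rw [abs_of_nonneg (by positivity)]
  nlinarith [sq_nonneg ‖gradient u x‖]

theorem radial_sq_le (u : 𝔼 → ℝ) (x : 𝔼) : fderiv ℝ u x x ^ 2 ≤ ‖x‖ ^ 2 * ‖gradient u x‖ ^ 2 := by
  rw [← inner_gradient_left, ← mul_pow, mul_comm]
  exact sq_le_sq' (neg_le_of_abs_le (abs_real_inner_le_norm _ _)) (real_inner_le_norm _ _)

theorem gaussInt_radial_sq (h : IsLinearSolution u v) :
    GaussInt fun x => fderiv ℝ u x x ^ 2 := by
  have := h.continuous_radial
  refine h.gaussInt_gradient.norm_sq_mul.mono (by fun_prop) fun x => ?_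
  rw [abs_of_nonneg (by positivity)]
  exact radial_sq_le u x

theorem gaussInt_mul_radial (h : IsLinearSolution u v) :
    GaussInt fun x => u x * fderiv ℝ u x x := by
  have := h.contDiff_left.continuous
  have := h.continuous_radial
  refine (h.gaussInt_sq.add h.gaussInt_radial_sq).mono (by fun_prop) fun x => ?_
  rw [abs_le]
  constructor <;> nlinarith [sq_nonneg (u x + fderiv ℝ u x x), sq_nonneg (u x - fderiv ℝ u x x)]

end IsLinearSolution

/-- The normalised Gaussian mean of `u²` at scale `e ^ t`. -/
def height (u : 𝔼 → ℝ) (t : ℝ) : ℝ := Real.exp (-2 * t) * gaussMean (fun x => u x ^ 2) t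

/-- The Gaussian mean of the energy density of the first component. -/
def energy (u v : 𝔼 → ℝ) (t : ℝ) : ℝ :=
  gaussMean (fun x => ‖gradient u x‖ ^ 2 + u x ^ 2 * v x ^ 2) t

/-- The Gaussian mean of the interaction density `u² v²`. -/
def interaction (u v : 𝔼 → ℝ) (t : ℝ) : ℝ := gaussMean (fun x => u x ^ 2 * v x ^ 2) t

/-- The Gaussian mean of the deviation of `u` from being homogeneous of degree one. -/
def defect (u : 𝔼 → ℝ) (t : ℝ) : ℝ :=
  Real.exp (-2 * t) * gaussMean (fun x => (fderiv ℝ u x x - u x) ^ 2) t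

theorem height_nonneg (u : 𝔼 → ℝ) (t : ℝ) : 0 ≤ height u t :=
  mul_nonneg (Real.exp_pos _).le (gaussMean_nonneg (fun _ => sq_nonneg _) t)

theorem energy_nonneg (u v : 𝔼 → ℝ) (t : ℝ) : 0 ≤ energy u v t :=
  gaussMean_nonneg (fun _ => by positivity) t

theorem interaction_nonneg (u v : 𝔼 → ℝ) (t : ℝ) : 0 ≤ interaction u v t :=
  gaussMean_nonneg (fun _ => by positivity) t

theorem defect_nonneg (u : 𝔼 → ℝ) (t : ℝ) : 0 ≤ defect u t :=
  mul_nonneg (Real.exp_pos _).le (gaussMean_nonneg (fun _ => sq_nonneg _) t)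

theorem interaction_comm (u v : 𝔼 → ℝ) : interaction u v = interaction v u := by
  ext t
  simp only [interaction, mul_comm]

namespace IsLinearSolution

variable {u v : EuclideanSpace ℝ (Fin n) → ℝ}

theorem height_pos (h : IsLinearSolution u v) (t : ℝ) : 0 < height u t :=
  mul_pos (Real.exp_pos _) (h.gaussInt_sq.gaussMean_pos (fun x => pow_pos (h.pos_left x) 2) t)

theorem interaction_le_energy (h : IsLinearSolution u v) (t : ℝ) :
    interaction u v t ≤ energy u v t :=
  h.gaussInt_interaction.gaussMean_mono h.gaussInt_energy
    (fun x => by nlinarith [sq_nonneg ‖gradient u x‖]) t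

theorem energy_eq (h : IsLinearSolution u v) (t : ℝ) :
    energy u v t = Real.exp (-2 * t) * gaussMean (fun x => u x * fderiv ℝ u x x) t :=
  gaussMean_eq_of_radial h.gaussInt_energy h.gaussInt_mul_radial
    (fun _ _ _ h1 h2 h3 => integral_radial_mul_gradient h1 h2 h3 h.contDiff_left h.lap_left) t

theorem exp_neg_mul_exp_two_mul (t : ℝ) : Real.exp (-2 * t) * Real.exp (2 * t) = 1 := by
  rw [← Real.exp_add]; simp

theorem hasDerivAt_gaussMean_sq (h : IsLinearSolution u v) (t : ℝ) :
    HasDerivAt (gaussMean fun x => u x ^ 2)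
      (2 * gaussMean (fun x => u x * fderiv ℝ u x x) t) t := by
  refine (h.gaussInt_sq.hasDerivAt_gaussMean t).congr_deriv ?_
  have h1 := gaussMean_eq_of_radial
    ((h.gaussInt_sq.const_mul n).add (h.gaussInt_mul_radial.const_mul 2))
    h.gaussInt_sq.norm_sq_mul
    (fun _ _ _ h1 h2 h3 => integral_radial_sq h1 h2 h3 h.contDiff_left) t
  rw [(h.gaussInt_sq.const_mul n).gaussMean_add (h.gaussInt_mul_radial.const_mul 2),
    gaussMean_const_mul, gaussMean_const_mul] at h1
  linarith

theorem hasDerivAt_exp_neg_two_mul (t : ℝ) :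
    HasDerivAt (fun t => Real.exp (-2 * t)) (Real.exp (-2 * t) * -2) t := by
  simpa using ((hasDerivAt_id t).const_mul (-2)).exp

theorem hasDerivAt_height (h : IsLinearSolution u v) (t : ℝ) :
    HasDerivAt (height u) (2 * (energy u v t - height u t)) t := by
  refine ((hasDerivAt_exp_neg_two_mul t).mul (h.hasDerivAt_gaussMean_sq t)).congr_deriv ?_
  rw [h.energy_eq, height]
  ring

theorem gaussInt_defect (h : IsLinearSolution u v) :
    GaussInt fun x => (fderiv ℝ u x x - u x) ^ 2 := by
  have := h.contDiff_left.continuous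
  have := h.continuous_radial
  refine ((h.gaussInt_sq.add h.gaussInt_radial_sq).const_mul 2).mono (by fun_prop) fun x => ?_
  rw [abs_of_nonneg (sq_nonneg _)]
  nlinarith [sq_nonneg (fderiv ℝ u x x + u x)]

theorem defect_eq (h : IsLinearSolution u v) (t : ℝ) : defect u t =
    Real.exp (-2 * t) * gaussMean (fun x => fderiv ℝ u x x ^ 2) t
      - 2 * energy u v t + height u t := by
  have e : (fun x => (fderiv ℝ u x x - u x) ^ 2)
      = fun x => (fderiv ℝ u x x ^ 2 - 2 * (u x * fderiv ℝ u x x)) + u x ^ 2 := by ext x; ring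
  rw [defect, e, (h.gaussInt_radial_sq.sub (h.gaussInt_mul_radial.const_mul 2)).gaussMean_add
    h.gaussInt_sq, h.gaussInt_radial_sq.gaussMean_sub (h.gaussInt_mul_radial.const_mul 2),
    gaussMean_const_mul, h.energy_eq, height]
  ring

theorem sq_energy_sub_height_le (h : IsLinearSolution u v) (t : ℝ) :
    (energy u v t - height u t) ^ 2 ≤ height u t * defect u t := by
  set s : ℝ := (energy u v t - height u t) / height u t with hs
  have hpos := h.height_pos t
  have e : (fun x => (fderiv ℝ u x x - (1 + s) * u x) ^ 2)
      = fun x => (fderiv ℝ u x x ^ 2 - (2 * (1 + s)) * (u x * fderiv ℝ u x x))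
        + (1 + s) ^ 2 * u x ^ 2 := by ext x; ring
  have h1 := gaussMean_nonneg (g := fun x => (fderiv ℝ u x x - (1 + s) * u x) ^ 2)
    (fun x => sq_nonneg _) t
  have h2 := mul_nonneg (Real.exp_pos (-2 * t)).le h1
  rw [e, (h.gaussInt_radial_sq.sub (h.gaussInt_mul_radial.const_mul _)).gaussMean_add
    (h.gaussInt_sq.const_mul _), h.gaussInt_radial_sq.gaussMean_sub
    (h.gaussInt_mul_radial.const_mul _), gaussMean_const_mul, gaussMean_const_mul] at h2
  have h3 : 0 ≤ defect u t + 2 * energy u v t - height u t - 2 * (1 + s) * energy u v t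
      + (1 + s) ^ 2 * height u t := by
    rw [h.defect_eq, h.energy_eq, height]
    linarith
  have hsh : s * height u t = energy u v t - height u t := by rw [hs]; field_simp
  have h4 : 0 ≤ defect u t - s * (energy u v t - height u t) := by
    have : (1 + s) ^ 2 * height u t = height u t + 2 * (s * height u t)
      + s * (s * height u t) := by ring
    rw [this, hsh] at h3
    linarith
  have h5 := mul_nonneg hpos.le h4
  have : height u t * (s * (energy u v t - height u t)) = (energy u v t - height u t) ^ 2 := by
    rw [← mul_assoc, mul_comm (height u t), hsh]; ring
  linarith

end IsLinearSolution

end Solutions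

section Solutions

open ProbabilityTheory

variable {n : ℕ}

local notation "𝔼" => EuclideanSpace ℝ (Fin n)

/-- The Gaussian mean of the total energy density of the system. -/
def totalEnergy (u v : 𝔼 → ℝ) (t : ℝ) : ℝ :=
  energy u v t + energy v u t - interaction u v t

/-- The total Gaussian height of the pair. -/
def totalHeight (u v : 𝔼 → ℝ) (t : ℝ) : ℝ := height u t + height v t

/-- The Gaussian frequency of one component, shifted by one. -/
def excess (u v : 𝔼 → ℝ) (t : ℝ) : ℝ := (energy u v t - height u t) / height u t

namespace IsLinearSolution

variable {u v : EuclideanSpace ℝ (Fin n) → ℝ}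

theorem gaussInt_total (h : IsLinearSolution u v) :
    GaussInt fun x => ‖gradient u x‖ ^ 2 + ‖gradient v x‖ ^ 2 + u x ^ 2 * v x ^ 2 :=
  (h.gaussInt_gradient.add h.symm.gaussInt_gradient).add h.gaussInt_interaction

theorem totalEnergy_eq (h : IsLinearSolution u v) (t : ℝ) : totalEnergy u v t =
    gaussMean (fun x => ‖gradient u x‖ ^ 2 + ‖gradient v x‖ ^ 2 + u x ^ 2 * v x ^ 2) t := by
  rw [(h.gaussInt_gradient.add h.symm.gaussInt_gradient).gaussMean_add h.gaussInt_interaction,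
    h.gaussInt_gradient.gaussMean_add h.symm.gaussInt_gradient, totalEnergy, energy, energy,
    h.gaussInt_gradient.gaussMean_add h.gaussInt_interaction,
    h.symm.gaussInt_gradient.gaussMean_add h.symm.gaussInt_interaction]
  have := congrFun (interaction_comm u v) t
  unfold interaction at *
  linarith

theorem hasDerivAt_totalEnergy (h : IsLinearSolution u v) (t : ℝ) :
    HasDerivAt (totalEnergy u v) (2 * totalEnergy u v t + 6 * interaction u v t
      - 2 * totalHeight u v t + 2 * (defect u t + defect v t)) t := by
  have e : totalEnergy u v = gaussMean fun x =>
    ‖gradient u x‖ ^ 2 + ‖gradient v x‖ ^ 2 + u x ^ 2 * v x ^ 2 := funext h.totalEnergy_eq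
  have hg := h.gaussInt_gradient.add h.symm.gaussInt_gradient
  have hA := (hg.const_mul 2).sub (h.gaussInt_total.const_mul n)
  have hr := (h.gaussInt_radial_sq.const_mul 2).add (h.symm.gaussInt_radial_sq.const_mul 2)
  have hB := hr.sub h.gaussInt_total.norm_sq_mul
  have key := gaussMean_eq_of_radial hA hB (fun _ _ _ h1 h2 h3 =>
    integral_radial_pohozaev h1 h2 h3 h.contDiff_left h.contDiff_right h.lap_left h.lap_right) t
  rw [(hg.const_mul 2).gaussMean_sub (h.gaussInt_total.const_mul n), gaussMean_const_mul,
    gaussMean_const_mul, hr.gaussMean_sub h.gaussInt_total.norm_sq_mul,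
    (h.gaussInt_radial_sq.const_mul 2).gaussMean_add (h.symm.gaussInt_radial_sq.const_mul 2),
    gaussMean_const_mul, gaussMean_const_mul, ← h.totalEnergy_eq] at key
  have hG : gaussMean (fun x => ‖gradient u x‖ ^ 2 + ‖gradient v x‖ ^ 2) t
      = totalEnergy u v t - interaction u v t := by
    rw [h.totalEnergy_eq, hg.gaussMean_add h.gaussInt_interaction, interaction]
    ring
  have hd := h.gaussInt_total.hasDerivAt_gaussMean t
  rw [← e] at hd
  refine hd.congr_deriv ?_
  rw [h.defect_eq, h.symm.defect_eq, totalHeight]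
  have := congrFun (interaction_comm u v) t
  have hF : totalEnergy u v t = energy u v t + energy v u t - interaction u v t := rfl
  rw [hG] at key
  linarith

theorem hasDerivAt_totalHeight (h : IsLinearSolution u v) (t : ℝ) :
    HasDerivAt (totalHeight u v) (2 * (totalEnergy u v t - totalHeight u v t
      + interaction u v t)) t := by
  refine ((h.hasDerivAt_height t).add (h.symm.hasDerivAt_height t)).congr_deriv ?_
  unfold totalEnergy totalHeight
  ring

theorem hasDerivAt_weiss (h : IsLinearSolution u v) (t : ℝ) :
    HasDerivAt (fun t => totalEnergy u v t - totalHeight u v t)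
      (4 * interaction u v t + 2 * (defect u t + defect v t)) t :=
  ((h.hasDerivAt_totalEnergy t).sub (h.hasDerivAt_totalHeight t)).congr_deriv (by ring)

theorem exists_height_le (h : IsLinearSolution u v) :
    ∃ K > 0, ∀ t, height u t ≤ K * (Real.exp (-2 * t) + 1) := by
  obtain ⟨C, hC, hg⟩ := h.exists_sq_le
  set M := ∫ y : 𝔼, ‖y‖ ^ 2 * 1 ∂(stdGaussian 𝔼) with hM
  have hM0 : 0 ≤ M := integral_nonneg fun _ => by positivity
  refine ⟨C * (1 + M), by positivity, fun t => ?_⟩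
  have h1 := h.gaussInt_sq.gaussMean_mono
    (((gaussInt_const 1).add (gaussInt_const 1).norm_sq_mul).const_mul C)
    (fun x => (hg x).trans (le_of_eq (by ring))) t
  rw [gaussMean_const_mul, (gaussInt_const 1).gaussMean_add (gaussInt_const 1).norm_sq_mul,
    gaussMean_const, gaussMean_norm_sq_mul, ← hM] at h1
  unfold height
  have h2 := mul_le_mul_of_nonneg_left h1 (Real.exp_pos (-2 * t)).le
  refine h2.trans ?_
  have h3 := exp_neg_mul_exp_two_mul t
  have h4 : Real.exp (-2 * t) * (C * (1 + Real.exp (2 * t) * M))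
      = C * (Real.exp (-2 * t) + (Real.exp (-2 * t) * Real.exp (2 * t)) * M) := by ring
  rw [h4, h3]
  have h5 := (Real.exp_pos (-2 * t)).le
  nlinarith [mul_nonneg hC.le (mul_nonneg hM0 h5)]

theorem exists_height_bound (h : IsLinearSolution u v) :
    ∃ K > 0, ∀ t, 0 ≤ t → height u t ≤ K ∧ height v t ≤ K := by
  obtain ⟨K, hK, h1⟩ := h.exists_height_le
  obtain ⟨K', hK', h2⟩ := h.symm.exists_height_le
  refine ⟨2 * K + 2 * K', by positivity, fun t ht => ?_⟩
  have : Real.exp (-2 * t) ≤ 1 := Real.exp_le_one_iff.2 (by linarith)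
  constructor
  · nlinarith [h1 t]
  · nlinarith [h2 t]

theorem weiss_mono (h : IsLinearSolution u v) :
    Monotone fun t => totalEnergy u v t - totalHeight u v t := fun _ _ hst =>
  le_of_hasDerivAt_nonneg hst h.hasDerivAt_weiss fun t _ => by
    have := interaction_nonneg u v t
    have := defect_nonneg u t
    have := defect_nonneg v t
    linarith

theorem weiss_nonpos (h : IsLinearSolution u v) (t : ℝ) :
    totalEnergy u v t - totalHeight u v t ≤ 0 := by
  by_contra! hpos
  set w := totalEnergy u v t - totalHeight u v t with hw
  obtain ⟨K, hK, hb⟩ := h.exists_height_bound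
  have h1 : ∀ s, t ≤ s → totalHeight u v t - 2 * w * t ≤ totalHeight u v s - 2 * w * s := by
    intro s hs
    refine le_of_hasDerivAt_nonneg (f := fun s => totalHeight u v s - 2 * w * s)
      (f' := fun s => 2 * (totalEnergy u v s - totalHeight u v s + interaction u v s) - 2 * w * 1) hs
      (fun s => (h.hasDerivAt_totalHeight s).sub ((hasDerivAt_id s).const_mul (2 * w)))
      fun s hs' => ?_
    have := h.weiss_mono hs'.1
    have := interaction_nonneg u v s
    simp only at *
    linarith
  have h2 : 0 ≤ totalHeight u v t := add_nonneg (height_nonneg u t) (height_nonneg v t)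
  set s := max (max t 0) (t + (2 * K + 1) / (2 * w)) with hs
  have hs1 : t ≤ s := (le_max_left _ _).trans (le_max_left _ _)
  have hs2 : 0 ≤ s := (le_max_right _ _).trans (le_max_left _ _)
  have hs3 : t + (2 * K + 1) / (2 * w) ≤ s := le_max_right _ _
  have h3 := h1 s hs1
  have h4 := hb s hs2
  have h5 : totalHeight u v s = height u s + height v s := rfl
  have h6 : 2 * K + 1 ≤ 2 * w * (s - t) := by
    rw [← div_le_iff₀' (by positivity)]
    linarith
  linarith [h4.1, h4.2]

theorem height_mul_excess (h : IsLinearSolution u v) (t : ℝ) :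
    height u t * excess u v t = energy u v t - height u t := by
  have := (h.height_pos t).ne'
  unfold excess
  field_simp

theorem excess_ge (h : IsLinearSolution u v) (t : ℝ) : -1 ≤ excess u v t := by
  rw [excess, le_div_iff₀ (h.height_pos t)]
  linarith [energy_nonneg u v t]

theorem height_mul_sq_excess_le (h : IsLinearSolution u v) (t : ℝ) :
    height u t * excess u v t ^ 2 ≤ defect u t := by
  have h1 := h.sq_energy_sub_height_le t
  rw [← h.height_mul_excess t, mul_pow] at h1
  have h2 := h.height_pos t
  have h3 : height u t * (height u t * excess u v t ^ 2) ≤ height u t * defect u t := by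
    linarith [sq (height u t)]
  exact le_of_mul_le_mul_left h3 h2

theorem flowData (h : IsLinearSolution u v) :
    FlowData (height u) (height v) (excess u v) (excess v u) (interaction u v)
      (fun t => totalEnergy u v t / totalHeight u v t)
      (fun t => ((2 * totalEnergy u v t + 6 * interaction u v t
        - 2 * totalHeight u v t + 2 * (defect u t + defect v t)) * totalHeight u v t
        - totalEnergy u v t * (2 * (totalEnergy u v t - totalHeight u v t
          + interaction u v t))) / totalHeight u v t ^ 2) where
  a_pos := h.height_pos
  b_pos := h.symm.height_pos
  q_nonneg := interaction_nonneg u v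
  X_ge := h.excess_ge
  Y_ge := h.symm.excess_ge
  deriv_a t := by
    rw [h.height_mul_excess]
    exact h.hasDerivAt_height t
  deriv_b t := by
    rw [h.symm.height_mul_excess]
    exact h.symm.hasDerivAt_height t
  deriv_N t := (h.hasDerivAt_totalEnergy t).div (h.hasDerivAt_totalHeight t)
    (add_pos (h.height_pos t) (h.symm.height_pos t)).ne'
  N_nonneg t := by
    have h1 := h.interaction_le_energy t
    have h2 := energy_nonneg v u t
    have h3 : 0 ≤ totalEnergy u v t := by unfold totalEnergy; linarith
    exact div_nonneg h3 (add_pos (h.height_pos t) (h.symm.height_pos t)).le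
  N_le t := by
    have hpos : 0 < totalHeight u v t := add_pos (h.height_pos t) (h.symm.height_pos t)
    exact (div_le_one hpos).2 (by linarith [h.weiss_nonpos t])
  mean_le t := by
    rw [h.height_mul_excess, h.symm.height_mul_excess]
    have h1 := h.weiss_nonpos t
    unfold totalEnergy totalHeight at h1
    linarith
  N'_ge t := by
    have ha := h.height_pos t
    have hb := h.symm.height_pos t
    have hq := interaction_nonneg u v t
    have h1 := h.height_mul_sq_excess_le t
    have h2 := h.symm.height_mul_sq_excess_le t
    have h3 := h.height_mul_excess t
    have h4 := h.symm.height_mul_excess t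
    have h5 := h.interaction_le_energy t
    have h6 := energy_nonneg v u t
    unfold totalEnergy totalHeight
    set a := height u t
    set b := height v t
    set X := excess u v t
    set Y := excess v u t
    set q := interaction u v t
    set k := energy u v t
    set l := energy v u t
    set d := defect u t
    set e := defect v t
    have hk : k = a * X + a := by linarith
    have hl : l = b * Y + b := by linarith
    have hF : 0 ≤ k + l - q := by linarith
    have hab : 0 < a + b := by linarith
    rw [hk, hl] at hF ⊢
    rw [show 2 * (a * b) / (a + b) ^ 2 * (Y - X) ^ 2 + 2 * (q / (a + b))
      = (2 * (a * b) * (Y - X) ^ 2 + 2 * q * (a + b)) / (a + b) ^ 2 by field_simp]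
    refine div_le_div_of_nonneg_right ?_ (by positivity)
    have h7 := mul_le_mul_of_nonneg_right (add_le_add h1 h2) hab.le
    have h8 := mul_nonneg hq hF
    have h9 : 0 ≤ q * (a + b) := by positivity
    nlinarith [sq_nonneg q]

end IsLinearSolution

end Solutions

section Solutions

open ProbabilityTheory

variable {n : ℕ}

local notation "𝔼" => EuclideanSpace ℝ (Fin n)

theorem GaussInt.gaussMean_translate_le {g : 𝔼 → ℝ} (hg : GaussInt g) (h0 : ∀ x, 0 ≤ g x)
    (t : ℝ) (y : 𝔼) : gaussMean (fun x => g (x + Real.exp t • y)) t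
      ≤ Real.exp (n * Real.log 2) * Real.exp (‖y‖ ^ 2 / 6) * gaussMean g (t + Real.log 2) := by
  have e1 : Real.exp (-2 * (t + Real.log 2)) / 2 = Real.exp (-2 * t) / 2 / 4 := by
    rw [mul_add, Real.exp_add, show -2 * Real.log 2 = -(Real.log 2 + Real.log 2) by ring,
      Real.exp_neg, Real.exp_add, Real.exp_log two_pos]
    ring
  have e2 : Real.exp (-n * (t + Real.log 2)) * Real.exp (n * Real.log 2) = Real.exp (-n * t) := by
    rw [← Real.exp_add]
    ring_nf
  rw [gaussMean_eq, gaussMean_eq, e1]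
  set β := Real.exp (-2 * t) / 2 with hβ
  have hβ0 : 0 < β := by positivity
  have hβy : β * ‖Real.exp t • y‖ ^ 2 = ‖y‖ ^ 2 / 2 := by
    rw [norm_smul, Real.norm_of_nonneg (Real.exp_pos _).le, mul_pow, ← Real.exp_nat_mul, hβ]
    push_cast
    linear_combination (‖y‖ ^ 2 / 2) * IsLinearSolution.exp_neg_mul_exp_two_mul t
  have key : weightInt (fun x => g (x + Real.exp t • y)) β
      ≤ Real.exp (‖y‖ ^ 2 / 6) * weightInt g (β / 4) := by
    unfold weightInt
    rw [← integral_add_right_eq_self (μ := volume)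
      (fun x => g (x + Real.exp t • y) * Real.exp (-β * ‖x‖ ^ 2)) (-(Real.exp t • y)),
      ← integral_const_mul]
    refine integral_mono_of_nonneg (ae_of_all _ fun x => mul_nonneg (h0 _) (Real.exp_pos _).le)
      ((hg (β / 4) (by positivity)).const_mul _) (ae_of_all _ fun x => ?_)
    simp only [neg_add_cancel_right]
    rw [mul_left_comm, ← Real.exp_add]
    refine mul_le_mul_of_nonneg_left (Real.exp_le_exp.2 ?_) (h0 x)
    have h1 : 0 ≤ ‖(3 / 4 : ℝ) • x - Real.exp t • y‖ ^ 2 := sq_nonneg _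
    rw [norm_sub_sq_real, norm_smul, real_inner_smul_left, mul_pow] at h1
    rw [← sub_eq_add_neg, norm_sub_sq_real]
    have h2 := mul_nonneg hβ0.le h1
    norm_num at h2
    linarith
  calc _ ≤ (2 * Real.pi) ^ (-(n : ℝ) / 2) * Real.exp (-n * t)
      * (Real.exp (‖y‖ ^ 2 / 6) * weightInt g (β / 4)) :=
        mul_le_mul_of_nonneg_left key (by positivity)
    _ = _ := by
      rw [← e2]
      ring

namespace IsLinearSolution

variable {u v : EuclideanSpace ℝ (Fin n) → ℝ}

theorem gaussMean_sq_eq (u : 𝔼 → ℝ) (t : ℝ) :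
    gaussMean (fun x => u x ^ 2) t = Real.exp (2 * t) * height u t := by
  rw [height, ← mul_assoc, mul_comm (Real.exp (2 * t)), exp_neg_mul_exp_two_mul, one_mul]

theorem hasDerivAt_gaussMean_sq' (h : IsLinearSolution u v) (t : ℝ) :
    HasDerivAt (gaussMean fun x => u x ^ 2) (2 * (Real.exp (2 * t) * energy u v t)) t := by
  refine (h.hasDerivAt_gaussMean_sq t).congr_deriv ?_
  rw [h.energy_eq, ← mul_assoc (Real.exp (2 * t)), mul_comm (Real.exp (2 * t)),
    exp_neg_mul_exp_two_mul, one_mul]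

theorem monotone_gaussMean_sq (h : IsLinearSolution u v) :
    Monotone (gaussMean fun x => u x ^ 2) := fun _ _ hst =>
  le_of_hasDerivAt_nonneg hst h.hasDerivAt_gaussMean_sq' fun t _ => by
    have := energy_nonneg u v t
    positivity

theorem sq_le_gaussMean (h : IsLinearSolution u v) (t : ℝ) :
    u 0 ^ 2 ≤ gaussMean (fun x => u x ^ 2) t := by
  obtain ⟨C, hC, hg⟩ := h.exists_sq_le
  have hu := h.contDiff_left.continuous
  have hlim : Filter.Tendsto (gaussMean fun x => u x ^ 2) Filter.atBot (nhds (u 0 ^ 2)) := by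
    have e : u 0 ^ 2 = ∫ _ : 𝔼, u 0 ^ 2 ∂(stdGaussian 𝔼) := by simp
    rw [e]
    refine tendsto_integral_filter_of_dominated_convergence (fun y => C * (1 + ‖y‖ ^ 2)) ?_ ?_ ?_ ?_
    · exact Filter.Eventually.of_forall fun t => by fun_prop
    · filter_upwards [Filter.eventually_le_atBot 0] with t ht
      refine ae_of_all _ fun y => ?_
      rw [Real.norm_of_nonneg (sq_nonneg _)]
      refine (hg _).trans (mul_le_mul_of_nonneg_left ?_ hC.le)
      rw [norm_smul, Real.norm_of_nonneg (Real.exp_pos _).le]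
      have h1 : Real.exp t ≤ 1 := Real.exp_le_one_iff.2 ht
      have h2 : Real.exp t * ‖y‖ ≤ ‖y‖ := mul_le_of_le_one_left (norm_nonneg _) h1
      have h3 := pow_le_pow_left₀ (by positivity) h2 2
      linarith
    · have := (((gaussInt_const (n := n) 1).add (gaussInt_const 1).norm_sq_mul).const_mul
        C).integrable_comp_exp_smul 0
      simpa using this
    · refine ae_of_all _ fun y => ?_
      have h1 : Filter.Tendsto (fun t => Real.exp t • y) Filter.atBot (nhds ((0 : ℝ) • y)) :=
        Real.tendsto_exp_atBot.smul_const y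
      rw [zero_smul] at h1
      exact ((hu.pow 2).tendsto 0).comp h1
  exact le_of_tendsto hlim ((Filter.eventually_le_atBot t).mono fun s hs =>
    h.monotone_gaussMean_sq hs)

/-- If the Gaussian means of `u²` and `v²` grow slowly, then the two frequencies are small at some
intermediate scale. -/
theorem exists_frequency_le (h : IsLinearSolution u v) {t s : ℝ} (ht : 0 < t)
    (hs : gaussMean (fun x => u x ^ 2) t * gaussMean (fun x => v x ^ 2) t
      ≤ Real.exp (s * t) * (u 0 ^ 2 * v 0 ^ 2)) :
    ∃ τ, t / 2 ≤ τ ∧ energy u v τ / height u τ + energy v u τ / height v τ ≤ s := by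
  set A := gaussMean (fun x => u x ^ 2) with hA
  set B := gaussMean (fun x => v x ^ 2) with hB
  have hA0 : ∀ t, 0 < A t := fun t => (pow_pos (h.pos_left 0) 2).trans_le (h.sq_le_gaussMean t)
  have hB0 : ∀ t, 0 < B t := fun t =>
    (pow_pos (h.symm.pos_left 0) 2).trans_le (h.symm.sq_le_gaussMean t)
  have hd : ∀ τ, HasDerivAt (fun τ => Real.log (A τ) + Real.log (B τ))
      (2 * (energy u v τ / height u τ + energy v u τ / height v τ)) τ := fun τ => by
    refine (((h.hasDerivAt_gaussMean_sq' τ).log (hA0 τ).ne').add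
      ((h.symm.hasDerivAt_gaussMean_sq' τ).log (hB0 τ).ne')).congr_deriv ?_
    rw [gaussMean_sq_eq, gaussMean_sq_eq]
    have h1 := (Real.exp_pos (2 * τ)).ne'
    have h2 := (h.height_pos τ).ne'
    have h3 := (h.symm.height_pos τ).ne'
    field_simp
  obtain ⟨τ, hτ, he⟩ := exists_hasDerivAt_eq_slope (fun τ => Real.log (A τ) + Real.log (B τ))
    _ (show t / 2 < t by linarith)
    (fun x _ => (hd x).continuousAt.continuousWithinAt) (fun x _ => hd x)
  refine ⟨τ, hτ.1.le, ?_⟩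
  have h1 : Real.log (A t) + Real.log (B t) ≤ s * t + (Real.log (A (t / 2))
      + Real.log (B (t / 2))) := by
    rw [← Real.log_mul (hA0 _).ne' (hB0 _).ne', ← Real.log_mul (hA0 _).ne' (hB0 _).ne']
    have h2 : A t * B t ≤ Real.exp (s * t) * (A (t / 2) * B (t / 2)) :=
      hs.trans (mul_le_mul_of_nonneg_left (mul_le_mul (h.sq_le_gaussMean _)
        (h.symm.sq_le_gaussMean _) (sq_nonneg _) (hA0 _).le) (Real.exp_pos _).le)
    have h3 := Real.log_le_log (mul_pos (hA0 t) (hB0 t)) h2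
    rwa [Real.log_mul (Real.exp_pos _).ne' (mul_pos (hA0 _) (hB0 _)).ne', Real.log_exp] at h3
  rw [eq_div_iff (by linarith)] at he
  have h4 : (energy u v τ / height u τ + energy v u τ / height v τ) * t ≤ s * t := by linarith
  exact le_of_mul_le_mul_right h4 ht

end IsLinearSolution

end Solutions

section Overlap

open ProbabilityTheory

variable {E : Type*} [NormedAddCommGroup E] [InnerProductSpace ℝ E] [FiniteDimensional ℝ E]
  [MeasurableSpace E] [BorelSpace E]

local notation "γ" => stdGaussian E

/-- Two nonnegative normalised functions with small Dirichlet energy overlap substantially. -/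
theorem half_le_integral_mul {f g : E → ℝ} (hf : ContDiff ℝ 2 f) (hg : ContDiff ℝ 2 g)
    (hf0 : ∀ x, 0 ≤ f x) (hg0 : ∀ x, 0 ≤ g x)
    (hf2 : Integrable (fun x => f x ^ 2) γ) (hg2 : Integrable (fun x => g x ^ 2) γ)
    (hf' : Integrable (fun x => ‖gradient f x‖ ^ 2) γ)
    (hg' : Integrable (fun x => ‖gradient g x‖ ^ 2) γ)
    (hf1 : ∫ x, f x ^ 2 ∂γ = 1) (hg1 : ∫ x, g x ^ 2 ∂γ = 1)
    (hsmall : ∫ x, ‖gradient f x‖ ^ 2 ∂γ + ∫ x, ‖gradient g x‖ ^ 2 ∂γ ≤ 1 / 4) :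
    1 / 2 ≤ ∫ x, f x * g x ∂γ := by
  have hfm : MemLp f 2 γ :=
    (memLp_two_iff_integrable_sq hf.continuous.aestronglyMeasurable).2 hf2
  have hgm : MemLp g 2 γ :=
    (memLp_two_iff_integrable_sq hg.continuous.aestronglyMeasurable).2 hg2
  have hfi : Integrable f γ := hfm.integrable one_le_two
  have hgi : Integrable g γ := hgm.integrable one_le_two
  have hfg : Integrable (fun x => f x * g x) γ := hfm.integrable_mul hgm
  have pf := gaussian_poincare hf hf2 hf'
  have pg := gaussian_poincare hg hg2 hg'
  have nf : 0 ≤ ∫ x, ‖gradient f x‖ ^ 2 ∂γ := integral_nonneg fun _ => sq_nonneg _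
  have ng : 0 ≤ ∫ x, ‖gradient g x‖ ^ 2 ∂γ := integral_nonneg fun _ => sq_nonneg _
  have mf : 0 ≤ ∫ x, f x ∂γ := integral_nonneg hf0
  have mg : 0 ≤ ∫ x, g x ∂γ := integral_nonneg hg0
  rw [hf1] at pf
  rw [hg1] at pg
  set P := ∫ x, f x ∂γ with hP
  set Q := ∫ x, g x ∂γ with hQ
  have h1 : 0 ≤ ∫ x, (((f x ^ 2 + g x ^ 2) + 2 * (f x * g x)) - (2 * (P + Q)) * (f x + g x))
      + (P + Q) ^ 2 ∂γ :=
    integral_nonneg fun x => by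
      show 0 ≤ (((f x ^ 2 + g x ^ 2) + 2 * (f x * g x)) - (2 * (P + Q)) * (f x + g x))
        + (P + Q) ^ 2
      nlinarith [sq_nonneg (f x + g x - (P + Q))]
  have i1 : Integrable (fun x => f x ^ 2 + g x ^ 2) γ := hf2.add hg2
  have i2 : Integrable (fun x => (f x ^ 2 + g x ^ 2) + 2 * (f x * g x)) γ :=
    i1.add (hfg.const_mul 2)
  have i3 : Integrable (fun x => f x + g x) γ := hfi.add hgi
  have i4 : Integrable (fun x => ((f x ^ 2 + g x ^ 2) + 2 * (f x * g x))
    - (2 * (P + Q)) * (f x + g x)) γ := i2.sub (i3.const_mul _)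
  rw [integral_add i4 (integrable_const _), integral_sub i2 (i3.const_mul _),
    integral_add i1 (hfg.const_mul 2), integral_add hf2 hg2, integral_const_mul,
    integral_const_mul, integral_add hfi hgi, hf1, hg1, ← hP, ← hQ] at h1
  simp only [integral_const, probReal_univ, one_smul] at h1
  have hP1 : 4 / 5 ≤ P := by nlinarith
  have hQ1 : 4 / 5 ≤ Q := by nlinarith
  have hPQ : 4 / 5 * (4 / 5) ≤ P * Q := mul_le_mul hP1 hQ1 (by norm_num) mf
  nlinarith

end Overlap

section Solutions

open ProbabilityTheory

variable {n : ℕ}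

local notation "𝔼" => EuclideanSpace ℝ (Fin n)

/-- The rescaling of `u` to scale `e ^ t`, normalised in Gaussian `L²`. -/
def normalized (u : 𝔼 → ℝ) (t : ℝ) (y : 𝔼) : ℝ :=
  u (Real.exp t • y) / √(gaussMean (fun x => u x ^ 2) t)

namespace IsLinearSolution

variable {u v : EuclideanSpace ℝ (Fin n) → ℝ}

theorem gaussMean_sq_pos (h : IsLinearSolution u v) (t : ℝ) :
    0 < gaussMean (fun x => u x ^ 2) t := by
  rw [gaussMean_sq_eq]
  exact mul_pos (Real.exp_pos _) (h.height_pos t)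

theorem contDiff_normalized (h : IsLinearSolution u v) (t : ℝ) :
    ContDiff ℝ 2 (normalized u t) :=
  (h.contDiff_left.comp (contDiff_const_smul (Real.exp t))).div_const _

theorem normalized_nonneg (h : IsLinearSolution u v) (t : ℝ) (y : 𝔼) : 0 ≤ normalized u t y :=
  div_nonneg (h.pos_left _).le (Real.sqrt_nonneg _)

theorem sq_normalized (h : IsLinearSolution u v) (t : ℝ) (y : 𝔼) :
    normalized u t y ^ 2 = (gaussMean (fun x => u x ^ 2) t)⁻¹ * u (Real.exp t • y) ^ 2 := by
  rw [normalized, div_pow, Real.sq_sqrt (h.gaussMean_sq_pos t).le, div_eq_inv_mul]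

theorem integrable_sq_normalized (h : IsLinearSolution u v) (t : ℝ) :
    Integrable (fun y => normalized u t y ^ 2) (stdGaussian 𝔼) := by
  simp only [h.sq_normalized]
  exact (h.gaussInt_sq.integrable_comp_exp_smul t).const_mul _

theorem integral_sq_normalized (h : IsLinearSolution u v) (t : ℝ) :
    ∫ y, normalized u t y ^ 2 ∂(stdGaussian 𝔼) = 1 := by
  simp only [h.sq_normalized]
  rw [integral_const_mul]
  exact inv_mul_cancel₀ (h.gaussMean_sq_pos t).ne'

theorem sq_norm_gradient_normalized (h : IsLinearSolution u v) (t : ℝ) (y : 𝔼) :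
    ‖gradient (normalized u t) y‖ ^ 2 = (height u t)⁻¹ * ‖gradient u (Real.exp t • y)‖ ^ 2 := by
  have hd := (h.contDiff_left.differentiable (by norm_num))
  have e1 := gradient_comp_affine (f := u) (c := Real.exp t) (w := 0) (x := y) (hd _)
  simp only [add_zero] at e1
  have hd' : DifferentiableAt ℝ (fun y => u (Real.exp t • y)) y := by fun_prop
  have e2 := gradient_comp_real (f := fun y => u (Real.exp t • y))
    (g := fun s => s / √(gaussMean (fun x => u x ^ 2) t)) (x := y)
    ((hasDerivAt_id _).div_const _) hd'
  unfold normalized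
  rw [e2, e1, norm_smul, norm_smul, mul_pow, mul_pow, Real.norm_of_nonneg (Real.exp_pos _).le,
    Real.norm_of_nonneg (by positivity), div_pow, Real.sq_sqrt (h.gaussMean_sq_pos t).le,
    gaussMean_sq_eq, ← Real.exp_nat_mul]
  have h1 := (Real.exp_pos (2 * t)).ne'
  have h2 := (h.height_pos t).ne'
  push_cast
  field_simp

theorem integrable_sq_gradient_normalized (h : IsLinearSolution u v) (t : ℝ) :
    Integrable (fun y => ‖gradient (normalized u t) y‖ ^ 2) (stdGaussian 𝔼) := by
  simp only [h.sq_norm_gradient_normalized]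
  exact (h.gaussInt_gradient.integrable_comp_exp_smul t).const_mul _

theorem integral_sq_gradient_normalized_le (h : IsLinearSolution u v) (t : ℝ) :
    ∫ y, ‖gradient (normalized u t) y‖ ^ 2 ∂(stdGaussian 𝔼) ≤ energy u v t / height u t := by
  simp only [h.sq_norm_gradient_normalized]
  rw [integral_const_mul, div_eq_inv_mul]
  refine mul_le_mul_of_nonneg_left ?_ (inv_nonneg.2 (height_nonneg u t))
  exact h.gaussInt_gradient.gaussMean_mono h.gaussInt_energy
    (fun x => by nlinarith [mul_nonneg (sq_nonneg (u x)) (sq_nonneg (v x))]) t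

theorem le_interaction (h : IsLinearSolution u v) {τ : ℝ}
    (hτ : energy u v τ / height u τ + energy v u τ / height v τ ≤ 1 / 4) :
    1 / 4 * (gaussMean (fun x => u x ^ 2) τ * gaussMean (fun x => v x ^ 2) τ)
      ≤ interaction u v τ := by
  have h1 := half_le_integral_mul (h.contDiff_normalized τ) (h.symm.contDiff_normalized τ)
    (h.normalized_nonneg τ) (h.symm.normalized_nonneg τ) (h.integrable_sq_normalized τ)
    (h.symm.integrable_sq_normalized τ) (h.integrable_sq_gradient_normalized τ)
    (h.symm.integrable_sq_gradient_normalized τ) (h.integral_sq_normalized τ)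
    (h.symm.integral_sq_normalized τ)
    ((add_le_add (h.integral_sq_gradient_normalized_le τ)
      (h.symm.integral_sq_gradient_normalized_le τ)).trans hτ)
  set A := gaussMean (fun x => u x ^ 2) τ with hA
  set B := gaussMean (fun x => v x ^ 2) τ with hB
  have hA0 : 0 < A := h.gaussMean_sq_pos τ
  have hB0 : 0 < B := h.symm.gaussMean_sq_pos τ
  have e : ∀ y, (normalized u τ y * normalized v τ y) ^ 2
      = (A * B)⁻¹ * (u (Real.exp τ • y) ^ 2 * v (Real.exp τ • y) ^ 2) := fun y => by
    rw [mul_pow, h.sq_normalized, h.symm.sq_normalized, ← hA, ← hB, mul_inv]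
    ring
  have hc : Continuous fun y => normalized u τ y * normalized v τ y :=
    (h.contDiff_normalized τ).continuous.mul (h.symm.contDiff_normalized τ).continuous
  have hm : MemLp (fun y => normalized u τ y * normalized v τ y) 2 (stdGaussian 𝔼) := by
    refine (memLp_two_iff_integrable_sq hc.aestronglyMeasurable).2 ?_
    simp only [e]
    exact (h.gaussInt_interaction.integrable_comp_exp_smul τ).const_mul _
  have h2 := sq_norm_integral_le hm
  simp only [Real.norm_eq_abs, sq_abs, e] at h2
  rw [integral_const_mul] at h2
  have h3 : 1 / 4 ≤ (A * B)⁻¹ * interaction u v τ :=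
    le_trans (by nlinarith) h2
  rw [inv_mul_eq_div, le_div_iff₀ (by positivity)] at h3
  exact h3

theorem gaussMean_sq_le_exp (h : IsLinearSolution u v) {τ : ℝ}
    (hτ : energy u v τ / height u τ + energy v u τ / height v τ ≤ 1 / 4) :
    gaussMean (fun x => u x ^ 2) τ ≤ Real.exp (-2 * τ) := by
  have h1 := h.le_interaction hτ
  rw [interaction_comm] at h1
  have h2 := h1.trans (h.symm.interaction_le_energy τ)
  have h3 : 0 ≤ energy u v τ / height u τ :=
    div_nonneg (energy_nonneg u v τ) (height_nonneg u τ)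
  have h4 : energy v u τ ≤ 1 / 4 * height v τ := by
    rw [← div_le_iff₀ (h.symm.height_pos τ)]
    linarith
  have h5 : height v τ = Real.exp (-2 * τ) * gaussMean (fun x => v x ^ 2) τ := rfl
  rw [h5] at h4
  have h6 := h.symm.gaussMean_sq_pos τ
  refine le_of_mul_le_mul_right ?_ h6
  linarith

end IsLinearSolution

end Solutions

section Solutions

open ProbabilityTheory

variable {n : ℕ}

local notation "𝔼" => EuclideanSpace ℝ (Fin n)

namespace IsLinearSolution

variable {u v : EuclideanSpace ℝ (Fin n) → ℝ}

theorem gaussMean_sq_translate_le (h : IsLinearSolution u v) {C₁ t : ℝ}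
    (hC : height u (t + Real.log 2) ≤ C₁ * height u t) (y : 𝔼) :
    gaussMean (fun x => u (x + Real.exp t • y) ^ 2) t
      ≤ Real.exp (n * Real.log 2) * (4 * C₁) * (Real.exp (‖y‖ ^ 2 / 6)
        * gaussMean (fun x => u x ^ 2) t) := by
  refine (h.gaussInt_sq.gaussMean_translate_le (fun _ => sq_nonneg _) t y).trans ?_
  have h1 : gaussMean (fun x => u x ^ 2) (t + Real.log 2)
      ≤ 4 * C₁ * gaussMean (fun x => u x ^ 2) t := by
    rw [gaussMean_sq_eq, gaussMean_sq_eq, mul_add, Real.exp_add, two_mul (Real.log 2),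
      Real.exp_add, Real.exp_log two_pos]
    have := mul_le_mul_of_nonneg_left hC (Real.exp_pos (2 * t)).le
    linarith
  have h2 := mul_le_mul_of_nonneg_left h1
    (show 0 ≤ Real.exp (n * Real.log 2) * Real.exp (‖y‖ ^ 2 / 6) by positivity)
  linarith

theorem sq_expWeight (y : 𝔼) : expWeight y ^ 2 = Real.exp (‖y‖ ^ 2 / 6) := by
  rw [expWeight, ← Real.exp_nat_mul]
  push_cast
  ring_nf

theorem lt_sq_of_lt_normalized (h : IsLinearSolution u v) {t δ : ℝ} {y : 𝔼} (hδ : 0 ≤ δ)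
    (hy : δ * expWeight y < normalized u t y) :
    δ ^ 2 * (Real.exp (‖y‖ ^ 2 / 6) * gaussMean (fun x => u x ^ 2) t)
      < u (Real.exp t • y) ^ 2 := by
  have h1 : (δ * expWeight y) ^ 2 < normalized u t y ^ 2 :=
    pow_lt_pow_left₀ hy (mul_nonneg hδ (Real.exp_pos _).le) two_ne_zero
  rw [mul_pow, sq_expWeight, h.sq_normalized, inv_mul_eq_div,
    lt_div_iff₀ (h.gaussMean_sq_pos t)] at h1
  linarith

/-- At scales where the heights do not jump, the two components are nowhere simultaneously
comparable with their Gaussian means. -/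
theorem almost_disjoint (h : IsLinearSolution u v) (C₁ : ℝ) : ∃ T > 0, ∀ t, T ≤ t →
    height u (t + Real.log 2) ≤ C₁ * height u t → height v (t + Real.log 2) ≤ C₁ * height v t →
    ∀ y, normalized u t y ≤ Real.exp (-t / 20) * expWeight y ∨
      normalized v t y ≤ Real.exp (-t / 20) * expWeight y := by
  set c := gaussMean (fun x => u x ^ 2) 0 with hc
  have hc0 : 0 < c := h.gaussMean_sq_pos 0
  set K := Real.exp (n * Real.log 2) * (4 * C₁) with hK
  refine ⟨20 * K ^ 2 + 2 / c + 1, by positivity, fun t ht hu hv y => ?_⟩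
  by_contra! hy
  have hδ := (Real.exp_pos (-t / 20)).le
  have hcp : 0 < 2 / c := by positivity
  have ht1 : 1 ≤ t := by nlinarith [sq_nonneg K]
  have u1 := h.lt_sq_of_lt_normalized hδ hy.1
  have v1 := h.symm.lt_sq_of_lt_normalized hδ hy.2
  have u2 := h.gaussMean_sq_translate_le hu y
  have v2 := h.symm.gaussMean_sq_translate_le hv y
  rw [← hK] at u2 v2
  set x := Real.exp t • y with hx
  have hx' := h.translate x
  have hd : Real.exp (-t / 20) ^ 2 = Real.exp (-t / 10) := by
    rw [← Real.exp_nat_mul]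
    push_cast
    ring_nf
  rw [hd] at u1 v1
  set A := Real.exp (‖y‖ ^ 2 / 6) * gaussMean (fun x => u x ^ 2) t with hA
  set B := Real.exp (‖y‖ ^ 2 / 6) * gaussMean (fun x => v x ^ 2) t with hB
  have hA0 : 0 < A := mul_pos (Real.exp_pos _) (h.gaussMean_sq_pos t)
  have hB0 : 0 < B := mul_pos (Real.exp_pos _) (h.symm.gaussMean_sq_pos t)
  have hgrow : gaussMean (fun z => u (z + x) ^ 2) t * gaussMean (fun z => v (z + x) ^ 2) t
      ≤ Real.exp (1 / 4 * t) * (u (0 + x) ^ 2 * v (0 + x) ^ 2) := by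
    rw [zero_add]
    have e1 : Real.exp (1 / 4 * t) = Real.exp (t / 20) * (Real.exp (t / 10) * Real.exp (t / 10)) := by
      rw [← Real.exp_add, ← Real.exp_add]
      ring_nf
    have e2 : Real.exp (t / 10) * Real.exp (-t / 10) = 1 := by
      rw [← Real.exp_add]
      ring_nf
      simp
    have h1 : K ^ 2 ≤ Real.exp (t / 20) := by
      have := Real.add_one_le_exp (t / 20)
      linarith
    calc _ ≤ (K * A) * (K * B) := mul_le_mul u2 v2 (hx'.symm.gaussMean_sq_pos t).le
          ((hx'.gaussMean_sq_pos t).le.trans u2)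
      _ = K ^ 2 * (A * B) := by ring
      _ ≤ Real.exp (t / 20) * (A * B) := mul_le_mul_of_nonneg_right h1 (by positivity)
      _ = Real.exp (1 / 4 * t) * ((Real.exp (-t / 10) * A) * (Real.exp (-t / 10) * B)) := by
        rw [e1]
        linear_combination (-Real.exp (t / 20) * (A * B)
          * (Real.exp (t / 10) * Real.exp (-t / 10) + 1)) * e2
      _ ≤ _ := mul_le_mul_of_nonneg_left
        (mul_le_mul u1.le v1.le (by positivity) (sq_nonneg _)) (Real.exp_pos _).le
  obtain ⟨τ, hτ, hle⟩ := hx'.exists_frequency_le (by linarith) hgrow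
  have h3 := (hx'.sq_le_gaussMean τ).trans (hx'.gaussMean_sq_le_exp hle)
  simp only [zero_add] at h3
  have h4 : Real.exp (-2 * τ) ≤ Real.exp (-t) := Real.exp_le_exp.2 (by linarith)
  have h5 : c ≤ A := by
    have h6 := h.monotone_gaussMean_sq (show 0 ≤ t by linarith)
    have h7 : (1 : ℝ) ≤ Real.exp (‖y‖ ^ 2 / 6) := Real.one_le_exp (by positivity)
    nlinarith [h.gaussMean_sq_pos t]
  have h8 : Real.exp (-t / 10) * c < Real.exp (-t) :=
    (mul_le_mul_of_nonneg_left h5 (Real.exp_pos _).le).trans_lt (u1.trans_le (h3.trans h4))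
  have e3 : Real.exp (-t) = Real.exp (-t / 10) * Real.exp (-(9 * t / 10)) := by
    rw [← Real.exp_add]
    ring_nf
  rw [e3] at h8
  have h9 := lt_of_mul_lt_mul_left h8 (Real.exp_pos _).le
  rw [Real.exp_neg, lt_inv_comm₀ hc0 (Real.exp_pos _)] at h9
  have h10 := Real.add_one_le_exp (9 * t / 10)
  have h11 : 2 / c = 2 * c⁻¹ := by ring
  have h12 : 0 < c⁻¹ := inv_pos.2 hc0
  nlinarith [sq_nonneg K]

theorem improves (h : IsLinearSolution u v) :
    FlowData.Improves (height u) (height v) (excess u v) (excess v u) (Real.log 2) (1 / 40) := by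
  intro C₁
  obtain ⟨C, hC, hFH⟩ := friedland_hayman_of_almost_disjoint 𝔼
  obtain ⟨T, hT, hdis⟩ := h.almost_disjoint C₁
  have aux : ∀ {u v : 𝔼 → ℝ}, IsLinearSolution u v → ∀ t, 0 ≤ t →
      (T ≤ t → ∀ y, normalized u t y ≤ Real.exp (-t / 20) * expWeight y ∨
        normalized v t y ≤ Real.exp (-t / 20) * expWeight y) → excess u v t < 0 →
      -excess u v t / (1 + 4 * -excess u v t)
        - (C + 2 * Real.exp (T / 40)) * Real.exp (-(1 / 40) * t) ≤ excess v u t := by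
    intro u v h t ht hd hX
    have hpos := (Real.exp_pos (-(1 / 40) * t)).le
    have hT' := (Real.exp_pos (T / 40)).le
    have e : ∀ {u v : 𝔼 → ℝ}, IsLinearSolution u v →
        energy u v t / height u t = 1 + excess u v t := fun h => by
      have := (h.height_pos t).ne'
      unfold excess
      field_simp
      ring
    rcases le_total T t with hTt | htT
    · have h1 := hFH (normalized u t) (normalized v t) (1 + excess u v t) (1 + excess v u t)
        (Real.exp (-t / 20)) (h.contDiff_normalized t) (h.symm.contDiff_normalized t)
        (h.normalized_nonneg t) (h.symm.normalized_nonneg t) (h.integrable_sq_normalized t)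
        (h.symm.integrable_sq_normalized t) (h.integrable_sq_gradient_normalized t)
        (h.symm.integrable_sq_gradient_normalized t) (h.integral_sq_normalized t)
        (h.symm.integral_sq_normalized t)
        ((h.integral_sq_gradient_normalized_le t).trans (e h).le)
        ((h.symm.integral_sq_gradient_normalized_le t).trans (e h.symm).le) (by linarith)
        (Real.exp_pos _) (Real.exp_le_one_iff.2 (by linarith)) (hd hTt)
      have h2 : √(Real.exp (-t / 20)) = Real.exp (-(1 / 40) * t) := by
        rw [Real.sqrt_eq_iff_mul_self_eq (Real.exp_pos _).le (Real.exp_pos _).le, ← Real.exp_add]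
        ring_nf
      rw [h2, show 1 - (1 + excess u v t) = -excess u v t by ring] at h1
      nlinarith [mul_nonneg hT' hpos]
    · have h1 : -excess u v t / (1 + 4 * -excess u v t) ≤ 1 := by
        rw [div_le_one (by linarith)]
        linarith
      have h2 : 1 ≤ Real.exp (T / 40) * Real.exp (-(1 / 40) * t) := by
        rw [← Real.exp_add]
        exact Real.one_le_exp (by linarith)
      have h3 := h.symm.excess_ge t
      nlinarith [mul_nonneg hC.le hpos]
  refine ⟨C + 2 * Real.exp (T / 40), by positivity, fun t ht hu hv => ⟨?_, ?_⟩⟩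
  · exact aux h t ht fun hTt => hdis t hTt hu hv
  · exact aux h.symm t ht fun hTt y => (hdis t hTt hu hv y).symm

/-- The product of the Gaussian heights converges to a positive limit. -/
theorem exists_limit_height (h : IsLinearSolution u v) :
    ∃ L, 0 < L ∧ Filter.Tendsto (fun t => height u t * height v t) Filter.atTop (nhds L) := by
  obtain ⟨K, _, hb⟩ := h.exists_height_bound
  exact h.flowData.exists_limit (κ := 1 / 40) (K := K) (by norm_num)
    (fun t ht => (hb t ht).1) (fun t ht => (hb t ht).2) h.improves

end IsLinearSolution

end Solutions

section Defect

open ProbabilityTheory Filter Topology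

variable {n : ℕ}

local notation "𝔼" => EuclideanSpace ℝ (Fin n)

theorem GaussInt.gaussMean_le_of_le {g : 𝔼 → ℝ} (hg : GaussInt g) (h0 : ∀ x, 0 ≤ g x) {s t : ℝ}
    (hst : s ≤ t) : gaussMean g s ≤ Real.exp (n * (t - s)) * gaussMean g t := by
  have e : Real.exp (n * (t - s)) * Real.exp (-n * t) = Real.exp (-n * s) := by
    rw [← Real.exp_add]
    ring_nf
  have key : weightInt g (Real.exp (-2 * s) / 2) ≤ weightInt g (Real.exp (-2 * t) / 2) := by
    unfold weightInt
    refine integral_mono (hg _ (by positivity)) (hg _ (by positivity)) fun x => ?_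
    refine mul_le_mul_of_nonneg_left (Real.exp_le_exp.2 ?_) (h0 x)
    have : Real.exp (-2 * t) ≤ Real.exp (-2 * s) := Real.exp_le_exp.2 (by linarith)
    nlinarith [sq_nonneg ‖x‖]
  rw [gaussMean_eq, gaussMean_eq, ← e]
  calc _ ≤ (2 * Real.pi) ^ (-(n : ℝ) / 2) * (Real.exp (n * (t - s)) * Real.exp (-n * t))
      * weightInt g (Real.exp (-2 * t) / 2) := mul_le_mul_of_nonneg_left key (by positivity)
    _ = _ := by ring

namespace IsLinearSolution

variable {u v : EuclideanSpace ℝ (Fin n) → ℝ}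

theorem defect_le_of_le (h : IsLinearSolution u v) {s t : ℝ} (hst : s ≤ t) (hts : t ≤ s + 1) :
    defect u s ≤ Real.exp (n + 2) * defect u t := by
  have h1 := h.gaussInt_defect.gaussMean_le_of_le (fun _ => sq_nonneg _) hst
  have h0 := gaussMean_nonneg (g := fun x => (fderiv ℝ u x x - u x) ^ 2) (fun _ => sq_nonneg _) t
  have e : Real.exp (-2 * s) = Real.exp (2 * (t - s)) * Real.exp (-2 * t) := by
    rw [← Real.exp_add]
    ring_nf
  unfold defect
  calc _ ≤ Real.exp (-2 * s) * _ := mul_le_mul_of_nonneg_left h1 (Real.exp_pos _).le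
    _ = Real.exp (n * (t - s) + 2 * (t - s)) * (Real.exp (-2 * t)
        * gaussMean (fun x => (fderiv ℝ u x x - u x) ^ 2) t) := by rw [e, Real.exp_add]; ring
    _ ≤ _ := by
      refine mul_le_mul_of_nonneg_right (Real.exp_le_exp.2 ?_) (by positivity)
      have : (0 : ℝ) ≤ n := Nat.cast_nonneg n
      nlinarith

theorem tendsto_defect (h : IsLinearSolution u v) : Tendsto (defect u) atTop (𝓝 0) := by
  set W := fun t => totalEnergy u v t - totalHeight u v t with hW
  have hbdd : BddAbove (Set.range W) := ⟨0, by rintro _ ⟨t, rfl⟩; exact h.weiss_nonpos t⟩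
  have h1 := tendsto_atTop_ciSup h.weiss_mono hbdd
  have h2 : Tendsto (fun t => W (t + 1) - W t) atTop (𝓝 0) := by
    have := (h1.comp (tendsto_atTop_add_const_right atTop 1 tendsto_id)).sub h1
    rwa [sub_self] at this
  have h3 : Tendsto (fun t => Real.exp (n + 2) * (W (t + 1) - W t)) atTop (𝓝 0) := by
    simpa using h2.const_mul (Real.exp (n + 2))
  refine squeeze_zero (defect_nonneg u) (fun t => ?_) h3
  have hE := Real.exp_pos ((n : ℝ) + 2)
  have h4 := le_of_hasDerivAt_nonneg (s := t) (r := t + 1)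
    (f := fun s => Real.exp (n + 2) * W s - defect u t * s)
    (f' := fun s => Real.exp (n + 2) * (4 * interaction u v s + 2 * (defect u s + defect v s))
      - defect u t * 1) (by linarith)
    (fun s => ((h.hasDerivAt_weiss s).const_mul _).sub ((hasDerivAt_id s).const_mul _))
    fun s hs => by
      have h5 := h.defect_le_of_le hs.1 hs.2
      have := mul_nonneg hE.le (interaction_nonneg u v s)
      have := mul_nonneg hE.le (defect_nonneg u s)
      have := mul_nonneg hE.le (defect_nonneg v s)
      linarith
  linarith

end IsLinearSolution

end Defect

section BallMean

open Filter Topology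

variable {n : ℕ}

local notation "𝔼" => EuclideanSpace ℝ (Fin n)

/-- The integral over the unit ball of `g` rescaled to scale `e ^ s`. -/
def ballMean (g : 𝔼 → ℝ) (s : ℝ) : ℝ := ∫ y in ball (0 : 𝔼) 1, g (Real.exp s • y)

theorem setIntegral_ball_comp_smul (g : 𝔼 → ℝ) {c : ℝ} (hc : 0 < c) (ρ : ℝ) :
    ∫ y in ball (0 : 𝔼) ρ, g (c • y) = (c ^ n)⁻¹ * ∫ x in ball (0 : 𝔼) (c * ρ), g x := by
  rw [← integral_indicator measurableSet_ball, ← integral_indicator measurableSet_ball]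
  have h := Measure.integral_comp_smul (volume : Measure 𝔼)
    ((ball (0 : 𝔼) (c * ρ)).indicator g) c
  rw [finrank_euclideanSpace_fin, abs_of_pos (by positivity), smul_eq_mul] at h
  rw [← h]
  congr 1
  ext y
  have : y ∈ ball (0 : 𝔼) ρ ↔ c • y ∈ ball (0 : 𝔼) (c * ρ) := by
    simp [norm_smul, abs_of_pos hc, hc]
  by_cases hy : y ∈ ball (0 : 𝔼) ρ
  · rw [Set.indicator_of_mem hy, Set.indicator_of_mem (this.1 hy)]
  · rw [Set.indicator_of_notMem hy, Set.indicator_of_notMem fun h => hy (this.2 h)]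

theorem ballMean_eq (g : 𝔼 → ℝ) (s : ℝ) :
    ballMean g s = Real.exp (-n * s) * ∫ x in ball (0 : 𝔼) (Real.exp s), g x := by
  rw [ballMean, setIntegral_ball_comp_smul g (Real.exp_pos s), mul_one, ← Real.exp_nat_mul,
    ← Real.exp_neg, neg_mul]

theorem setIntegral_ball_eq_ballMean (g : 𝔼 → ℝ) (s : ℝ) {r : ℝ} (hr : 0 < r) :
    ∫ y in ball (0 : 𝔼) r, g (Real.exp s • y) = r ^ n * ballMean g (s + Real.log r) := by
  rw [setIntegral_ball_comp_smul g (Real.exp_pos s), ballMean,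
    setIntegral_ball_comp_smul g (Real.exp_pos _), Real.exp_add, Real.exp_log hr, mul_one, mul_pow]
  field_simp

theorem integrableOn_ball {g : 𝔼 → ℝ} (hg : Continuous g) (ρ : ℝ) :
    IntegrableOn g (ball (0 : 𝔼) ρ) :=
  (hg.continuousOn.integrableOn_compact (isCompact_closedBall 0 ρ)).mono_set ball_subset_closedBall

theorem continuous_ballMean {g : 𝔼 → ℝ} (hg : Continuous g) : Continuous (ballMean g) := by
  refine continuous_iff_continuousAt.2 fun s => ?_
  obtain ⟨C, hC⟩ := (isCompact_closedBall (0 : 𝔼) (Real.exp (s + 1))).exists_bound_of_continuousOn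
    hg.continuousOn
  refine continuousAt_of_dominated (bound := fun _ => C) ?_ ?_ ?_ ?_
  · exact Eventually.of_forall fun t => by fun_prop
  · filter_upwards [Iio_mem_nhds (show s < s + 1 by linarith)] with t ht
    refine (ae_restrict_iff' measurableSet_ball).2 (ae_of_all _ fun y hy => hC _ ?_)
    rw [mem_ball_zero_iff] at hy
    rw [mem_closedBall_zero_iff, norm_smul, Real.norm_of_nonneg (Real.exp_pos _).le]
    have := Real.exp_le_exp.2 (Set.mem_Iio.1 ht).le
    nlinarith [Real.exp_pos t, norm_nonneg y]
  · exact integrableOn_const measure_ball_lt_top.ne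
  · exact ae_of_all _ fun y => by fun_prop

theorem ballMean_nonneg {g : 𝔼 → ℝ} (hg : ∀ x, 0 ≤ g x) (s : ℝ) : 0 ≤ ballMean g s :=
  integral_nonneg fun _ => hg _

theorem lintegral_lintegral_Ioi_norm (ν : Measure 𝔼) [SFinite ν] {w : ℝ → ENNReal}
    (hw : Measurable w) : ∫⁻ y, (∫⁻ r in Set.Ioi ‖y‖, w r) ∂ν
      = ∫⁻ r in Set.Ioi 0, w r * ν (ball 0 r) := by
  have hm : MeasurableSet {p : 𝔼 × ℝ | ‖p.1‖ < p.2} :=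
    measurableSet_lt (by fun_prop) (by fun_prop)
  calc _ = ∫⁻ y, (∫⁻ r, {p : 𝔼 × ℝ | ‖p.1‖ < p.2}.indicator (fun p => w p.2) (y, r)) ∂ν := by
        refine lintegral_congr fun y => ?_
        rw [← lintegral_indicator measurableSet_Ioi]
        rfl
    _ = ∫⁻ r, (∫⁻ y, {p : 𝔼 × ℝ | ‖p.1‖ < p.2}.indicator (fun p => w p.2) (y, r) ∂ν) :=
        lintegral_lintegral_swap
          ((hw.comp measurable_snd).indicator hm).aemeasurable
    _ = _ := by
        rw [← lintegral_indicator measurableSet_Ioi]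
        refine lintegral_congr fun r => ?_
        have e : (fun y => {p : 𝔼 × ℝ | ‖p.1‖ < p.2}.indicator (fun p => w p.2) (y, r))
            = (ball (0 : 𝔼) r).indicator fun _ => w r := by
          ext y
          simp [Set.indicator]
        rw [e, lintegral_indicator measurableSet_ball, lintegral_const, Measure.restrict_apply_univ]
        by_cases hr : 0 < r
        · simp [hr]
        · simp [hr, ball_eq_empty.2 (not_lt.1 hr)]

/-- Radial weights integrate as superpositions of ball means. -/
theorem lintegral_mul_radial (hn : 0 < n) {g : 𝔼 → ℝ} (hg : Continuous g) (h0 : ∀ x, 0 ≤ g x)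
    {w G : ℝ → ℝ} (hw : Measurable w) (hw0 : ∀ r, 0 < r → 0 ≤ w r)
    (hG : ∀ r, 0 < r → ∫⁻ t in Set.Ioi r, ENNReal.ofReal (w t) = ENNReal.ofReal (G r)) (s : ℝ) :
    ∫⁻ y : 𝔼, ENNReal.ofReal (g (Real.exp s • y) * G ‖y‖)
      = ∫⁻ r in Set.Ioi 0, ENNReal.ofReal (w r * (r ^ n * ballMean g (s + Real.log r))) := by
  have hne : Nonempty (Fin n) := ⟨⟨0, hn⟩⟩
  have hcont : Continuous fun y : 𝔼 => g (Real.exp s • y) := by fun_prop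
  have hmeas : Measurable fun y : 𝔼 => ENNReal.ofReal (g (Real.exp s • y)) :=
    hcont.measurable.ennreal_ofReal
  have h1 := lintegral_lintegral_Ioi_norm
    ((volume : Measure 𝔼).withDensity fun y => ENNReal.ofReal (g (Real.exp s • y)))
    hw.ennreal_ofReal
  have hmi : Measurable fun y : 𝔼 => ∫⁻ r in Set.Ioi ‖y‖, ENNReal.ofReal (w r) := by
    have e : (fun y : 𝔼 => ∫⁻ r in Set.Ioi ‖y‖, ENNReal.ofReal (w r))
        = fun y => ∫⁻ r, {p : 𝔼 × ℝ | ‖p.1‖ < p.2}.indicator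
          (fun p => ENNReal.ofReal (w p.2)) (y, r) := by
      ext y
      rw [← lintegral_indicator measurableSet_Ioi]
      rfl
    rw [e]
    exact Measurable.lintegral_prod_right ((hw.ennreal_ofReal.comp measurable_snd).indicator
      (measurableSet_lt (by fun_prop) (by fun_prop)))
  rw [lintegral_withDensity_eq_lintegral_mul _ hmeas hmi] at h1
  have e1 : ∫⁻ y : 𝔼, ENNReal.ofReal (g (Real.exp s • y) * G ‖y‖) = ∫⁻ y : 𝔼,
      ((fun y : 𝔼 => ENNReal.ofReal (g (Real.exp s • y)))
        * fun y : 𝔼 => ∫⁻ r in Set.Ioi ‖y‖, ENNReal.ofReal (w r)) y := by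
    refine lintegral_congr_ae ?_
    have h2 : ∀ᵐ y : 𝔼, y ≠ 0 := Measure.ae_ne volume 0
    filter_upwards [h2] with y hy
    rw [Pi.mul_apply, hG _ (norm_pos_iff.2 hy), ENNReal.ofReal_mul (h0 _)]
  rw [e1, h1]
  refine setLIntegral_congr_fun measurableSet_Ioi fun r hr => ?_
  have hr' : 0 < r := hr
  rw [ENNReal.ofReal_mul (hw0 r hr'), ← setIntegral_ball_eq_ballMean g s hr',
    withDensity_apply _ measurableSet_ball, ofReal_integral_eq_lintegral_ofReal
      (integrableOn_ball hcont r) (ae_of_all _ fun _ => h0 _)]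

theorem measurable_radial_ballMean {g : 𝔼 → ℝ} (hg : Continuous g) {w : ℝ → ℝ} (hw : Measurable w)
    (s : ℝ) : Measurable fun r => w r * (r ^ n * ballMean g (s + Real.log r)) :=
  hw.mul ((measurable_id.pow_const n).mul
    ((continuous_ballMean hg).measurable.comp (measurable_const.add Real.measurable_log)))

theorem integral_mul_radial (hn : 0 < n) {g : 𝔼 → ℝ} (hg : Continuous g) (h0 : ∀ x, 0 ≤ g x)
    {w G : ℝ → ℝ} (hw : Measurable w) (hw0 : ∀ r, 0 < r → 0 ≤ w r) (hGm : Measurable G)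
    (hG0 : ∀ r, 0 ≤ r → 0 ≤ G r)
    (hG : ∀ r, 0 < r → ∫⁻ t in Set.Ioi r, ENNReal.ofReal (w t) = ENNReal.ofReal (G r)) (s : ℝ) :
    ∫ y : 𝔼, g (Real.exp s • y) * G ‖y‖
      = ∫ r in Set.Ioi 0, w r * (r ^ n * ballMean g (s + Real.log r)) := by
  have hcont : Continuous fun y : 𝔼 => g (Real.exp s • y) := by fun_prop
  rw [integral_eq_lintegral_of_nonneg_ae, integral_eq_lintegral_of_nonneg_ae,
    lintegral_mul_radial hn hg h0 hw hw0 hG]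
  · refine (ae_restrict_iff' measurableSet_Ioi).2 (ae_of_all _ fun r hr => ?_)
    have hr' : 0 < r := hr
    exact mul_nonneg (hw0 r hr') (mul_nonneg (by positivity) (ballMean_nonneg h0 _))
  · exact (measurable_radial_ballMean hg hw s).aestronglyMeasurable
  · exact ae_of_all _ fun y => mul_nonneg (h0 _) (hG0 _ (norm_nonneg y))
  · exact (hcont.measurable.mul (hGm.comp measurable_norm)).aestronglyMeasurable

theorem integrable_mul_radial (hn : 0 < n) {g : 𝔼 → ℝ} (hg : Continuous g) (h0 : ∀ x, 0 ≤ g x)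
    {w G : ℝ → ℝ} (hw : Measurable w) (hw0 : ∀ r, 0 < r → 0 ≤ w r) (hGm : Measurable G)
    (hG0 : ∀ r, 0 ≤ r → 0 ≤ G r)
    (hG : ∀ r, 0 < r → ∫⁻ t in Set.Ioi r, ENNReal.ofReal (w t) = ENNReal.ofReal (G r)) (s : ℝ)
    (hi : IntegrableOn (fun r => w r * (r ^ n * ballMean g (s + Real.log r))) (Set.Ioi 0)) :
    Integrable fun y : 𝔼 => g (Real.exp s • y) * G ‖y‖ := by
  have hcont : Continuous fun y : 𝔼 => g (Real.exp s • y) := by fun_prop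
  rw [← lintegral_ofReal_ne_top_iff_integrable, lintegral_mul_radial hn hg h0 hw hw0 hG]
  · exact hi.lintegral_lt_top.ne
  · exact (hcont.measurable.mul (hGm.comp measurable_norm)).aestronglyMeasurable
  · exact ae_of_all _ fun y => mul_nonneg (h0 _) (hG0 _ (norm_nonneg y))

end BallMean

section BallMeanDeriv

open Filter Topology ProbabilityTheory

variable {n : ℕ}

local notation "𝔼" => EuclideanSpace ℝ (Fin n)

theorem ballMean_const_mul (c : ℝ) (g : 𝔼 → ℝ) (s : ℝ) :
    ballMean (fun x => c * g x) s = c * ballMean g s :=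
  integral_const_mul _ _

theorem integrableOn_ball_comp_smul {g : 𝔼 → ℝ} (hg : Continuous g) (c ρ : ℝ) :
    IntegrableOn (fun y => g (c • y)) (ball (0 : 𝔼) ρ) :=
  integrableOn_ball (by fun_prop) ρ

theorem ballMean_add {f g : 𝔼 → ℝ} (hf : Continuous f) (hg : Continuous g) (s : ℝ) :
    ballMean (fun x => f x + g x) s = ballMean f s + ballMean g s :=
  integral_add (integrableOn_ball_comp_smul hf _ _) (integrableOn_ball_comp_smul hg _ _)

theorem ballMean_mono {f g : 𝔼 → ℝ} (hf : Continuous f) (hg : Continuous g) (h : ∀ x, f x ≤ g x)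
    (s : ℝ) : ballMean f s ≤ ballMean g s :=
  integral_mono (integrableOn_ball_comp_smul hf _ _) (integrableOn_ball_comp_smul hg _ _)
    fun _ => h _

theorem hasDerivAt_ballMean {g : 𝔼 → ℝ} (hg : ContDiff ℝ 1 g) (s : ℝ) :
    HasDerivAt (ballMean g) (ballMean (fun x => fderiv ℝ g x x) s) s := by
  have hD : Continuous fun x => fderiv ℝ g x x :=
    (hg.continuous_fderiv (by norm_num)).clm_apply continuous_id
  obtain ⟨C, hC⟩ := (isCompact_closedBall (0 : 𝔼) (Real.exp (s + 1))).exists_bound_of_continuousOn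
    hD.continuousOn
  refine (hasDerivAt_integral_of_dominated_loc_of_deriv_le (bound := fun _ => C)
    (F := fun t y => g (Real.exp t • y))
    (F' := fun t y => fderiv ℝ g (Real.exp t • y) (Real.exp t • y))
    (Iio_mem_nhds (show s < s + 1 by linarith)) ?_ ?_ ?_ ?_ ?_ ?_).2
  · exact Eventually.of_forall fun t =>
      (integrableOn_ball_comp_smul hg.continuous _ _).aestronglyMeasurable
  · exact integrableOn_ball_comp_smul hg.continuous _ _
  · exact (integrableOn_ball_comp_smul hD _ _).aestronglyMeasurable
  · refine (ae_restrict_iff' measurableSet_ball).2 (ae_of_all _ fun y hy t ht => hC _ ?_)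
    rw [mem_ball_zero_iff] at hy
    rw [mem_closedBall_zero_iff, norm_smul, Real.norm_of_nonneg (Real.exp_pos _).le]
    have := Real.exp_le_exp.2 (Set.mem_Iio.1 ht).le
    nlinarith [Real.exp_pos t, norm_nonneg y]
  · exact integrableOn_const measure_ball_lt_top.ne
  · refine ae_of_all _ fun y t _ => ?_
    exact ((hg.differentiable (by norm_num)) _).hasFDerivAt.comp_hasDerivAt t
      ((Real.hasDerivAt_exp t).smul_const y)

theorem GaussInt.ballMean_le {g : 𝔼 → ℝ} (hgc : Continuous g) (hg : GaussInt g)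
    (h0 : ∀ x, 0 ≤ g x) (s : ℝ) :
    ballMean g s ≤ (2 * Real.pi) ^ ((n : ℝ) / 2) * Real.exp (1 / 2) * gaussMean g s := by
  have hi := hg.integrable_comp_exp_smul s
  have hi2 := hi
  rw [integrable_stdGaussian_iff] at hi2
  have hc : (0 : ℝ) ≤ (2 * Real.pi) ^ ((n : ℝ) / 2) * Real.exp (1 / 2) := by positivity
  unfold gaussMean ballMean
  rw [integral_stdGaussian, ← integral_const_mul]
  have h1 : ∀ y ∈ ball (0 : 𝔼) 1, g (Real.exp s • y)
      ≤ (2 * Real.pi) ^ ((n : ℝ) / 2) * Real.exp (1 / 2) * (gaussDens y • g (Real.exp s • y)) := by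
    intro y hy
    rw [mem_ball_zero_iff] at hy
    have e : (2 * Real.pi) ^ ((n : ℝ) / 2) * Real.exp (1 / 2) * gaussDens y
        = Real.exp (1 / 2 - ‖y‖ ^ 2 / 2) := by
      unfold gaussDens
      rw [finrank_euclideanSpace_fin]
      have e1 : (2 * Real.pi) ^ ((n : ℝ) / 2) * (2 * Real.pi) ^ (-(n : ℝ) / 2) = 1 := by
        rw [← Real.rpow_add (by positivity)]
        simp [neg_div]
      calc _ = ((2 * Real.pi) ^ ((n : ℝ) / 2) * (2 * Real.pi) ^ (-(n : ℝ) / 2))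
          * (Real.exp (1 / 2) * Real.exp (-‖y‖ ^ 2 / 2)) := by ring
        _ = _ := by rw [e1, one_mul, ← Real.exp_add]; ring_nf
    rw [smul_eq_mul, ← mul_assoc, e]
    refine le_mul_of_one_le_left (h0 _) (Real.one_le_exp ?_)
    nlinarith [norm_nonneg y]
  calc _ ≤ ∫ y in ball (0 : 𝔼) 1, (2 * Real.pi) ^ ((n : ℝ) / 2) * Real.exp (1 / 2)
        * (gaussDens y • g (Real.exp s • y)) :=
        setIntegral_mono_on (integrableOn_ball_comp_smul hgc _ _)
          (hi2.const_mul _).integrableOn measurableSet_ball h1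
    _ ≤ _ := setIntegral_le_integral (hi2.const_mul _) (ae_of_all _ fun y =>
        mul_nonneg hc (mul_nonneg (gaussDens_pos _).le (h0 _)))

theorem tendsto_sub_of_hasDerivAt {f f' : ℝ → ℝ} (hf : ∀ t, HasDerivAt f (f' t) t)
    (h : Tendsto f' atTop (𝓝 0)) (σ : ℝ) :
    Tendsto (fun s => f (s + σ) - f s) atTop (𝓝 0) := by
  rw [Metric.tendsto_atTop] at h ⊢
  intro ε hε
  obtain ⟨N, hN⟩ := h (ε / (2 * (|σ| + 1))) (by positivity)
  refine ⟨N + |σ|, fun s hs => ?_⟩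
  have hσ := neg_abs_le σ
  have hσ0 := abs_nonneg σ
  have h1 := (convex_Ici N).norm_image_sub_le_of_norm_hasDerivWithin_le (f := f) (f' := f')
    (C := ε / (2 * (|σ| + 1))) (fun x _ => (hf x).hasDerivWithinAt)
    (fun x hx => by simpa using (hN x hx).le)
    (show s ∈ Set.Ici N by simp; linarith) (show s + σ ∈ Set.Ici N by simp; linarith)
  rw [dist_zero_right]
  refine h1.trans_lt ?_
  rw [add_sub_cancel_left, Real.norm_eq_abs, div_mul_eq_mul_div, div_lt_iff₀ (by positivity)]
  nlinarith

end BallMeanDeriv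

section BallHeight

open Filter Topology ProbabilityTheory

variable {n : ℕ}

local notation "𝔼" => EuclideanSpace ℝ (Fin n)

/-- The scale-invariant unweighted height over the ball of radius `e ^ s`. -/
def ballHeight (u : 𝔼 → ℝ) (s : ℝ) : ℝ := Real.exp (-2 * s) * ballMean (fun x => u x ^ 2) s

/-- Half of the derivative of `ballHeight`. -/
def ballFlux (u : 𝔼 → ℝ) (s : ℝ) : ℝ :=
  Real.exp (-2 * s) * ballMean (fun x => u x * (fderiv ℝ u x x - u x)) s

theorem ballHeight_nonneg (u : 𝔼 → ℝ) (s : ℝ) : 0 ≤ ballHeight u s :=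
  mul_nonneg (Real.exp_pos _).le (ballMean_nonneg (fun _ => sq_nonneg _) _)

namespace IsLinearSolution

variable {u v : EuclideanSpace ℝ (Fin n) → ℝ}

theorem continuous_left (h : IsLinearSolution u v) : Continuous u := h.contDiff_left.continuous

theorem continuous_sq_left (h : IsLinearSolution u v) : Continuous fun x => u x ^ 2 :=
  h.continuous_left.pow 2

theorem continuous_ballHeight (h : IsLinearSolution u v) : Continuous (ballHeight u) :=
  (by fun_prop : Continuous fun s : ℝ => Real.exp (-2 * s)).mul
    (continuous_ballMean h.continuous_sq_left)

theorem exists_ballHeight_le (h : IsLinearSolution u v) :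
    ∃ K > 0, ∀ s, ballHeight u s ≤ K * (Real.exp (-2 * s) + 1) := by
  obtain ⟨K, hK, hb⟩ := h.exists_height_le
  refine ⟨(2 * Real.pi) ^ ((n : ℝ) / 2) * Real.exp (1 / 2) * K, by positivity, fun s => ?_⟩
  have h1 := h.gaussInt_sq.ballMean_le h.continuous_sq_left (fun _ => sq_nonneg _) s
  have hc : (0 : ℝ) ≤ (2 * Real.pi) ^ ((n : ℝ) / 2) * Real.exp (1 / 2) := by positivity
  calc _ ≤ Real.exp (-2 * s) * _ := mul_le_mul_of_nonneg_left h1 (Real.exp_pos _).le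
    _ = (2 * Real.pi) ^ ((n : ℝ) / 2) * Real.exp (1 / 2) * height u s := by
      unfold height; ring
    _ ≤ (2 * Real.pi) ^ ((n : ℝ) / 2) * Real.exp (1 / 2) * (K * (Real.exp (-2 * s) + 1)) :=
      mul_le_mul_of_nonneg_left (hb s) hc
    _ = _ := by ring

theorem hasDerivAt_ballHeight (h : IsLinearSolution u v) (s : ℝ) :
    HasDerivAt (ballHeight u) (2 * ballFlux u s) s := by
  have hu1 : ContDiff ℝ 1 u := h.contDiff_left.of_le (by norm_num)
  have h1 := (hasDerivAt_exp_neg_two_mul s).mul (hasDerivAt_ballMean (hu1.pow 2) s)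
  refine h1.congr_deriv ?_
  have hur : Continuous fun x => u x * fderiv ℝ u x x := h.continuous_left.mul h.continuous_radial
  have e1 : ballMean (fun x => fderiv ℝ (fun x => u x ^ 2) x x) s
      = 2 * ballMean (fun x => u x * fderiv ℝ u x x) s := by
    rw [← ballMean_const_mul]
    congr 1
    ext x
    have := ((hu1.differentiable (by norm_num) x).hasFDerivAt.pow 2).fderiv
    rw [this]
    simp
    ring
  have e2 : ballMean (fun x => u x * (fderiv ℝ u x x - u x)) s
      = ballMean (fun x => u x * fderiv ℝ u x x) s + (-1) * ballMean (fun x => u x ^ 2) s := by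
    rw [← ballMean_const_mul, ← ballMean_add hur (h.continuous_sq_left.const_mul _)]
    congr 1
    ext x
    ring
  rw [e1, ballFlux, e2]
  ring

theorem tendsto_ballFlux (h : IsLinearSolution u v) : Tendsto (ballFlux u) atTop (𝓝 0) := by
  obtain ⟨K, hK, hb⟩ := h.exists_ballHeight_le
  set c : ℝ := (2 * Real.pi) ^ ((n : ℝ) / 2) * Real.exp (1 / 2) with hc
  have hc0 : 0 < c := by positivity
  have hd : Continuous fun x => fderiv ℝ u x x - u x := h.continuous_radial.sub h.continuous_left
  have hd2 : Continuous fun x => (fderiv ℝ u x x - u x) ^ 2 := hd.pow 2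
  have hud : Continuous fun x => u x * (fderiv ℝ u x x - u x) := h.continuous_left.mul hd
  have key : ∀ ε > 0, ∀ s, 0 ≤ s → |ballFlux u s| ≤ ε * (2 * K) + ε⁻¹ * (c * defect u s) := by
    intro ε hε s hs
    have hS := hb s
    have hexp : Real.exp (-2 * s) ≤ 1 := Real.exp_le_one_iff.2 (by linarith)
    have h1 : ∀ x, |u x * (fderiv ℝ u x x - u x)|
        ≤ ε * u x ^ 2 + ε⁻¹ * (fderiv ℝ u x x - u x) ^ 2 := fun x => by
      have h2 : |u x * (fderiv ℝ u x x - u x)| = (|u x| * ε) * |fderiv ℝ u x x - u x| * ε⁻¹ := by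
        rw [abs_mul]; field_simp
      have h3 : ε * u x ^ 2 + ε⁻¹ * (fderiv ℝ u x x - u x) ^ 2
          = ((|u x| * ε) ^ 2 + |fderiv ℝ u x x - u x| ^ 2) * ε⁻¹ := by
        rw [mul_pow, sq_abs, sq_abs]; field_simp
      rw [h2, h3]
      refine mul_le_mul_of_nonneg_right ?_ (by positivity)
      nlinarith [sq_nonneg (|u x| * ε - |fderiv ℝ u x x - u x|), sq_nonneg (|u x| * ε),
        sq_nonneg |fderiv ℝ u x x - u x|]
    have h4 : |ballMean (fun x => u x * (fderiv ℝ u x x - u x)) s|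
        ≤ ε * ballMean (fun x => u x ^ 2) s
          + ε⁻¹ * ballMean (fun x => (fderiv ℝ u x x - u x) ^ 2) s := by
      rw [← ballMean_const_mul, ← ballMean_const_mul,
        ← ballMean_add (h.continuous_sq_left.const_mul _) (hd2.const_mul _)]
      refine (abs_integral_le_integral_abs).trans ?_
      exact ballMean_mono (f := fun x => |u x * (fderiv ℝ u x x - u x)|) hud.abs
        ((h.continuous_sq_left.const_mul _).add (hd2.const_mul _)) h1 s
    have h5 := h.gaussInt_defect.ballMean_le hd2 (fun _ => sq_nonneg _) s
    have hE := Real.exp_pos (-2 * s)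
    calc |ballFlux u s| = Real.exp (-2 * s) * |ballMean (fun x => u x * (fderiv ℝ u x x - u x)) s| := by
          rw [ballFlux, abs_mul, abs_of_pos hE]
      _ ≤ Real.exp (-2 * s) * (ε * ballMean (fun x => u x ^ 2) s
          + ε⁻¹ * (c * gaussMean (fun x => (fderiv ℝ u x x - u x) ^ 2) s)) := by
          refine mul_le_mul_of_nonneg_left (h4.trans ?_) hE.le
          have := mul_le_mul_of_nonneg_left h5 (inv_pos.2 hε).le
          linarith
      _ = ε * ballHeight u s + ε⁻¹ * (c * defect u s) := by
          unfold ballHeight defect; ring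
      _ ≤ _ := by
          have : ε * ballHeight u s ≤ ε * (2 * K) :=
            mul_le_mul_of_nonneg_left (hS.trans (by nlinarith)) hε.le
          linarith
  rw [Metric.tendsto_atTop]
  intro δ hδ
  set ε := δ / (8 * K) with hε
  have hε0 : 0 < ε := by positivity
  have h6 : Tendsto (fun s => ε⁻¹ * (c * defect u s)) atTop (𝓝 0) := by
    simpa using (h.tendsto_defect.const_mul c).const_mul ε⁻¹
  obtain ⟨N, hN⟩ := eventually_atTop.1 (h6.eventually (gt_mem_nhds (half_pos hδ)))
  refine ⟨max N 0, fun s hs => ?_⟩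
  have h7 := key ε hε0 s ((le_max_right _ _).trans hs)
  have h8 := hN s ((le_max_left _ _).trans hs)
  have h9 : ε * (2 * K) = δ / 4 := by rw [hε]; field_simp; norm_num
  rw [Real.dist_eq, sub_zero]
  linarith

theorem tendsto_ballHeight_sub (h : IsLinearSolution u v) (σ : ℝ) :
    Tendsto (fun s => ballHeight u (s + σ) - ballHeight u s) atTop (𝓝 0) :=
  tendsto_sub_of_hasDerivAt h.hasDerivAt_ballHeight (by simpa using h.tendsto_ballFlux.const_mul 2) σ

end IsLinearSolution

end BallHeight

section HeightComparison

open Filter Topology ProbabilityTheory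

variable {n : ℕ}

local notation "𝔼" => EuclideanSpace ℝ (Fin n)

theorem integrableOn_pow_mul_exp (k : ℕ) :
    IntegrableOn (fun r : ℝ => r ^ k * Real.exp (-r ^ 2 / 2)) (Set.Ioi 0) := by
  have h := integrableOn_rpow_mul_exp_neg_mul_sq (b := 1 / 2) (by norm_num) (s := (k : ℝ))
    (by have : (0 : ℝ) ≤ k := Nat.cast_nonneg k; linarith)
  refine h.congr_fun (fun r _ => ?_) measurableSet_Ioi
  simp only [Real.rpow_natCast]
  ring_nf

theorem integral_pow_mul_exp_pos (k : ℕ) :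
    0 < ∫ r in Set.Ioi (0 : ℝ), r ^ k * Real.exp (-r ^ 2 / 2) := by
  refine (setIntegral_pos_iff_support_of_nonneg_ae ?_ (integrableOn_pow_mul_exp k)).2 ?_
  · refine (ae_restrict_iff' measurableSet_Ioi).2 (ae_of_all _ fun r hr => ?_)
    have : (0 : ℝ) < r := hr
    simp only [Pi.zero_apply]
    positivity
  · have : Set.Ioi (0 : ℝ) ⊆ Function.support fun r : ℝ => r ^ k * Real.exp (-r ^ 2 / 2) :=
      fun r hr => by
        have : (0 : ℝ) < r := hr
        rw [Function.mem_support]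
        positivity
    rw [Set.inter_eq_right.2 this]
    simp

theorem lintegral_Ioi_mul_exp (r : ℝ) (hr : 0 < r) :
    ∫⁻ t in Set.Ioi r, ENNReal.ofReal (t * Real.exp (-t ^ 2 / 2))
      = ENNReal.ofReal (Real.exp (-r ^ 2 / 2)) := by
  have hd : ∀ t ∈ Set.Ici r, HasDerivAt (fun t : ℝ => -Real.exp (-t ^ 2 / 2))
      (t * Real.exp (-t ^ 2 / 2)) t := fun t _ => by
    refine ((((hasDerivAt_id t).pow 2).neg.div_const 2).exp.neg).congr_deriv ?_
    simp
    ring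
  have h0 : ∀ t ∈ Set.Ioi r, 0 ≤ t * Real.exp (-t ^ 2 / 2) := fun t ht => by
    have : r < t := ht
    have := hr.trans this
    positivity
  have ht : Tendsto (fun t : ℝ => -Real.exp (-t ^ 2 / 2)) atTop (𝓝 0) := by
    rw [← neg_zero]
    refine (Real.tendsto_exp_atBot.comp ?_).neg
    simp_rw [neg_div]
    exact tendsto_neg_atTop_atBot.comp
      ((tendsto_pow_atTop two_ne_zero).atTop_div_const (by norm_num))
  have h1 := integral_Ioi_of_hasDerivAt_of_nonneg' hd h0 ht
  have h2 := integrableOn_Ioi_deriv_of_nonneg' hd h0 ht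
  rw [← ofReal_integral_eq_lintegral_ofReal h2
    ((ae_restrict_iff' measurableSet_Ioi).2 (ae_of_all _ h0)), h1]
  simp

theorem ballMean_sq_eq (u : 𝔼 → ℝ) (s : ℝ) :
    ballMean (fun x => u x ^ 2) s = Real.exp (2 * s) * ballHeight u s := by
  unfold ballHeight
  rw [← mul_assoc, ← Real.exp_add]
  simp

namespace IsLinearSolution

variable {u v : EuclideanSpace ℝ (Fin n) → ℝ}

theorem height_eq_integral (hn : 0 < n) (h : IsLinearSolution u v) (s : ℝ) :
    (2 * Real.pi) ^ ((n : ℝ) / 2) * height u s = ∫ r in Set.Ioi (0 : ℝ),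
      r ^ (n + 3) * Real.exp (-r ^ 2 / 2) * ballHeight u (s + Real.log r) := by
  have h1 := integral_mul_radial hn h.continuous_sq_left (fun _ => sq_nonneg _)
    (w := fun r => r * Real.exp (-r ^ 2 / 2)) (G := fun r => Real.exp (-r ^ 2 / 2))
    (by fun_prop) (fun r hr => by positivity) (by fun_prop) (fun r _ => (Real.exp_pos _).le)
    lintegral_Ioi_mul_exp s
  have e1 : (2 * Real.pi) ^ ((n : ℝ) / 2) * gaussMean (fun x => u x ^ 2) s
      = ∫ y : 𝔼, u (Real.exp s • y) ^ 2 * Real.exp (-‖y‖ ^ 2 / 2) := by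
    unfold gaussMean
    rw [integral_stdGaussian, ← integral_const_mul]
    refine integral_congr_ae (ae_of_all _ fun y => ?_)
    have e1 : (2 * Real.pi) ^ ((n : ℝ) / 2) * (2 * Real.pi) ^ (-(n : ℝ) / 2) = 1 := by
      rw [← Real.rpow_add (by positivity)]
      simp [neg_div]
    simp only [gaussDens, smul_eq_mul]
    rw [finrank_euclideanSpace_fin, ← mul_assoc, ← mul_assoc, e1, one_mul, mul_comm]
  have e2 : (2 * Real.pi) ^ ((n : ℝ) / 2) * height u s = Real.exp (-2 * s)
      * ((2 * Real.pi) ^ ((n : ℝ) / 2) * gaussMean (fun x => u x ^ 2) s) := by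
    unfold height; ring
  rw [e2, e1, h1, ← integral_const_mul]
  refine setIntegral_congr_fun measurableSet_Ioi fun r hr => ?_
  have hr' : (0 : ℝ) < r := hr
  have e3 : Real.exp (2 * (s + Real.log r)) = Real.exp (2 * s) * r ^ 2 := by
    rw [mul_add, Real.exp_add, two_mul (Real.log r), Real.exp_add, Real.exp_log hr', sq]
  have e4 := exp_neg_mul_exp_two_mul s
  rw [ballMean_sq_eq, e3]
  calc _ = (Real.exp (-2 * s) * Real.exp (2 * s)) * (r ^ (n + 3) * Real.exp (-r ^ 2 / 2)
      * ballHeight u (s + Real.log r)) := by ring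
    _ = _ := by rw [e4, one_mul]

theorem tendsto_height_sub_ballHeight (hn : 0 < n) (h : IsLinearSolution u v) :
    Tendsto (fun s => (2 * Real.pi) ^ ((n : ℝ) / 2) * height u s
      - (∫ r in Set.Ioi (0 : ℝ), r ^ (n + 3) * Real.exp (-r ^ 2 / 2)) * ballHeight u s)
      atTop (𝓝 0) := by
  obtain ⟨K, hK, hb⟩ := h.exists_ballHeight_le
  have hm : ∀ s, Measurable fun r : ℝ => r ^ (n + 3) * Real.exp (-r ^ 2 / 2)
      * ballHeight u (s + Real.log r) := fun s =>
    Measurable.mul (by fun_prop)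
      (h.continuous_ballHeight.measurable.comp (measurable_const.add Real.measurable_log))
  have hlow : ∀ s r : ℝ, 0 ≤ s → 0 < r → r ^ (n + 3) * Real.exp (-r ^ 2 / 2)
      * ballHeight u (s + Real.log r) ≤ K * (r ^ (n + 1) * Real.exp (-r ^ 2 / 2))
        + K * (r ^ (n + 3) * Real.exp (-r ^ 2 / 2)) := by
    intro s r hs hr
    have h1 := hb (s + Real.log r)
    have e : Real.exp (-2 * (s + Real.log r)) = Real.exp (-2 * s) * (r ^ 2)⁻¹ := by
      rw [mul_add, Real.exp_add, show -2 * Real.log r = -(Real.log r + Real.log r) by ring,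
        Real.exp_neg (_ + _), Real.exp_add, Real.exp_log hr, sq]
    have h2 : Real.exp (-2 * s) ≤ 1 := Real.exp_le_one_iff.2 (by linarith)
    have h3 : Real.exp (-2 * s) * (r ^ 2)⁻¹ ≤ (r ^ 2)⁻¹ :=
      mul_le_of_le_one_left (by positivity) h2
    have h4 : ballHeight u (s + Real.log r) ≤ K * ((r ^ 2)⁻¹ + 1) := by
      rw [e] at h1
      exact h1.trans (mul_le_mul_of_nonneg_left (by linarith) hK.le)
    calc _ ≤ r ^ (n + 3) * Real.exp (-r ^ 2 / 2) * (K * ((r ^ 2)⁻¹ + 1)) :=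
          mul_le_mul_of_nonneg_left h4 (by positivity)
      _ = _ := by
          have : r ^ (n + 3) = r ^ (n + 1) * r ^ 2 := by rw [← pow_add]
          rw [this]
          field_simp
  have hbi : IntegrableOn (fun r : ℝ => K * (r ^ (n + 1) * Real.exp (-r ^ 2 / 2))
      + K * (r ^ (n + 3) * Real.exp (-r ^ 2 / 2))) (Set.Ioi 0) :=
    ((integrableOn_pow_mul_exp _).const_mul K).add ((integrableOn_pow_mul_exp _).const_mul K)
  have hintegr : ∀ s, 0 ≤ s → IntegrableOn (fun r : ℝ => r ^ (n + 3) * Real.exp (-r ^ 2 / 2)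
      * ballHeight u (s + Real.log r)) (Set.Ioi 0) := fun s hs => by
    refine Integrable.mono' hbi (hm s).aestronglyMeasurable ?_
    refine (ae_restrict_iff' measurableSet_Ioi).2 (ae_of_all _ fun r hr => ?_)
    have hr' : (0 : ℝ) < r := hr
    rw [Real.norm_of_nonneg (mul_nonneg (by positivity) (ballHeight_nonneg _ _))]
    exact hlow s r hs hr'
  have key : Tendsto (fun s => ∫ r in Set.Ioi (0 : ℝ), r ^ (n + 3) * Real.exp (-r ^ 2 / 2)
      * (ballHeight u (s + Real.log r) - ballHeight u s)) atTop
      (𝓝 (∫ r in Set.Ioi (0 : ℝ), (0 : ℝ))) := by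
    refine tendsto_integral_filter_of_dominated_convergence
      (fun r : ℝ => (K * (r ^ (n + 1) * Real.exp (-r ^ 2 / 2))
      + K * (r ^ (n + 3) * Real.exp (-r ^ 2 / 2)))
      + (2 * K) * (r ^ (n + 3) * Real.exp (-r ^ 2 / 2))) ?_ ?_ ?_ ?_
    · refine Eventually.of_forall fun s => Measurable.aestronglyMeasurable ?_
      exact Measurable.mul (by fun_prop) ((h.continuous_ballHeight.measurable.comp
        (measurable_const.add Real.measurable_log)).sub measurable_const)
    · filter_upwards [eventually_ge_atTop 0] with s hs
      refine (ae_restrict_iff' measurableSet_Ioi).2 (ae_of_all _ fun r hr => ?_)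
      have hr' : (0 : ℝ) < r := hr
      have h1 := hlow s r hs hr'
      have h2 : ballHeight u s ≤ 2 * K := by
        have := hb s
        have : Real.exp (-2 * s) ≤ 1 := Real.exp_le_one_iff.2 (by linarith)
        nlinarith
      have hP : 0 ≤ r ^ (n + 3) * Real.exp (-r ^ 2 / 2) := by positivity
      have h3 := mul_nonneg hP (ballHeight_nonneg u (s + Real.log r))
      have h4 := mul_nonneg hP (ballHeight_nonneg u s)
      have h5 := mul_le_mul_of_nonneg_left h2 hP
      have h6 : 0 ≤ K * (r ^ (n + 1) * Real.exp (-r ^ 2 / 2)) := by positivity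
      rw [Real.norm_eq_abs, abs_le]
      constructor <;> nlinarith
    · exact hbi.add ((integrableOn_pow_mul_exp _).const_mul _)
    · refine ae_of_all _ fun r => ?_
      simpa using (h.tendsto_ballHeight_sub (Real.log r)).const_mul
        (r ^ (n + 3) * Real.exp (-r ^ 2 / 2))
  rw [integral_zero] at key
  refine key.congr' ?_
  filter_upwards [eventually_ge_atTop 0] with s hs
  rw [h.height_eq_integral hn, ← integral_mul_const,
    ← integral_sub (hintegr s hs) ((integrableOn_pow_mul_exp _).mul_const _)]
  refine integral_congr_ae (ae_of_all _ fun r => ?_)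
  simp only
  ring

end IsLinearSolution

end HeightComparison

section RadialEnergy

open Filter Topology

theorem hasDerivAt_max_zero_sq (p : ℝ) :
    HasDerivAt (fun x : ℝ => (max x 0) ^ 2) (2 * max p 0) p := by
  have hc : Continuous fun x : ℝ => max x 0 := by fun_prop
  by_cases hp : p = 0
  · subst hp
    refine hasDerivAt_of_hasDerivAt_of_ne (g := fun x => 2 * max x 0) (fun y hy => ?_)
      (by fun_prop) (by fun_prop)
    rcases lt_or_gt_of_ne hy with h | h
    · rw [max_eq_right h.le, mul_zero]
      refine (hasDerivAt_const y (0 : ℝ)).congr_of_eventuallyEq ?_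
      filter_upwards [Iio_mem_nhds h] with x hx
      rw [max_eq_right (le_of_lt hx)]
      norm_num
    · rw [max_eq_left h.le]
      refine (((hasDerivAt_id y).pow 2).congr_deriv (by simp)).congr_of_eventuallyEq ?_
      filter_upwards [Ioi_mem_nhds h] with x hx
      rw [max_eq_left (le_of_lt hx)]
      rfl
  · rcases lt_or_gt_of_ne hp with h | h
    · rw [max_eq_right h.le, mul_zero]
      refine (hasDerivAt_const p (0 : ℝ)).congr_of_eventuallyEq ?_
      filter_upwards [Iio_mem_nhds h] with x hx
      rw [max_eq_right (le_of_lt hx)]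
      norm_num
    · rw [max_eq_left h.le]
      refine (((hasDerivAt_id p).pow 2).congr_deriv (by simp)).congr_of_eventuallyEq ?_
      filter_upwards [Ioi_mem_nhds h] with x hx
      rw [max_eq_left (le_of_lt hx)]
      rfl

/-- A `C¹` approximation of `t ↦ max (c - t) 0`. -/
def rampApprox (c δ t : ℝ) : ℝ := ((max (c - t) 0) ^ 2 - (max (c - t - δ) 0) ^ 2) / (2 * δ)

/-- The derivative of `rampApprox`. -/
def rampApproxDeriv (c δ t : ℝ) : ℝ := -((max (c - t) 0 - max (c - t - δ) 0) / δ)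

theorem hasDerivAt_rampApprox (c δ t : ℝ) :
    HasDerivAt (rampApprox c δ) (rampApproxDeriv c δ t) t := by
  have h1 := (hasDerivAt_max_zero_sq (c - t)).comp t ((hasDerivAt_id t).const_sub c)
  have h2 := (hasDerivAt_max_zero_sq (c - t - δ)).comp t
    (((hasDerivAt_id t).const_sub c).sub_const δ)
  refine ((h1.sub h2).div_const (2 * δ)).congr_deriv ?_
  unfold rampApproxDeriv
  rw [← neg_div, ← mul_div_mul_left _ δ two_ne_zero]
  ring

theorem contDiff_rampApprox (c δ : ℝ) : ContDiff ℝ 1 (rampApprox c δ) := by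
  rw [contDiff_one_iff_deriv]
  refine ⟨fun t => (hasDerivAt_rampApprox c δ t).differentiableAt, ?_⟩
  have : deriv (rampApprox c δ) = rampApproxDeriv c δ :=
    funext fun t => (hasDerivAt_rampApprox c δ t).deriv
  rw [this]
  unfold rampApproxDeriv
  fun_prop

theorem rampApprox_of_le {c δ t : ℝ} (hδ : 0 < δ) (ht : c ≤ t) :
    rampApprox c δ t = 0 ∧ rampApproxDeriv c δ t = 0 := by
  unfold rampApprox rampApproxDeriv
  rw [max_eq_right (by linarith), max_eq_right (by linarith)]
  simp

theorem abs_rampApprox_le {c δ t : ℝ} (hδ : 0 < δ) (ht : t ≤ c) :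
    |rampApprox c δ t| ≤ c - t ∧ |rampApproxDeriv c δ t| ≤ 1 := by
  unfold rampApprox rampApproxDeriv
  rw [max_eq_left (show 0 ≤ c - t by linarith)]
  set a := c - t
  have ha : 0 ≤ a := by simp only [a]; linarith
  have hb0 : 0 ≤ max (a - δ) 0 := le_max_right _ _
  have hb1 : max (a - δ) 0 ≤ a := max_le (by linarith) ha
  have hb2 : a - δ ≤ max (a - δ) 0 := le_max_left _ _
  set b := max (a - δ) 0
  constructor
  · rw [abs_of_nonneg (div_nonneg (by nlinarith) (by positivity)), div_le_iff₀ (by positivity)]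
    nlinarith [mul_nonneg (sub_nonneg.2 hb2) (add_nonneg ha hb0), mul_nonneg hδ.le (sub_nonneg.2 hb1),
      mul_nonneg (show 0 ≤ δ - (a - b) by linarith) (add_nonneg ha hb0)]
  · rw [abs_neg, abs_of_nonneg (div_nonneg (by linarith) hδ.le), div_le_one hδ]
    linarith

theorem tendsto_rampApprox {c t : ℝ} (ht : t < c) :
    Tendsto (fun δ => rampApprox c δ t) (𝓝[>] 0) (𝓝 (c - t)) ∧
      Tendsto (fun δ => rampApproxDeriv c δ t) (𝓝[>] 0) (𝓝 (-1)) := by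
  have hev : ∀ᶠ δ in 𝓝[>] (0 : ℝ), 0 < δ ∧ δ < c - t := by
    filter_upwards [Ioo_mem_nhdsGT (sub_pos.2 ht)] with δ hδ using hδ
  constructor
  · have h1 : Tendsto (fun δ : ℝ => (c - t) - δ / 2) (𝓝[>] 0) (𝓝 (c - t)) := by
      have : Continuous fun δ : ℝ => (c - t) - δ / 2 := by fun_prop
      simpa using (this.tendsto 0).mono_left nhdsWithin_le_nhds
    refine h1.congr' ?_
    filter_upwards [hev] with δ hδ
    unfold rampApprox
    rw [max_eq_left (by linarith), max_eq_left (by linarith [hδ.2])]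
    have := hδ.1.ne'
    field_simp
    ring
  · refine tendsto_const_nhds.congr' ?_
    filter_upwards [hev] with δ hδ
    unfold rampApproxDeriv
    rw [max_eq_left (by linarith), max_eq_left (by linarith [hδ.2])]
    have := hδ.1.ne'
    field_simp
    ring

variable {n : ℕ}

local notation "𝔼" => EuclideanSpace ℝ (Fin n)

/-- The energy density of the first component. -/
def energyDens (u v : 𝔼 → ℝ) (x : 𝔼) : ℝ := ‖gradient u x‖ ^ 2 + u x ^ 2 * v x ^ 2

theorem energyDens_nonneg (u v : 𝔼 → ℝ) (x : 𝔼) : 0 ≤ energyDens u v x := by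
  unfold energyDens; positivity

namespace IsLinearSolution

variable {u v : EuclideanSpace ℝ (Fin n) → ℝ}

theorem continuous_energyDens (h : IsLinearSolution u v) : Continuous (energyDens u v) := by
  have h1 := h.continuous_gradient
  have h2 := h.continuous_left
  have h3 := h.symm.continuous_left
  unfold energyDens
  fun_prop

/-- The integrated energy over balls is a boundary-free flux of `u`. -/
theorem integral_energyDens_mul (h : IsLinearSolution u v) {ρ : ℝ} (hρ : 0 < ρ) :
    ∫ x in ball (0 : 𝔼) ρ, energyDens u v x * (ρ ^ 2 - ‖x‖ ^ 2)
      = 2 * ∫ x in ball (0 : 𝔼) ρ, u x * fderiv ℝ u x x := by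
  have hu := h.continuous_left
  have hr := h.continuous_radial
  have he := h.continuous_energyDens
  have hur : Continuous fun x => u x * fderiv ℝ u x x := hu.mul hr
  set F : ℝ → 𝔼 → ℝ := fun δ x => energyDens u v x * rampApprox (ρ ^ 2) δ (‖x‖ ^ 2)
      + 2 * (u x * fderiv ℝ u x x) * rampApproxDeriv (ρ ^ 2) δ (‖x‖ ^ 2) with hF
  have h0 : ∀ δ, 0 < δ → ∫ x in ball (0 : 𝔼) ρ, F δ x = 0 := by
    intro δ hδ
    rw [setIntegral_eq_integral_of_forall_compl_eq_zero]
    · exact integral_radial_mul_gradient (contDiff_rampApprox (ρ ^ 2) δ)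
        (hasDerivAt_rampApprox (ρ ^ 2) δ) (R := ρ ^ 2) (fun t ht => (rampApprox_of_le hδ ht).1)
        h.contDiff_left h.lap_left
    · intro x hx
      rw [mem_ball_zero_iff, not_lt] at hx
      have h1 := rampApprox_of_le hδ (show ρ ^ 2 ≤ ‖x‖ ^ 2 by gcongr)
      simp [hF, h1.1, h1.2]
  have hlim : Tendsto (fun δ => ∫ x in ball (0 : 𝔼) ρ, F δ x) (𝓝[>] 0)
      (𝓝 (∫ x in ball (0 : 𝔼) ρ, (energyDens u v x * (ρ ^ 2 - ‖x‖ ^ 2)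
        + 2 * (u x * fderiv ℝ u x x) * (-1)))) := by
    refine tendsto_integral_filter_of_dominated_convergence
      (fun x => energyDens u v x * ρ ^ 2 + 2 * |u x * fderiv ℝ u x x|) ?_ ?_ ?_ ?_
    · refine Eventually.of_forall fun δ => Continuous.aestronglyMeasurable ?_
      simp only [hF]
      unfold rampApprox rampApproxDeriv
      fun_prop
    · filter_upwards [self_mem_nhdsWithin] with δ hδ
      refine (ae_restrict_iff' measurableSet_ball).2 (ae_of_all _ fun x hx => ?_)
      rw [mem_ball_zero_iff] at hx
      have h1 := abs_rampApprox_le (c := ρ ^ 2) (t := ‖x‖ ^ 2) hδ (by gcongr)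
      have h2 := energyDens_nonneg u v x
      simp only [hF, Real.norm_eq_abs]
      refine (abs_add_le _ _).trans (add_le_add ?_ ?_)
      · rw [abs_mul, abs_of_nonneg h2]
        exact mul_le_mul_of_nonneg_left (h1.1.trans (by nlinarith [norm_nonneg x])) h2
      · rw [abs_mul, abs_mul, abs_of_pos (two_pos : (0 : ℝ) < 2)]
        exact mul_le_of_le_one_right (by positivity) h1.2
    · exact integrableOn_ball (by fun_prop) ρ
    · refine (ae_restrict_iff' measurableSet_ball).2 (ae_of_all _ fun x hx => ?_)
      rw [mem_ball_zero_iff] at hx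
      have h1 := tendsto_rampApprox (c := ρ ^ 2) (t := ‖x‖ ^ 2) (by gcongr)
      exact (h1.1.const_mul _).add (h1.2.const_mul _)
  have hlim0 : Tendsto (fun δ => ∫ x in ball (0 : 𝔼) ρ, F δ x) (𝓝[>] 0) (𝓝 0) := by
    refine tendsto_const_nhds.congr' ?_
    filter_upwards [self_mem_nhdsWithin] with δ hδ
    exact (h0 δ hδ).symm
  have h1 := tendsto_nhds_unique hlim hlim0
  have i1 : IntegrableOn (fun x => energyDens u v x * (ρ ^ 2 - ‖x‖ ^ 2)) (ball (0 : 𝔼) ρ) :=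
    integrableOn_ball (by fun_prop) ρ
  have i2 : IntegrableOn (fun x => 2 * (u x * fderiv ℝ u x x) * (-1)) (ball (0 : 𝔼) ρ) :=
    integrableOn_ball (by fun_prop) ρ
  rw [integral_add i1 i2, integral_mul_const, integral_const_mul] at h1
  linarith

/-- Twice the sum of `ballHeight` and `ballFlux` is the normalised integrated energy. -/
theorem integral_energyDens_mul_exp (h : IsLinearSolution u v) (s : ℝ) :
    ∫ x in ball (0 : 𝔼) (Real.exp s), energyDens u v x * (Real.exp s ^ 2 - ‖x‖ ^ 2)
      = Real.exp ((n + 2) * s) * (2 * (ballHeight u s + ballFlux u s)) := by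
  have hu := h.continuous_left
  have hr := h.continuous_radial
  have hd : Continuous fun x => u x * (fderiv ℝ u x x - u x) := by fun_prop
  rw [h.integral_energyDens_mul (Real.exp_pos s)]
  have e1 : ballMean (fun x => u x * fderiv ℝ u x x) s
      = ballMean (fun x => u x ^ 2) s + ballMean (fun x => u x * (fderiv ℝ u x x - u x)) s := by
    rw [← ballMean_add h.continuous_sq_left hd]
    congr 1
    ext x
    ring
  have e2 := ballMean_eq (fun x => u x * fderiv ℝ u x x) s
  have e3 : Real.exp ((n + 2) * s) * Real.exp (-2 * s) * Real.exp (-n * s) = 1 := by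
    rw [← Real.exp_add, ← Real.exp_add, ← Real.exp_zero]
    ring_nf
  calc _ = (Real.exp ((n + 2) * s) * Real.exp (-2 * s) * Real.exp (-n * s))
      * (2 * ∫ x in ball (0 : 𝔼) (Real.exp s), u x * fderiv ℝ u x x) := by rw [e3, one_mul]
    _ = Real.exp ((n + 2) * s) * Real.exp (-2 * s)
      * (2 * ballMean (fun x => u x * fderiv ℝ u x x) s) := by rw [e2]; ring
    _ = _ := by rw [e1]; unfold ballHeight ballFlux; ring

end IsLinearSolution

theorem setIntegral_ball_mul_sub {g : 𝔼 → ℝ} (hg : Continuous g) (h0 : ∀ x, 0 ≤ g x) {r R : ℝ}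
    (hr : 0 < r) (hrR : r ≤ R) :
    (R ^ 2 - r ^ 2) * (∫ x in ball (0 : 𝔼) r, g x)
      ≤ (∫ x in ball (0 : 𝔼) R, g x * (R ^ 2 - ‖x‖ ^ 2))
        - ∫ x in ball (0 : 𝔼) r, g x * (r ^ 2 - ‖x‖ ^ 2) ∧
    (∫ x in ball (0 : 𝔼) R, g x * (R ^ 2 - ‖x‖ ^ 2))
        - (∫ x in ball (0 : 𝔼) r, g x * (r ^ 2 - ‖x‖ ^ 2))
      ≤ (R ^ 2 - r ^ 2) * ∫ x in ball (0 : 𝔼) R, g x := by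
  have hsub : ball (0 : 𝔼) r ⊆ ball 0 R := ball_subset_ball hrR
  have iR : IntegrableOn (fun x => g x * (R ^ 2 - ‖x‖ ^ 2)) (ball (0 : 𝔼) R) :=
    integrableOn_ball (by fun_prop) R
  have ir : IntegrableOn (fun x => g x * (r ^ 2 - ‖x‖ ^ 2)) (ball (0 : 𝔼) r) :=
    integrableOn_ball (by fun_prop) r
  have iRr : IntegrableOn (fun x => g x * (R ^ 2 - ‖x‖ ^ 2)) (ball (0 : 𝔼) r) :=
    integrableOn_ball (by fun_prop) r
  have ig := integrableOn_ball hg R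
  have h1 := setIntegral_sdiff measurableSet_ball iR hsub
  have h2 := setIntegral_sdiff measurableSet_ball ig hsub
  have h3 : (∫ x in ball (0 : 𝔼) r, g x * (R ^ 2 - ‖x‖ ^ 2))
      - (∫ x in ball (0 : 𝔼) r, g x * (r ^ 2 - ‖x‖ ^ 2))
      = (R ^ 2 - r ^ 2) * ∫ x in ball (0 : 𝔼) r, g x := by
    rw [← integral_sub iRr ir, ← integral_const_mul]
    refine integral_congr_ae (ae_of_all _ fun x => ?_)
    simp only
    ring
  have hms : MeasurableSet (ball (0 : 𝔼) R \ ball 0 r) := measurableSet_ball.diff measurableSet_ball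
  have h4 : 0 ≤ ∫ x in ball (0 : 𝔼) R \ ball 0 r, g x * (R ^ 2 - ‖x‖ ^ 2) := by
    refine setIntegral_nonneg hms fun x hx => mul_nonneg (h0 x) ?_
    have := hx.1
    rw [mem_ball_zero_iff] at this
    nlinarith [norm_nonneg x]
  have h5 : ∫ x in ball (0 : 𝔼) R \ ball 0 r, g x * (R ^ 2 - ‖x‖ ^ 2)
      ≤ (R ^ 2 - r ^ 2) * ∫ x in ball (0 : 𝔼) R \ ball 0 r, g x := by
    rw [← integral_const_mul]
    refine setIntegral_mono_on (iR.mono_set Set.sdiff_subset)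
      ((ig.mono_set Set.sdiff_subset).const_mul _) hms fun x hx => ?_
    have := hx.2
    rw [mem_ball_zero_iff, not_lt] at this
    have := h0 x
    rw [mul_comm]
    refine mul_le_mul_of_nonneg_right ?_ this
    nlinarith
  rw [h2] at h5
  constructor <;> linarith

end RadialEnergy

section EnergyMean

open Filter Topology

theorem tendsto_exp_mul_sub_one_div (k : ℝ) :
    Tendsto (fun σ : ℝ => (Real.exp (k * σ) - 1) / (Real.exp (2 * σ) - 1)) (𝓝[>] 0)
      (𝓝 (k / 2)) := by
  have h : ∀ k : ℝ, Tendsto (fun σ : ℝ => σ⁻¹ * (Real.exp (k * σ) - 1)) (𝓝[>] 0) (𝓝 k) := by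
    intro k
    have h1 : HasDerivAt (fun σ : ℝ => Real.exp (k * σ)) k 0 := by
      simpa using ((hasDerivAt_id (0 : ℝ)).const_mul k).exp
    have h2 := (hasDerivAt_iff_tendsto_slope_zero.1 h1).mono_left
      (nhdsWithin_mono 0 fun x (hx : x ∈ Set.Ioi (0 : ℝ)) => ne_of_gt hx)
    simpa using h2
  refine ((h k).div (h 2) two_ne_zero).congr' ?_
  filter_upwards [self_mem_nhdsWithin] with σ hσ
  have hσ' : (0 : ℝ) < σ := hσ
  exact mul_div_mul_left _ _ (inv_ne_zero hσ'.ne')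

/-- A function pinched by increments of a slowly varying function is asymptotic to a multiple of
that function. -/
theorem tendsto_sub_of_pinched {M z : ℝ → ℝ} {n B : ℝ}
    (hz : ∀ σ, Tendsto (fun s => z (s + σ) - z s) atTop (𝓝 0))
    (hB : ∀ᶠ s in atTop, |z s| ≤ B)
    (hlow : ∀ σ s, 0 < σ → (Real.exp (2 * σ) - 1) * M s ≤ Real.exp ((n + 2) * σ) * z (s + σ) - z s)
    (hup : ∀ σ s, 0 < σ → Real.exp ((n + 2) * σ) * z (s + σ) - z s
      ≤ (Real.exp (2 * σ) - 1) * (Real.exp (n * σ) * M (s + σ))) :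
    Tendsto (fun s => M s - (n + 2) / 2 * z s) atTop (𝓝 0) := by
  have hB0 : 0 ≤ B := by
    obtain ⟨s, hs⟩ := hB.exists
    exact (abs_nonneg _).trans hs
  rw [Metric.tendsto_nhds]
  intro ε hε
  have ha := tendsto_exp_mul_sub_one_div (n + 2)
  have hb : Tendsto (fun σ : ℝ => Real.exp (-n * σ)
      * ((Real.exp ((n + 2) * σ) - 1) / (Real.exp (2 * σ) - 1))) (𝓝[>] 0) (𝓝 ((n + 2) / 2)) := by
    have h1 : Tendsto (fun σ : ℝ => Real.exp (-n * σ)) (𝓝[>] 0) (𝓝 1) := by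
      have : Continuous fun σ : ℝ => Real.exp (-n * σ) := by fun_prop
      simpa using (this.tendsto 0).mono_left nhdsWithin_le_nhds
    simpa using h1.mul ha
  have hε' : 0 < ε / (2 * (B + 1)) := by positivity
  obtain ⟨σ, ⟨hσa, hσb⟩, hσ⟩ := (((Metric.tendsto_nhds.1 ha _ hε').and
    (Metric.tendsto_nhds.1 hb _ hε')).and self_mem_nhdsWithin).exists
  have hσ' : (0 : ℝ) < σ := hσ
  set E := Real.exp (2 * σ) - 1 with hE
  have hE0 : 0 < E := by
    have := Real.add_one_lt_exp (show 2 * σ ≠ 0 by positivity)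
    simp only [hE]
    linarith
  set P := Real.exp ((n + 2) * σ) with hP
  set Q := Real.exp (-n * σ) with hQ
  have hQn : Q * Real.exp (n * σ) = 1 := by
    rw [hQ, ← Real.exp_add]
    simp
  have hQ0 : 0 < Q := Real.exp_pos _
  have h1 : ∀ᶠ s in atTop, P / E * (z (s + σ) - z s) < ε / 2 := by
    have := (hz σ).const_mul (P / E)
    rw [mul_zero] at this
    exact this.eventually (gt_mem_nhds (half_pos hε))
  have h2 : ∀ᶠ s in atTop, -(ε / 2) < -(Q / E) * (z (s + -σ) - z s) := by
    have := (hz (-σ)).const_mul (-(Q / E))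
    rw [mul_zero] at this
    exact this.eventually (lt_mem_nhds (by linarith))
  have habs : ∀ a, dist a ((n + 2) / 2) < ε / (2 * (B + 1)) → ∀ s, |z s| ≤ B →
      |(a - (n + 2) / 2) * z s| ≤ ε / 2 := by
    intro a h s hs
    rw [Real.dist_eq] at h
    rw [abs_mul]
    calc _ ≤ ε / (2 * (B + 1)) * (B + 1) :=
          mul_le_mul h.le (by linarith) (abs_nonneg _) hε'.le
      _ = ε / 2 := by field_simp
  filter_upwards [h1, h2, hB] with s h1 h2 hs
  have h3 := abs_le.1 (habs _ hσa s hs)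
  have h4 := abs_le.1 (habs _ hσb s hs)
  have h5 := hlow σ s hσ'
  have h6 := hup σ (s + -σ) hσ'
  rw [neg_add_cancel_right] at h6
  have h7 : M s ≤ P / E * (z (s + σ) - z s) + (P - 1) / E * z s := by
    have : P / E * (z (s + σ) - z s) + (P - 1) / E * z s = (P * z (s + σ) - z s) / E := by
      field_simp
      ring
    rw [this, le_div_iff₀ hE0]
    linarith
  have h8 : -(Q / E) * (z (s + -σ) - z s) + Q * ((P - 1) / E) * z s ≤ M s := by
    have e1 : -(Q / E) * (z (s + -σ) - z s) + Q * ((P - 1) / E) * z s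
        = Q * (P * z s - z (s + -σ)) / E := by
      field_simp
      ring
    rw [e1, div_le_iff₀ hE0]
    have e2 : M s * E = Q * (E * (Real.exp (n * σ) * M s)) := by
      calc _ = (Q * Real.exp (n * σ)) * (E * M s) := by rw [hQn]; ring
        _ = _ := by ring
    rw [e2]
    exact mul_le_mul_of_nonneg_left h6 hQ0.le
  rw [Real.dist_eq, sub_zero, abs_lt]
  constructor <;> linarith

variable {n : ℕ}

local notation "𝔼" => EuclideanSpace ℝ (Fin n)

theorem setIntegral_ball_exp (g : 𝔼 → ℝ) (s : ℝ) :
    ∫ x in ball (0 : 𝔼) (Real.exp s), g x = Real.exp (n * s) * ballMean g s := by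
  rw [ballMean_eq, ← mul_assoc, ← Real.exp_add]
  simp

namespace IsLinearSolution

variable {u v : EuclideanSpace ℝ (Fin n) → ℝ}

theorem tendsto_ballMean_energyDens_sub (h : IsLinearSolution u v) :
    Tendsto (fun s => ballMean (energyDens u v) s - (n + 2) * ballHeight u s) atTop (𝓝 0) := by
  obtain ⟨K, hK, hb⟩ := h.exists_ballHeight_le
  have hF := h.tendsto_ballFlux
  have hFσ : ∀ σ : ℝ, Tendsto (fun s => ballFlux u (s + σ)) atTop (𝓝 0) := fun σ =>
    hF.comp (tendsto_atTop_add_const_right atTop σ tendsto_id)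
  have hsand : ∀ σ s : ℝ, 0 < σ →
      (Real.exp (2 * σ) - 1) * ballMean (energyDens u v) s
        ≤ Real.exp ((n + 2) * σ) * (2 * (ballHeight u (s + σ) + ballFlux u (s + σ)))
          - 2 * (ballHeight u s + ballFlux u s) ∧
      Real.exp ((n + 2) * σ) * (2 * (ballHeight u (s + σ) + ballFlux u (s + σ)))
          - 2 * (ballHeight u s + ballFlux u s)
        ≤ (Real.exp (2 * σ) - 1) * (Real.exp (n * σ) * ballMean (energyDens u v) (s + σ)) := by
    intro σ s hσ
    have h1 := setIntegral_ball_mul_sub h.continuous_energyDens (energyDens_nonneg u v)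
      (Real.exp_pos s) (Real.exp_le_exp.2 (show s ≤ s + σ by linarith))
    rw [h.integral_energyDens_mul_exp, h.integral_energyDens_mul_exp, setIntegral_ball_exp,
      setIntegral_ball_exp] at h1
    have e1 : Real.exp (s + σ) ^ 2 - Real.exp s ^ 2
        = Real.exp (2 * s) * (Real.exp (2 * σ) - 1) := by
      rw [Real.exp_add, two_mul, two_mul, Real.exp_add, Real.exp_add]
      ring
    have e2 : Real.exp ((n + 2) * (s + σ)) = Real.exp (2 * s) * Real.exp (n * s)
        * Real.exp ((n + 2) * σ) := by
      rw [← Real.exp_add, ← Real.exp_add]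
      ring_nf
    have e3 : Real.exp ((n + 2) * s) = Real.exp (2 * s) * Real.exp (n * s) := by
      rw [← Real.exp_add]
      ring_nf
    have e4 : Real.exp (n * (s + σ)) = Real.exp (n * s) * Real.exp (n * σ) := by
      rw [← Real.exp_add]
      ring_nf
    rw [e1, e2, e3, e4] at h1
    have hp : 0 < Real.exp (2 * s) * Real.exp (n * s) := by positivity
    constructor
    · refine le_of_mul_le_mul_left ?_ hp
      linarith [h1.1]
    · refine le_of_mul_le_mul_left ?_ hp
      linarith [h1.2]
  have h2 := tendsto_sub_of_pinched (n := n) (B := 2 * (2 * K + 1))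
    (M := ballMean (energyDens u v)) (z := fun s => 2 * (ballHeight u s + ballFlux u s))
    (fun σ => by
      have := ((h.tendsto_ballHeight_sub σ).add ((hFσ σ).sub hF)).const_mul 2
      simp only [sub_zero, add_zero, mul_zero] at this
      refine this.congr fun s => ?_
      ring) ?_ (fun σ s hσ => (hsand σ s hσ).1) (fun σ s hσ => (hsand σ s hσ).2)
  · have h3 := h2.add (hF.const_mul ((n : ℝ) + 2))
    simp only [mul_zero, add_zero] at h3
    refine h3.congr fun s => ?_
    ring
  · filter_upwards [eventually_ge_atTop 0, Metric.tendsto_nhds.1 hF 1 one_pos] with s hs hf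
    have h4 := hb s
    have h5 : Real.exp (-2 * s) ≤ 1 := Real.exp_le_one_iff.2 (by linarith)
    have h6 := ballHeight_nonneg u s
    rw [Real.dist_eq, sub_zero] at hf
    have h7 := abs_lt.1 hf
    have h8 : ballHeight u s ≤ 2 * K := h4.trans (by nlinarith)
    rw [abs_le]
    constructor <;> linarith [h7.1, h7.2]

end IsLinearSolution

end EnergyMean

section WeightedEnergy

open Filter Topology

variable {n : ℕ}

local notation "𝔼" => EuclideanSpace ℝ (Fin n)

/-- The scale-invariant Green-weighted energy over the ball of radius `e ^ s`. -/
def weightedEnergy (u v : 𝔼 → ℝ) (s : ℝ) : ℝ :=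
  ∫ y in ball (0 : 𝔼) 1, energyDens u v (Real.exp s • y) * ‖y‖ ^ ((2 : ℝ) - n)

/-- The truncated Green kernel `ρ ^ (2 - n) - 1` on the unit interval. -/
def greenKernel (n : ℕ) : ℝ → ℝ :=
  (Set.Ioo (0 : ℝ) 1).indicator fun ρ => ρ ^ ((2 : ℝ) - n) - 1

/-- Minus the derivative of `greenKernel`. -/
def greenKernelDeriv (n : ℕ) : ℝ → ℝ :=
  (Set.Ioo (0 : ℝ) 1).indicator fun ρ => ((n : ℝ) - 2) * ρ ^ ((1 : ℝ) - n)

theorem measurable_greenKernel : Measurable (greenKernel n) :=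
  (by fun_prop : Measurable fun ρ : ℝ => ρ ^ ((2 : ℝ) - n) - 1).indicator measurableSet_Ioo

theorem measurable_greenKernelDeriv : Measurable (greenKernelDeriv n) :=
  (by fun_prop : Measurable fun ρ : ℝ => ((n : ℝ) - 2) * ρ ^ ((1 : ℝ) - n)).indicator
    measurableSet_Ioo

theorem greenKernel_nonneg (hn : 2 ≤ n) (r : ℝ) : 0 ≤ greenKernel n r := by
  have hn' : (2 : ℝ) ≤ n := by exact_mod_cast hn
  refine Set.indicator_nonneg (fun ρ hρ => ?_) r
  exact sub_nonneg.2 (Real.one_le_rpow_of_pos_of_le_one_of_nonpos hρ.1 hρ.2.le (by linarith))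

theorem greenKernelDeriv_nonneg (hn : 2 ≤ n) (r : ℝ) : 0 ≤ greenKernelDeriv n r := by
  have hn' : (2 : ℝ) ≤ n := by exact_mod_cast hn
  refine Set.indicator_nonneg (fun ρ hρ => ?_) r
  exact mul_nonneg (by linarith) (Real.rpow_nonneg hρ.1.le _)

theorem lintegral_greenKernelDeriv (hn : 2 ≤ n) (r : ℝ) (hr : 0 < r) :
    ∫⁻ t in Set.Ioi r, ENNReal.ofReal (greenKernelDeriv n t)
      = ENNReal.ofReal (greenKernel n r) := by
  have hn' : (2 : ℝ) ≤ n := by exact_mod_cast hn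
  rcases lt_or_ge r 1 with h1 | h1
  · have hd : ∀ t ∈ Set.uIcc r 1, HasDerivAt (fun t : ℝ => -t ^ ((2 : ℝ) - n))
        (((n : ℝ) - 2) * t ^ ((1 : ℝ) - n)) t := fun t ht => by
      rw [Set.uIcc_of_le h1.le] at ht
      refine ((Real.hasDerivAt_rpow_const (p := (2 : ℝ) - n)
        (Or.inl (hr.trans_le ht.1).ne')).neg).congr_deriv ?_
      rw [show (2 : ℝ) - n - 1 = 1 - n by ring]
      ring
    have hc : ContinuousOn (fun t : ℝ => ((n : ℝ) - 2) * t ^ ((1 : ℝ) - n)) (Set.uIcc r 1) := by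
      rw [Set.uIcc_of_le h1.le]
      exact continuousOn_const.mul (continuousOn_id.rpow_const fun t ht =>
        Or.inl (hr.trans_le ht.1).ne')
    have h2 := intervalIntegral.integral_eq_sub_of_hasDerivAt hd hc.intervalIntegrable
    rw [intervalIntegral.integral_of_le h1.le, integral_Ioc_eq_integral_Ioo] at h2
    have hio : IntegrableOn (fun t : ℝ => ((n : ℝ) - 2) * t ^ ((1 : ℝ) - n)) (Set.Ioo r 1) := by
      rw [Set.uIcc_of_le h1.le] at hc
      exact hc.integrableOn_Icc.mono_set Set.Ioo_subset_Icc_self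
    have e1 : ∫⁻ t in Set.Ioi r, ENNReal.ofReal (greenKernelDeriv n t)
        = ∫⁻ t in Set.Ioo r 1, ENNReal.ofReal (((n : ℝ) - 2) * t ^ ((1 : ℝ) - n)) := by
      rw [← lintegral_indicator measurableSet_Ioi, ← lintegral_indicator measurableSet_Ioo]
      refine lintegral_congr fun t => ?_
      unfold greenKernelDeriv
      by_cases ht : r < t
      · by_cases ht1 : t < 1
        · simp [ht, ht1, hr.trans ht]
        · simp [ht, ht1]
      · simp [ht]
    rw [e1, ← ofReal_integral_eq_lintegral_ofReal hio
      ((ae_restrict_iff' measurableSet_Ioo).2 (ae_of_all _ fun t ht =>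
        mul_nonneg (by linarith) (Real.rpow_nonneg (hr.trans ht.1).le _))), h2, greenKernel,
      Set.indicator_of_mem (show r ∈ Set.Ioo (0 : ℝ) 1 from ⟨hr, h1⟩), Real.one_rpow]
    ring_nf
  · rw [greenKernel, Set.indicator_of_notMem (fun h => absurd h.2 (not_lt.2 h1)),
      ENNReal.ofReal_zero]
    refine (setLIntegral_congr_fun measurableSet_Ioi (g := fun _ => 0) fun t ht => ?_).trans (by simp)
    have ht' : r < t := ht
    simp only [greenKernelDeriv]
    rw [Set.indicator_of_notMem (fun h => absurd h.2 (not_lt.2 (h1.trans ht'.le))),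
      ENNReal.ofReal_zero]

theorem greenKernelDeriv_mul (m : ℝ → ℝ) (s r : ℝ) :
    greenKernelDeriv n r * (r ^ n * m (s + Real.log r))
      = (Set.Ioo (0 : ℝ) 1).indicator (fun r => ((n : ℝ) - 2) * (r * m (s + Real.log r))) r := by
  unfold greenKernelDeriv
  by_cases hr : r ∈ Set.Ioo (0 : ℝ) 1
  · rw [Set.indicator_of_mem hr, Set.indicator_of_mem hr]
    have e : r ^ ((1 : ℝ) - n) * r ^ n = r := by
      rw [← Real.rpow_natCast r n, ← Real.rpow_add hr.1]
      simp
    calc _ = ((n : ℝ) - 2) * ((r ^ ((1 : ℝ) - n) * r ^ n) * m (s + Real.log r)) := by ring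
      _ = _ := by rw [e]
  · rw [Set.indicator_of_notMem hr, Set.indicator_of_notMem hr, zero_mul]

theorem setIntegral_Ioo_id : ∫ r in Set.Ioo (0 : ℝ) 1, r = 1 / 2 := by
  rw [← integral_Ioc_eq_integral_Ioo, ← intervalIntegral.integral_of_le zero_le_one, integral_id]
  norm_num

namespace IsLinearSolution

variable {u v : EuclideanSpace ℝ (Fin n) → ℝ}

theorem tendsto_ballMean_energyDens_add_sub (h : IsLinearSolution u v) (σ : ℝ) :
    Tendsto (fun s => ballMean (energyDens u v) (s + σ) - ballMean (energyDens u v) s) atTop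
      (𝓝 0) := by
  have h1 := h.tendsto_ballMean_energyDens_sub
  have h2 := h1.comp (tendsto_atTop_add_const_right atTop σ tendsto_id)
  have h3 := (h2.sub h1).add ((h.tendsto_ballHeight_sub σ).const_mul ((n : ℝ) + 2))
  simp only [sub_zero, add_zero, mul_zero] at h3
  refine h3.congr fun s => ?_
  simp only [Function.comp, id]
  ring

theorem exists_ballMean_energyDens_le (h : IsLinearSolution u v) :
    ∃ K > 0, ∀ s, ballMean (energyDens u v) s ≤ K := by
  obtain ⟨K, hK, hb⟩ := h.exists_ballHeight_le
  obtain ⟨s₀, hs₀⟩ := eventually_atTop.1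
    (Metric.tendsto_nhds.1 h.tendsto_ballMean_energyDens_sub 1 one_pos)
  obtain ⟨C, hC⟩ := (isCompact_closedBall (0 : 𝔼)
    (Real.exp (max s₀ 0))).exists_bound_of_continuousOn h.continuous_energyDens.continuousOn
  have hC0 : 0 ≤ C := (norm_nonneg _).trans (hC 0 (by simp [(Real.exp_pos _).le]))
  have hV : 0 ≤ (volume : Measure 𝔼).real (ball 0 1) := ENNReal.toReal_nonneg
  have hn : (0 : ℝ) ≤ n := Nat.cast_nonneg n
  refine ⟨C * (volume : Measure 𝔼).real (ball 0 1) + ((n + 2) * (2 * K) + 1), by positivity,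
    fun s => ?_⟩
  rcases le_or_gt s (max s₀ 0) with hs | hs
  · have h1 : ballMean (energyDens u v) s ≤ C * (volume : Measure 𝔼).real (ball 0 1) := by
      have h2 := norm_setIntegral_le_of_norm_le_const (μ := (volume : Measure 𝔼)) (C := C)
        (f := fun y => energyDens u v (Real.exp s • y)) (s := ball (0 : 𝔼) 1)
        measure_ball_lt_top fun y hy => hC _ (by
          rw [mem_ball_zero_iff] at hy
          rw [mem_closedBall_zero_iff, norm_smul, Real.norm_of_nonneg (Real.exp_pos _).le]
          have := Real.exp_le_exp.2 hs
          nlinarith [Real.exp_pos s, norm_nonneg y])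
      exact (Real.le_norm_self _).trans h2
    have : 0 ≤ (n + 2) * (2 * K) + 1 := by positivity
    linarith
  · have h1 := hs₀ s ((le_max_left _ _).trans hs.le)
    have h0 : 0 ≤ s := (le_max_right _ _).trans hs.le
    rw [Real.dist_eq, sub_zero] at h1
    have h2 := (abs_lt.1 h1).2
    have h3 := hb s
    have h4 : Real.exp (-2 * s) ≤ 1 := Real.exp_le_one_iff.2 (by linarith)
    have h5 : ballHeight u s ≤ 2 * K := h3.trans (by nlinarith)
    have h6 : (n + 2) * ballHeight u s ≤ (n + 2) * (2 * K) :=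
      mul_le_mul_of_nonneg_left h5 (by positivity)
    have : 0 ≤ C * (volume : Measure 𝔼).real (ball 0 1) := by positivity
    linarith

theorem integrableOn_mul_ballMean_energyDens (h : IsLinearSolution u v) (s : ℝ) :
    IntegrableOn (fun r => r * ballMean (energyDens u v) (s + Real.log r)) (Set.Ioo 0 1) := by
  obtain ⟨K, hK, hb⟩ := h.exists_ballMean_energyDens_le
  refine Integrable.mono' (g := fun _ => K) (integrableOn_const (by simp)) ?_ ?_
  · exact (measurable_id.mul ((continuous_ballMean h.continuous_energyDens).measurable.comp
      (measurable_const.add Real.measurable_log))).aestronglyMeasurable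
  · refine (ae_restrict_iff' measurableSet_Ioo).2 (ae_of_all _ fun r hr => ?_)
    have h1 := ballMean_nonneg (energyDens_nonneg u v) (s + Real.log r)
    rw [Real.norm_of_nonneg (mul_nonneg hr.1.le h1)]
    exact (mul_le_of_le_one_left h1 hr.2.le).trans (hb _)

theorem weightedEnergy_eq (hn : 2 ≤ n) (h : IsLinearSolution u v) (s : ℝ) :
    weightedEnergy u v s = ballMean (energyDens u v) s
      + (n - 2) * ∫ r in Set.Ioo (0 : ℝ) 1, r * ballMean (energyDens u v) (s + Real.log r) := by
  have hc := h.continuous_energyDens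
  have hne : Nonempty (Fin n) := ⟨⟨0, by omega⟩⟩
  have e0 : (fun r : ℝ => greenKernelDeriv n r * (r ^ n * ballMean (energyDens u v)
      (s + Real.log r))) = (Set.Ioo (0 : ℝ) 1).indicator
        (fun r => ((n : ℝ) - 2) * (r * ballMean (energyDens u v) (s + Real.log r))) :=
    funext fun r => greenKernelDeriv_mul _ s r
  have hi := integrable_mul_radial (by omega) hc (energyDens_nonneg u v)
    measurable_greenKernelDeriv (fun r _ => greenKernelDeriv_nonneg hn r) measurable_greenKernel
    (fun r _ => greenKernel_nonneg hn r) (lintegral_greenKernelDeriv hn) s (by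
      rw [e0]
      have hr : IntegrableOn (fun r : ℝ => ((n : ℝ) - 2) * (r * ballMean (energyDens u v)
          (s + Real.log r))) (Set.Ioo 0 1) :=
        (h.integrableOn_mul_ballMean_energyDens s).const_mul _
      exact (hr.integrable_indicator measurableSet_Ioo).integrableOn)
  have h1 := integral_mul_radial (by omega) hc (energyDens_nonneg u v)
    measurable_greenKernelDeriv (fun r _ => greenKernelDeriv_nonneg hn r) measurable_greenKernel
    (fun r _ => greenKernel_nonneg hn r) (lintegral_greenKernelDeriv hn) s
  rw [e0, setIntegral_indicator measurableSet_Ioo,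
    Set.inter_eq_right.2 Set.Ioo_subset_Ioi_self, integral_const_mul] at h1
  rw [← h1]
  have e2 : ∫ y : 𝔼, energyDens u v (Real.exp s • y) * greenKernel n ‖y‖
      = ∫ y in ball (0 : 𝔼) 1, energyDens u v (Real.exp s • y) * greenKernel n ‖y‖ := by
    refine (setIntegral_eq_integral_of_forall_compl_eq_zero fun y hy => ?_).symm
    rw [mem_ball_zero_iff] at hy
    rw [greenKernel, Set.indicator_of_notMem (fun h => hy h.2), mul_zero]
  rw [e2, ballMean, ← integral_add (integrableOn_ball_comp_smul hc _ _) hi.integrableOn]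
  refine setIntegral_congr_ae measurableSet_ball ?_
  have h2 : ∀ᵐ y : 𝔼, y ≠ 0 := Measure.ae_ne volume 0
  filter_upwards [h2] with y hy hy1
  rw [mem_ball_zero_iff] at hy1
  rw [greenKernel, Set.indicator_of_mem (show ‖y‖ ∈ Set.Ioo (0 : ℝ) 1 from
    ⟨norm_pos_iff.2 hy, hy1⟩)]
  ring

theorem ballMean_le_weightedEnergy (hn : 2 ≤ n) (h : IsLinearSolution u v) (s : ℝ) :
    ballMean (energyDens u v) s ≤ weightedEnergy u v s := by
  have hn' : (2 : ℝ) ≤ n := by exact_mod_cast hn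
  rw [h.weightedEnergy_eq hn]
  refine le_add_of_nonneg_right (mul_nonneg (by linarith) ?_)
  exact setIntegral_nonneg measurableSet_Ioo fun r hr =>
    mul_nonneg hr.1.le (ballMean_nonneg (energyDens_nonneg u v) _)

theorem exists_weightedEnergy_le (hn : 2 ≤ n) (h : IsLinearSolution u v) :
    ∃ K > 0, ∀ s, weightedEnergy u v s ≤ K := by
  have hn' : (2 : ℝ) ≤ n := by exact_mod_cast hn
  obtain ⟨K, hK, hb⟩ := h.exists_ballMean_energyDens_le
  refine ⟨K + (n - 2) * (1 / 2 * K), add_pos_of_pos_of_nonneg hK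
    (mul_nonneg (by linarith) (by positivity)), fun s => ?_⟩
  rw [h.weightedEnergy_eq hn]
  refine add_le_add (hb s) (mul_le_mul_of_nonneg_left ?_ (by linarith))
  rw [← setIntegral_Ioo_id, ← integral_mul_const]
  refine setIntegral_mono_on (h.integrableOn_mul_ballMean_energyDens s) ?_ measurableSet_Ioo
    fun r hr => mul_le_mul_of_nonneg_left (hb _) hr.1.le
  have : Continuous fun r : ℝ => r * K := by fun_prop
  exact this.continuousOn.integrableOn_Icc.mono_set Set.Ioo_subset_Icc_self

theorem tendsto_weightedEnergy_sub (hn : 2 ≤ n) (h : IsLinearSolution u v) :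
    Tendsto (fun s => weightedEnergy u v s - n / 2 * ballMean (energyDens u v) s) atTop
      (𝓝 0) := by
  obtain ⟨K, hK, hb⟩ := h.exists_ballMean_energyDens_le
  have hcm := continuous_ballMean h.continuous_energyDens
  have h0 := ballMean_nonneg (energyDens_nonneg u v)
  have key : Tendsto (fun s => ∫ r in Set.Ioo (0 : ℝ) 1, r * (ballMean (energyDens u v)
      (s + Real.log r) - ballMean (energyDens u v) s)) atTop
      (𝓝 (∫ r in Set.Ioo (0 : ℝ) 1, (0 : ℝ))) := by
    refine tendsto_integral_filter_of_dominated_convergence (fun _ => K) ?_ ?_ ?_ ?_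
    · refine Eventually.of_forall fun s => Measurable.aestronglyMeasurable ?_
      exact measurable_id.mul ((hcm.measurable.comp
        (measurable_const.add Real.measurable_log)).sub measurable_const)
    · refine Eventually.of_forall fun s => ?_
      refine (ae_restrict_iff' measurableSet_Ioo).2 (ae_of_all _ fun r hr => ?_)
      rw [norm_mul, Real.norm_of_nonneg hr.1.le]
      refine (mul_le_of_le_one_left (norm_nonneg _) hr.2.le).trans ?_
      rw [Real.norm_eq_abs, abs_le]
      have h1 := h0 (s + Real.log r)
      have h2 := h0 s
      have h3 := hb (s + Real.log r)
      have h4 := hb s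
      constructor <;> linarith
    · exact integrableOn_const (by simp)
    · refine ae_of_all _ fun r => ?_
      simpa using (h.tendsto_ballMean_energyDens_add_sub (Real.log r)).const_mul r
  rw [integral_zero] at key
  have h1 := key.const_mul ((n : ℝ) - 2)
  rw [mul_zero] at h1
  refine h1.congr fun s => ?_
  have i1 : IntegrableOn (fun r : ℝ => r * ballMean (energyDens u v) s) (Set.Ioo 0 1) :=
    (by fun_prop : Continuous fun r : ℝ => r * ballMean (energyDens u v) s).continuousOn
      |>.integrableOn_Icc.mono_set Set.Ioo_subset_Icc_self
  have e : ∫ r in Set.Ioo (0 : ℝ) 1, r * (ballMean (energyDens u v)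
      (s + Real.log r) - ballMean (energyDens u v) s)
      = (∫ r in Set.Ioo (0 : ℝ) 1, r * ballMean (energyDens u v) (s + Real.log r))
        - 1 / 2 * ballMean (energyDens u v) s := by
    rw [← setIntegral_Ioo_id, ← integral_mul_const,
      ← integral_sub (h.integrableOn_mul_ballMean_energyDens s) i1]
    refine integral_congr_ae (ae_of_all _ fun r => ?_)
    simp only
    ring
  rw [e, h.weightedEnergy_eq hn]
  ring

/-- The Green-weighted energy is asymptotic to a universal multiple of the Gaussian height. -/
theorem tendsto_weightedEnergy_sub_height (hn : 2 ≤ n) (h : IsLinearSolution u v) :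
    Tendsto (fun s => weightedEnergy u v s - n / 2 * (n + 2) * (2 * Real.pi) ^ ((n : ℝ) / 2)
      / (∫ r in Set.Ioi (0 : ℝ), r ^ (n + 3) * Real.exp (-r ^ 2 / 2)) * height u s) atTop
      (𝓝 0) := by
  have h1 := h.tendsto_height_sub_ballHeight (by omega)
  have hc := integral_pow_mul_exp_pos (n + 3)
  set c := ∫ r in Set.Ioi (0 : ℝ), r ^ (n + 3) * Real.exp (-r ^ 2 / 2)
  have h2 := ((h.tendsto_weightedEnergy_sub hn).add
    (h.tendsto_ballMean_energyDens_sub.const_mul ((n : ℝ) / 2))).sub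
    (h1.const_mul ((n : ℝ) / 2 * (n + 2) / c))
  simp only [mul_zero, add_zero, sub_zero] at h2
  refine h2.congr fun s => ?_
  field_simp
  ring

theorem ballMean_energyDens_pos (h : IsLinearSolution u v) (s : ℝ) :
    0 < ballMean (energyDens u v) s := by
  have hpos : ∀ x, 0 < energyDens u v x := fun x => by
    have h1 := h.pos_left x
    have h2 := h.pos_right x
    unfold energyDens
    positivity
  unfold ballMean
  refine (setIntegral_pos_iff_support_of_nonneg_ae (ae_of_all _ fun y => (hpos _).le)
    (integrableOn_ball_comp_smul h.continuous_energyDens _ _)).2 ?_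
  have : Function.support (fun y : 𝔼 => energyDens u v (Real.exp s • y)) = Set.univ := by
    ext y
    simp [(hpos _).ne']
  rw [this, Set.univ_inter]
  exact measure_ball_pos _ _ one_pos

end IsLinearSolution

theorem setIntegral_ball_energyDens_mul (u v : 𝔼 → ℝ) (s : ℝ) :
    ∫ y in ball (0 : 𝔼) (Real.exp s), energyDens u v y * ‖0 - y‖ ^ ((2 : ℝ) - n)
      = Real.exp s ^ 2 * weightedEnergy u v s := by
  have hE := Real.exp_pos s
  have h1 := setIntegral_ball_comp_smul (fun y : 𝔼 => energyDens u v y * ‖0 - y‖ ^ ((2 : ℝ) - n))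
    hE 1
  rw [mul_one] at h1
  have e : ∫ y in ball (0 : 𝔼) 1, energyDens u v (Real.exp s • y)
      * ‖0 - Real.exp s • y‖ ^ ((2 : ℝ) - n)
      = Real.exp s ^ ((2 : ℝ) - n) * weightedEnergy u v s := by
    unfold weightedEnergy
    rw [← integral_const_mul]
    refine integral_congr_ae (ae_of_all _ fun y => ?_)
    simp only
    rw [zero_sub, norm_neg, norm_smul, Real.norm_of_nonneg hE.le,
      Real.mul_rpow hE.le (norm_nonneg _)]
    ring
  rw [e, eq_inv_mul_iff_mul_eq₀ (by positivity)] at h1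
  rw [← h1, ← mul_assoc, ← Real.rpow_natCast _ n, ← Real.rpow_add hE]
  congr 1
  rw [add_sub_cancel, Real.rpow_two]

theorem Jfun_exp (u v : 𝔼 → ℝ) (s : ℝ) :
    Jfun u v 0 (Real.exp s) = weightedEnergy u v s * weightedEnergy v u s := by
  have h1 := setIntegral_ball_energyDens_mul u v s
  have h2 := setIntegral_ball_energyDens_mul v u s
  have e : ∀ y, energyDens v u y = ‖gradient v y‖ ^ 2 + u y ^ 2 * v y ^ 2 := fun y => by
    unfold energyDens; ring
  simp only [e] at h2
  simp only [energyDens] at h1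
  unfold Jfun
  rw [h1, h2, Real.rpow_neg (Real.exp_pos s).le, show (4 : ℝ) = (4 : ℕ) by norm_num,
    Real.rpow_natCast]
  have := (Real.exp_pos s).ne'
  field_simp

end WeightedEnergy

open Filter Topology in
theorem IsLinearSolution.tendsto_weightedEnergy_mul {n : ℕ} {u v : EuclideanSpace ℝ (Fin n) → ℝ}
    (hn : 2 ≤ n) (h : IsLinearSolution u v) :
    ∃ L, 0 < L ∧ Tendsto (fun s => weightedEnergy u v s * weightedEnergy v u s) atTop (𝓝 L) := by
  obtain ⟨L, hL, hlim⟩ := h.exists_limit_height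
  obtain ⟨K₁, hK₁, hb₁⟩ := h.exists_height_bound
  obtain ⟨K₂, hK₂, hb₂⟩ := h.symm.exists_weightedEnergy_le hn
  have hu := h.tendsto_weightedEnergy_sub_height hn
  have hv := h.symm.tendsto_weightedEnergy_sub_height hn
  have hc := integral_pow_mul_exp_pos (n + 3)
  have hn0 : (0 : ℝ) < n := by exact_mod_cast (by omega : 0 < n)
  set C : ℝ := n / 2 * (n + 2) * (2 * Real.pi) ^ ((n : ℝ) / 2)
      / (∫ r in Set.Ioi (0 : ℝ), r ^ (n + 3) * Real.exp (-r ^ 2 / 2))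
  have hC : 0 < C := by positivity
  refine ⟨C ^ 2 * L, by positivity, ?_⟩
  have hz : Tendsto (fun s => (weightedEnergy u v s - C * height u s) * weightedEnergy v u s
      + C * height u s * (weightedEnergy v u s - C * height v s)) atTop (𝓝 0) := by
    have hbound : Tendsto (fun s => |weightedEnergy u v s - C * height u s| * K₂
        + C * K₁ * |weightedEnergy v u s - C * height v s|) atTop (𝓝 0) := by
      simpa using (hu.abs.mul_const K₂).add (hv.abs.const_mul (C * K₁))
    refine squeeze_zero_norm' ?_ hbound
    filter_upwards [eventually_ge_atTop 0] with s hs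
    rw [Real.norm_eq_abs]
    refine (abs_add_le _ _).trans (add_le_add ?_ ?_)
    · rw [abs_mul]
      refine mul_le_mul_of_nonneg_left ?_ (abs_nonneg _)
      rw [abs_of_nonneg ((h.symm.ballMean_energyDens_pos s).le.trans
        (h.symm.ballMean_le_weightedEnergy hn s))]
      exact hb₂ s
    · rw [abs_mul, abs_of_nonneg (mul_nonneg hC.le (height_nonneg u s))]
      exact mul_le_mul_of_nonneg_right (mul_le_mul_of_nonneg_left (hb₁ s hs).1 hC.le)
        (abs_nonneg _)
  have h1 := hz.add (hlim.const_mul (C ^ 2))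
  rw [zero_add] at h1
  refine h1.congr fun s => ?_
  ring

theorem exists_pos_le_of_continuous_of_le {f g : ℝ → ℝ} {L : ℝ} (hg : Continuous g)
    (hg0 : ∀ s, 0 < g s) (hfg : ∀ s, g s ≤ f s) (hL : 0 < L)
    (hf : Filter.Tendsto f Filter.atTop (nhds L)) : ∃ c > 0, ∀ s, 0 ≤ s → c ≤ f s := by
  obtain ⟨s₀, hs₀⟩ := Filter.eventually_atTop.1 (hf.eventually (lt_mem_nhds (half_lt_self hL)))
  obtain ⟨a, -, ha⟩ := (isCompact_Icc (a := (0 : ℝ)) (b := max s₀ 0)).exists_isMinOn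
    ⟨0, by simp⟩ hg.continuousOn
  refine ⟨min (L / 2) (g a), lt_min (half_pos hL) (hg0 a), fun s hs => ?_⟩
  rcases le_or_gt s (max s₀ 0) with h | h
  · exact (min_le_right _ _).trans ((ha ⟨hs, h⟩).trans (hfg s))
  · exact (min_le_left _ _).trans (hs₀ s ((le_max_left _ _).trans h.le)).le

theorem IsSolution.isLinearSolution {n : ℕ} {u v : EuclideanSpace ℝ (Fin n) → ℝ}
    (hsol : IsSolution u v) {C₀ : ℝ} (hC₀ : 0 < C₀)
    (hgrowth : ∀ x, u x + v x ≤ C₀ * (1 + ‖x‖)) : IsLinearSolution u v where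
  contDiff_left := contDiff_infty.1 hsol.1 2
  contDiff_right := contDiff_infty.1 hsol.2.1 2
  pos_left := hsol.2.2.1
  pos_right := hsol.2.2.2.1
  lap_left := hsol.2.2.2.2.1
  lap_right := hsol.2.2.2.2.2
  growth := ⟨C₀, hC₀, hgrowth⟩

/-- For an entire solution with linear growth, J(r; 0) is bounded between 1/C and C for r > 1,
and converges to a finite positive limit as r → ∞. -/
theorem J_bounded_and_limit_exists {n : ℕ} (hn : 2 ≤ n)
    (u v : EuclideanSpace ℝ (Fin n) → ℝ) (hsol : IsSolution u v)
    (C₀ : ℝ) (hC₀ : 0 < C₀) (hgrowth : ∀ x, u x + v x ≤ C₀ * (1 + ‖x‖)) :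
    ∃ C : ℝ, 0 < C ∧
      (∀ r : ℝ, 1 < r → 1 / C ≤ Jfun u v 0 r ∧ Jfun u v 0 r ≤ C) ∧
      ∃ L : ℝ, 0 < L ∧
        Filter.Tendsto (fun r : ℝ => Jfun u v 0 r) Filter.atTop (nhds L) := by
  have h := hsol.isLinearSolution hC₀ hgrowth
  obtain ⟨L, hL, hlim⟩ := h.tendsto_weightedEnergy_mul hn
  obtain ⟨K₁, hK₁, hb₁⟩ := h.exists_weightedEnergy_le hn
  obtain ⟨K₂, hK₂, hb₂⟩ := h.symm.exists_weightedEnergy_le hn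
  have hp₁ := h.ballMean_energyDens_pos
  have hp₂ := h.symm.ballMean_energyDens_pos
  have hl₁ := h.ballMean_le_weightedEnergy hn
  have hl₂ := h.symm.ballMean_le_weightedEnergy hn
  obtain ⟨c, hc, hlow⟩ := exists_pos_le_of_continuous_of_le
    (g := fun s => ballMean (energyDens u v) s * ballMean (energyDens v u) s)
    ((continuous_ballMean h.continuous_energyDens).mul
      (continuous_ballMean h.symm.continuous_energyDens))
    (fun s => mul_pos (hp₁ s) (hp₂ s))
    (fun s => mul_le_mul (hl₁ s) (hl₂ s) (hp₂ s).le ((hp₁ s).le.trans (hl₁ s))) hL hlim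
  have hJ : ∀ r : ℝ, 0 < r → Jfun u v 0 r
      = weightedEnergy u v (Real.log r) * weightedEnergy v u (Real.log r) := fun r hr => by
    rw [← Jfun_exp, Real.exp_log hr]
  refine ⟨max (1 / c) (K₁ * K₂), lt_max_of_lt_left (by positivity), fun r hr => ?_, L, hL, ?_⟩
  · have hr0 : 0 < r := one_pos.trans hr
    rw [hJ r hr0]
    constructor
    · refine le_trans ?_ (hlow _ (Real.log_nonneg hr.le))
      rw [one_div_le (lt_max_of_lt_left (by positivity)) hc]
      exact le_max_left _ _
    · exact (mul_le_mul (hb₁ _) (hb₂ _) ((hp₂ _).le.trans (hl₂ _)) hK₁.le).trans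
        (le_max_right _ _)
  · refine (hlim.comp Real.tendsto_log_atTop).congr' ?_
    filter_upwards [Filter.eventually_gt_atTop 0] with r hr
    exact (hJ r hr).symm
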